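/- arXiv:math/0504550 — 2 statements merged into one kernel-verified Lean document; each statement's English description precedes it below -/
import Mathlib

section
/- (Classification theorem.) For n ≥ 2, the space 𝒱 decomposes as the orthogonal direct sum 𝒱 = 𝒬𝒦₁ ⊕ 𝒬𝒦₂ ⊕ 𝒬𝒦₃ ⊕ 𝒬𝒦₄ ⊕ 𝒬𝒦₅: the five subspaces 𝒬𝒦₁, …, 𝒬𝒦₅ are mutually orthogonal with respect to the inner product ⟨S, S′⟩ = Σ S_{e_r e_s e_t} S′_{e_r e_s e_t}, their sum is all of 𝒱, and each of them is invariant and irreducible under the action of the Sp(n)Sp(1)-transformations (the only subspaces of 𝒬𝒦ᵢ invariant under all Sp(n)Sp(1)-transformations are {0} and 𝒬𝒦ᵢ itself). -/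
open scoped RealInnerProductSpace

noncomputable section

/-- Trilinear forms on `V`. -/
abbrev Tri (V : Type) [NormedAddCommGroup V] [InnerProductSpace ℝ V] : Type :=
  V →ₗ[ℝ] V →ₗ[ℝ] V →ₗ[ℝ] ℝ

variable {V : Type} [NormedAddCommGroup V] [InnerProductSpace ℝ V]

/-- `(V, ⟨·,·⟩, J₁, J₂, J₃)` is a quaternion-Hermitian vector space: the `Jₐ` square to `-1`,
satisfy the quaternion relations, and are isometries. -/
def IsQH (J1 J2 J3 : V →ₗ[ℝ] V) : Prop :=
  (∀ X, J1 (J1 X) = -X) ∧ (∀ X, J2 (J2 X) = -X) ∧ (∀ X, J3 (J3 X) = -X) ∧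
  (∀ X, J1 (J2 X) = J3 X) ∧ (∀ X, J2 (J1 X) = -(J3 X)) ∧
  (∀ X, J2 (J3 X) = J1 X) ∧ (∀ X, J3 (J2 X) = -(J1 X)) ∧
  (∀ X, J3 (J1 X) = J2 X) ∧ (∀ X, J1 (J3 X) = -(J2 X)) ∧
  (∀ X Y, ⟪J1 X, J1 Y⟫ = ⟪X, Y⟫) ∧ (∀ X Y, ⟪J2 X, J2 Y⟫ = ⟪X, Y⟫) ∧
  (∀ X Y, ⟪J3 X, J3 Y⟫ = ⟪X, Y⟫)

/-- The space `𝒯(V)` of trilinear forms skew in the last two arguments. -/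
def calT : Set (Tri V) := {S | ∀ X Y Z, S X Y Z = - S X Z Y}

/-- The space `𝒱` of (pointwise) homogeneous quaternionic Kähler structures. -/
def calV (J1 J2 J3 : V →ₗ[ℝ] V) : Set (Tri V) :=
  {S | (∀ X Y Z, S X Y Z = - S X Z Y) ∧
    ∃ π1 π2 π3 : V →ₗ[ℝ] ℝ, ∀ X Y Z : V,
      (S X (J1 Y) (J1 Z) - S X Y Z
        = π3 X * ⟪J2 Y, J1 Z⟫ - π2 X * ⟪J3 Y, J1 Z⟫) ∧
      (S X (J2 Y) (J2 Z) - S X Y Z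
        = π1 X * ⟪J3 Y, J2 Z⟫ - π3 X * ⟪J1 Y, J2 Z⟫) ∧
      (S X (J3 Y) (J3 Z) - S X Y Z
        = π2 X * ⟪J1 Y, J3 Z⟫ - π1 X * ⟪J2 Y, J3 Z⟫)}

/-- The space `𝒱̌`. -/
def calVcheck (J1 J2 J3 : V →ₗ[ℝ] V) : Set (Tri V) :=
  {Θ | ∃ π1 π2 π3 : V →ₗ[ℝ] ℝ, ∀ X Y Z : V,
    Θ X Y Z = (1/2) * (π1 X * ⟪J1 Y, Z⟫ + π2 X * ⟪J2 Y, Z⟫ + π3 X * ⟪J3 Y, Z⟫)}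

/-- The space `𝒱̂`. -/
def calVhat (J1 J2 J3 : V →ₗ[ℝ] V) : Set (Tri V) :=
  {T | (∀ X Y Z, T X Y Z = - T X Z Y) ∧
    (∀ X Y Z, T X (J1 Y) (J1 Z) = T X Y Z) ∧
    (∀ X Y Z, T X (J2 Y) (J2 Z) = T X Y Z) ∧
    (∀ X Y Z, T X (J3 Y) (J3 Z) = T X Y Z)}

/-- Inner product of trilinear forms w.r.t. an orthonormal basis. -/
def tinner {n : ℕ} (e : OrthonormalBasis (Fin (4*n)) ℝ V) (S S' : Tri V) : ℝ :=
  ∑ r, ∑ s, ∑ t, S (e r) (e s) (e t) * S' (e r) (e s) (e t)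

/-- The trace `c₁₂` of a trilinear form w.r.t. an orthonormal basis. -/
def c12 {n : ℕ} (e : OrthonormalBasis (Fin (4*n)) ℝ V) (S : Tri V) (Z : V) : ℝ :=
  ∑ r, S (e r) (e r) Z

/-- `A` is an `Sp(n)Sp(1)`-transformation: an orthogonal map with
`A ∘ Jₐ = Σ_b mₐᵇ J_b ∘ A` for some `m ∈ SO(3)`. -/
def IsSpnSp1 (J1 J2 J3 : V →ₗ[ℝ] V) (A : V ≃ₗᵢ[ℝ] V) : Prop :=
  ∃ m : Matrix (Fin 3) (Fin 3) ℝ, m.transpose * m = 1 ∧ m.det = 1 ∧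
    (∀ X, A (J1 X) = m 0 0 • J1 (A X) + m 0 1 • J2 (A X) + m 0 2 • J3 (A X)) ∧
    (∀ X, A (J2 X) = m 1 0 • J1 (A X) + m 1 1 • J2 (A X) + m 1 2 • J3 (A X)) ∧
    (∀ X, A (J3 X) = m 2 0 • J1 (A X) + m 2 1 • J2 (A X) + m 2 2 • J3 (A X))

/-- Action of an isometry on trilinear forms: `(A(S))_{XYZ} = S_{A⁻¹X,A⁻¹Y,A⁻¹Z}`. -/
def act (A : V ≃ₗᵢ[ℝ] V) (S : Tri V) : Tri V :=
  ((S.comp A.symm.toLinearMap).compl₂ A.symm.toLinearMap).compr₂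
    (LinearMap.lcomp ℝ ℝ A.symm.toLinearMap)

@[simp] theorem act_apply (A : V ≃ₗᵢ[ℝ] V) (S : Tri V) (X Y Z : V) :
    act A S X Y Z = S (A.symm X) (A.symm Y) (A.symm Z) := rfl

/-- `(X,Y,Z) ↦ T(Z,X,Y)` as a trilinear form. -/
def cyc1 (T : Tri V) : Tri V := LinearMap.lflip.comp T.flip

@[simp] theorem cyc1_apply (T : Tri V) (X Y Z : V) : cyc1 T X Y Z = T Z X Y := rfl

/-- `(X,Y,Z) ↦ T(Y,Z,X)` as a trilinear form. -/
def cyc2 (T : Tri V) : Tri V := (LinearMap.lflip.comp T).flip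

@[simp] theorem cyc2_apply (T : Tri V) (X Y Z : V) : cyc2 T X Y Z = T Y Z X := rfl

/-- Precompose the second and third arguments of a trilinear form with `f`. -/
def precomp23 (T : Tri V) (f : V →ₗ[ℝ] V) : Tri V :=
  (T.compl₂ f).compr₂ (LinearMap.lcomp ℝ ℝ f)

@[simp] theorem precomp23_apply (T : Tri V) (f : V →ₗ[ℝ] V) (X Y Z : V) :
    precomp23 T f X Y Z = T X (f Y) (f Z) := rfl

/-- The operator `L` on trilinear forms:
`L(T)_{XYZ} = T_{ZXY} + T_{YZX} + Σₐ (T_{JₐZ,X,JₐY} + T_{JₐY,JₐZ,X})`. -/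
def Lmap (J1 J2 J3 : V →ₗ[ℝ] V) (T : Tri V) : Tri V :=
  cyc1 T + cyc2 T
    + precomp23 (cyc1 T) J1 + precomp23 (cyc1 T) J2 + precomp23 (cyc1 T) J3
    + precomp23 (cyc2 T) J1 + precomp23 (cyc2 T) J2 + precomp23 (cyc2 T) J3

theorem Lmap_apply (J1 J2 J3 : V →ₗ[ℝ] V) (T : Tri V) (X Y Z : V) :
    Lmap J1 J2 J3 T X Y Z
      = T Z X Y + T Y Z X
        + (T (J1 Z) X (J1 Y) + T (J1 Y) (J1 Z) X)
        + (T (J2 Z) X (J2 Y) + T (J2 Y) (J2 Z) X)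
        + (T (J3 Z) X (J3 Y) + T (J3 Y) (J3 Z) X) := by
  simp [Lmap]; ring

/-- The space `𝒱̌₀^⊥ = 𝒬𝒦₁`. -/
def calVcheck0perp (J1 J2 J3 : V →ₗ[ℝ] V) : Set (Tri V) :=
  {Θ | ∃ θ : V →ₗ[ℝ] ℝ, ∀ X Y Z : V,
    Θ X Y Z = θ (J1 X) * ⟪J1 Y, Z⟫ + θ (J2 X) * ⟪J2 Y, Z⟫ + θ (J3 X) * ⟪J3 Y, Z⟫}

/-- The space `𝒱̌₀ = 𝒬𝒦₂`. -/
def calVcheck0 (J1 J2 J3 : V →ₗ[ℝ] V) : Set (Tri V) :=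
  {Θ | ∃ π1 π2 π3 : V →ₗ[ℝ] ℝ,
    (∀ X Y Z : V, Θ X Y Z = π1 X * ⟪J1 Y, Z⟫ + π2 X * ⟪J2 Y, Z⟫ + π3 X * ⟪J3 Y, Z⟫) ∧
    (∀ X : V, π1 (J1 X) + π2 (J2 X) + π3 (J3 X) = 0)}

/-- The values of the tensor `T^θ`. -/
def TthetaForm (J1 J2 J3 : V →ₗ[ℝ] V) (θ : V →ₗ[ℝ] ℝ) (X Y Z : V) : ℝ :=
  ⟪X, Y⟫ * θ Z - ⟪X, Z⟫ * θ Y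
    + (⟪X, J1 Y⟫ * θ (J1 Z) - ⟪X, J1 Z⟫ * θ (J1 Y))
    + (⟪X, J2 Y⟫ * θ (J2 Z) - ⟪X, J2 Z⟫ * θ (J2 Y))
    + (⟪X, J3 Y⟫ * θ (J3 Z) - ⟪X, J3 Z⟫ * θ (J3 Y))

/-- The space `𝒱̂₀^⊥ = 𝒬𝒦₃ = {T^θ : θ ∈ V*}`. -/
def TthetaSet (J1 J2 J3 : V →ₗ[ℝ] V) : Set (Tri V) :=
  {T | ∃ θ : V →ₗ[ℝ] ℝ, ∀ X Y Z : V, T X Y Z = TthetaForm J1 J2 J3 θ X Y Z}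

/-- The space `𝒬𝒦₄`. -/
def QK4set (J1 J2 J3 : V →ₗ[ℝ] V) {n : ℕ} (e : OrthonormalBasis (Fin (4*n)) ℝ V) :
    Set (Tri V) :=
  {T | T ∈ calVhat J1 J2 J3 ∧
    (∀ X Y Z : V, T X Y Z = (1/6) * ((T X Y Z + T Y Z X + T Z X Y)
      + (T X (J1 Y) (J1 Z) + T (J1 Y) (J1 Z) X + T (J1 Z) X (J1 Y))
      + (T X (J2 Y) (J2 Z) + T (J2 Y) (J2 Z) X + T (J2 Z) X (J2 Y))
      + (T X (J3 Y) (J3 Z) + T (J3 Y) (J3 Z) X + T (J3 Z) X (J3 Y)))) ∧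
    (∀ Z, c12 e T Z = 0)}

/-- The space `𝒬𝒦₅`. -/
def QK5set (J1 J2 J3 : V →ₗ[ℝ] V) : Set (Tri V) :=
  {T | T ∈ calVhat J1 J2 J3 ∧ ∀ X Y Z : V, T X Y Z + T Y Z X + T Z X Y = 0}

/-- The family `𝒬𝒦₁, …, 𝒬𝒦₅`. -/
def QKfam (J1 J2 J3 : V →ₗ[ℝ] V) {n : ℕ} (e : OrthonormalBasis (Fin (4*n)) ℝ V) :
    Fin 5 → Set (Tri V) :=
  ![calVcheck0perp J1 J2 J3, calVcheck0 J1 J2 J3, TthetaSet J1 J2 J3,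
    QK4set J1 J2 J3 e, QK5set J1 J2 J3]

section

set_option maxSynthPendingDepth 3
set_option linter.unusedSimpArgs false

/-- A linear map preserving the inner product. -/
def PreservesInner (g : V →ₗ[ℝ] V) : Prop := ∀ X Y, ⟪g X, g Y⟫ = ⟪X, Y⟫

/-- Precompose the three arguments of a trilinear form with `f`, `g`, `h`. -/
def tcomp (f g h : V →ₗ[ℝ] V) (T : Tri V) : Tri V :=
  ((T.comp f).compl₂ g).compr₂ (LinearMap.lcomp ℝ ℝ h)

@[simp] theorem tcomp_apply (f g h : V →ₗ[ℝ] V) (T : Tri V) (X Y Z : V) :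
    tcomp f g h T X Y Z = T (f X) (g Y) (h Z) := rfl

/-- Pull back a trilinear form along a linear map. -/
def pull (g : V →ₗ[ℝ] V) (T : Tri V) : Tri V := tcomp g g g T

@[simp] theorem pull_apply (g : V →ₗ[ℝ] V) (T : Tri V) (X Y Z : V) :
    pull g T X Y Z = T (g X) (g Y) (g Z) := rfl

theorem tri_ext {S T : Tri V} (h : ∀ X Y Z, S X Y Z = T X Y Z) : S = T :=
  LinearMap.ext fun X => LinearMap.ext fun Y => LinearMap.ext fun Z => h X Y Z

section Trace

variable {n : ℕ} (e : OrthonormalBasis (Fin (4 * n)) ℝ V)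

theorem finiteDimensional_of_orthonormalBasis (e : OrthonormalBasis (Fin (4 * n)) ℝ V) :
    FiniteDimensional ℝ V :=
  Module.Basis.finiteDimensional_of_finite e.toBasis

/-- An inner product preserving endomorphism as a linear isometry equivalence. -/
def PreservesInner.toEquiv [FiniteDimensional ℝ V] {g : V →ₗ[ℝ] V} (hg : PreservesInner g) :
    V ≃ₗᵢ[ℝ] V :=
  (g.isometryOfInner hg).toLinearIsometryEquiv rfl

theorem PreservesInner.toEquiv_apply [FiniteDimensional ℝ V] {g : V →ₗ[ℝ] V}
    (hg : PreservesInner g) (X : V) : hg.toEquiv X = g X := rfl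

theorem sum_inner_smul_apply (f : V →ₗ[ℝ] ℝ) (a : V) :
    ∑ r, ⟪a, e r⟫ * f (e r) = f a := by
  conv_rhs => rw [← e.sum_repr' a]
  simp [real_inner_comm]

theorem sum_diag_eq_sum_diag (f : OrthonormalBasis (Fin (4 * n)) ℝ V)
    (β : V →ₗ[ℝ] V →ₗ[ℝ] ℝ) : ∑ r, β (f r) (f r) = ∑ r, β (e r) (e r) := by
  calc ∑ r, β (f r) (f r) = ∑ r, ∑ s, ⟪f r, e s⟫ * β (e s) (f r) := by
        refine Finset.sum_congr rfl fun r _ => ?_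
        exact (sum_inner_smul_apply e (β.flip (f r)) (f r)).symm
    _ = ∑ s, ∑ r, ⟪e s, f r⟫ * β (e s) (f r) := by
        rw [Finset.sum_comm]
        simp only [real_inner_comm]
    _ = ∑ r, β (e r) (e r) :=
        Finset.sum_congr rfl fun s _ => sum_inner_smul_apply f (β (e s)) (e s)

theorem sum_diag_preservesInner {g : V →ₗ[ℝ] V} (hg : PreservesInner g)
    (β : V →ₗ[ℝ] V →ₗ[ℝ] ℝ) : ∑ r, β (g (e r)) (g (e r)) = ∑ r, β (e r) (e r) := by
  have := finiteDimensional_of_orthonormalBasis e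
  simpa [PreservesInner.toEquiv_apply] using sum_diag_eq_sum_diag e (e.map hg.toEquiv) β

theorem sum_mul_preservesInner {g : V →ₗ[ℝ] V} (hg : PreservesInner g) (a b : V →ₗ[ℝ] ℝ) :
    ∑ r, a (g (e r)) * b (g (e r)) = ∑ r, a (e r) * b (e r) :=
  sum_diag_preservesInner e hg ((LinearMap.mul ℝ ℝ).compl₁₂ a b)

theorem tinner_tcomp {f g h : V →ₗ[ℝ] V} (hf : PreservesInner f) (hg : PreservesInner g)
    (hh : PreservesInner h) (S T : Tri V) :
    tinner e (tcomp f g h S) (tcomp f g h T) = tinner e S T := by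
  simp only [tinner, tcomp_apply]
  have h3 : ∀ r s, ∑ t, S (f (e r)) (g (e s)) (h (e t)) * T (f (e r)) (g (e s)) (h (e t))
      = ∑ t, S (f (e r)) (g (e s)) (e t) * T (f (e r)) (g (e s)) (e t) :=
    fun r s => sum_mul_preservesInner e hh _ _
  have h2 : ∀ r t, ∑ s, S (f (e r)) (g (e s)) (e t) * T (f (e r)) (g (e s)) (e t)
      = ∑ s, S (f (e r)) (e s) (e t) * T (f (e r)) (e s) (e t) :=
    fun r t => sum_mul_preservesInner e hg ((S (f (e r))).flip (e t)) ((T (f (e r))).flip (e t))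
  have h1 : ∀ s t, ∑ r, S (f (e r)) (e s) (e t) * T (f (e r)) (e s) (e t)
      = ∑ r, S (e r) (e s) (e t) * T (e r) (e s) (e t) :=
    fun s t => sum_mul_preservesInner e hf ((S.flip (e s)).flip (e t)) ((T.flip (e s)).flip (e t))
  simp only [h3]
  calc _ = ∑ r, ∑ t, ∑ s, S (f (e r)) (g (e s)) (e t) * T (f (e r)) (g (e s)) (e t) :=
        Finset.sum_congr rfl fun r _ => Finset.sum_comm
    _ = ∑ r, ∑ t, ∑ s, S (f (e r)) (e s) (e t) * T (f (e r)) (e s) (e t) := by simp only [h2]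
    _ = ∑ t, ∑ s, ∑ r, S (f (e r)) (e s) (e t) * T (f (e r)) (e s) (e t) := by
        rw [Finset.sum_comm]
        exact Finset.sum_congr rfl fun t _ => Finset.sum_comm
    _ = ∑ t, ∑ s, ∑ r, S (e r) (e s) (e t) * T (e r) (e s) (e t) := by simp only [h1]
    _ = ∑ t, ∑ r, ∑ s, S (e r) (e s) (e t) * T (e r) (e s) (e t) :=
        Finset.sum_congr rfl fun t _ => Finset.sum_comm
    _ = ∑ r, ∑ t, ∑ s, S (e r) (e s) (e t) * T (e r) (e s) (e t) := Finset.sum_comm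
    _ = _ := Finset.sum_congr rfl fun r _ => Finset.sum_comm

theorem preservesInner_id : PreservesInner (LinearMap.id : V →ₗ[ℝ] V) := fun _ _ => rfl

theorem tinner_pull {g : V →ₗ[ℝ] V} (hg : PreservesInner g) (S T : Tri V) :
    tinner e (pull g S) (pull g T) = tinner e S T := tinner_tcomp e hg hg hg S T

theorem tinner_precomp23 {g : V →ₗ[ℝ] V} (hg : PreservesInner g) (S T : Tri V) :
    tinner e (precomp23 S g) (precomp23 T g) = tinner e S T :=
  tinner_tcomp e preservesInner_id hg hg S T

theorem tinner_comm (S T : Tri V) : tinner e S T = tinner e T S := by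
  simp only [tinner, mul_comm]

theorem tinner_add_left (S S' T : Tri V) :
    tinner e (S + S') T = tinner e S T + tinner e S' T := by
  simp [tinner, add_mul, Finset.sum_add_distrib]

theorem tinner_smul_left (c : ℝ) (S T : Tri V) : tinner e (c • S) T = c * tinner e S T := by
  simp [tinner, Finset.mul_sum, mul_assoc]

theorem tinner_add_right (S T T' : Tri V) :
    tinner e S (T + T') = tinner e S T + tinner e S T' := by
  simp [tinner, mul_add, Finset.sum_add_distrib]

theorem tinner_smul_right (c : ℝ) (S T : Tri V) : tinner e S (c • T) = c * tinner e S T := by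
  simp [tinner, Finset.mul_sum, mul_left_comm]

/-- The inner product of trilinear forms as a bilinear form. -/
def tinnerForm : LinearMap.BilinForm ℝ (Tri V) :=
  LinearMap.mk₂ ℝ (tinner e) (tinner_add_left e) (tinner_smul_left e) (tinner_add_right e)
    (tinner_smul_right e)

@[simp] theorem tinnerForm_apply (S T : Tri V) : tinnerForm e S T = tinner e S T := rfl

theorem tinner_cyc1 (S T : Tri V) : tinner e (cyc1 S) T = tinner e S (cyc2 T) := by
  simp only [tinner, cyc1_apply, cyc2_apply]
  rw [Finset.sum_comm' (t' := Finset.univ) (s' := fun _ => Finset.univ) (by simp)]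
  calc _ = ∑ s, ∑ t, ∑ r, S (e t) (e r) (e s) * T (e r) (e s) (e t) :=
        Finset.sum_congr rfl fun _ _ => Finset.sum_comm
    _ = ∑ t, ∑ s, ∑ r, S (e t) (e r) (e s) * T (e r) (e s) (e t) := Finset.sum_comm
    _ = _ := Finset.sum_congr rfl fun _ _ => Finset.sum_comm

theorem tinner_cyc2 (S T : Tri V) : tinner e (cyc2 S) T = tinner e S (cyc1 T) := by
  rw [tinner_comm, ← tinner_cyc1, tinner_comm]

theorem eq_zero_of_tinner_self_eq_zero {S : Tri V} (h : tinner e S S = 0) : S = 0 := by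
  have hz : ∀ r s t, S (e r) (e s) (e t) = 0 := by
    intro r s t
    have h1 := (Finset.sum_eq_zero_iff_of_nonneg (fun r _ => Finset.sum_nonneg fun s _ =>
      Finset.sum_nonneg fun t _ => mul_self_nonneg (S (e r) (e s) (e t)))).1 h r (Finset.mem_univ _)
    have h2 := (Finset.sum_eq_zero_iff_of_nonneg (fun s _ =>
      Finset.sum_nonneg fun t _ => mul_self_nonneg (S (e r) (e s) (e t)))).1 h1 s
      (Finset.mem_univ _)
    have h3 := (Finset.sum_eq_zero_iff_of_nonneg (fun t _ =>
      mul_self_nonneg (S (e r) (e s) (e t)))).1 h2 t (Finset.mem_univ _)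
    exact mul_self_eq_zero.1 h3
  refine e.toBasis.ext fun r => e.toBasis.ext fun s => e.toBasis.ext fun t => ?_
  simpa using hz r s t

/-- Every form differs from some element of `W` by a form orthogonal to `W`. -/
theorem exists_mem_forall_tinner_sub_eq_zero (W : Submodule ℝ (Tri V)) (S : Tri V) :
    ∃ w ∈ W, ∀ T ∈ W, tinner e T (S - w) = 0 := by
  have := finiteDimensional_of_orthonormalBasis e
  have hrefl : (tinnerForm e).IsRefl := fun S T h => by
    rw [tinnerForm_apply, tinner_comm]; exact h
  have hc : IsCompl W ((tinnerForm e).orthogonal W) := by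
    rw [LinearMap.BilinForm.isCompl_orthogonal_iff_disjoint hrefl, Submodule.disjoint_def]
    exact fun T hT hT' => eq_zero_of_tinner_self_eq_zero e (hT' T hT)
  obtain ⟨w, hw, w', hw', rfl⟩ :=
    Submodule.mem_sup.1 (hc.sup_eq_top ▸ Submodule.mem_top (x := S))
  exact ⟨w, hw, fun T hT => by simpa using hw' T hT⟩

end Trace

section Algebra

variable {J1 J2 J3 : V →ₗ[ℝ] V}

theorem IsQH.cyclic (h : IsQH J1 J2 J3) : IsQH J2 J3 J1 := by
  obtain ⟨h11, h22, h33, h12, h21, h23, h32, h31, h13, i1, i2, i3⟩ := h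
  exact ⟨h22, h33, h11, h23, h32, h31, h13, h12, h21, i2, i3, i1⟩

theorem IsQH.preservesInner (h : IsQH J1 J2 J3) : PreservesInner J1 := h.2.2.2.2.2.2.2.2.2.1

theorem IsQH.inner_left (h : IsQH J1 J2 J3) (X Y : V) : ⟪J1 X, Y⟫ = -⟪X, J1 Y⟫ := by
  have h1 := h.preservesInner X (J1 Y)
  rw [h.1, inner_neg_right] at h1
  linarith

theorem IsQH.inner_right (h : IsQH J1 J2 J3) (X Y : V) : ⟪X, J1 Y⟫ = -⟪J1 X, Y⟫ := by
  rw [h.inner_left, neg_neg]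

theorem IsQH.inner_self (h : IsQH J1 J2 J3) (X : V) : ⟪X, J1 X⟫ = 0 := by
  have h1 := h.inner_left X X
  rw [real_inner_comm] at h1
  linarith

theorem calVhat_cyclic {T : Tri V} (hT : T ∈ calVhat J1 J2 J3) : T ∈ calVhat J2 J3 J1 :=
  ⟨hT.1, hT.2.2.1, hT.2.2.2, hT.2.1⟩

theorem calVhat_move (h : IsQH J1 J2 J3) {T : Tri V} (hT : T ∈ calVhat J1 J2 J3) (X Y Z : V) :
    T X (J1 Y) Z = -T X Y (J1 Z) := by
  have h1 := hT.2.1 X Y (J1 Z)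
  rw [h.1, map_neg] at h1
  linarith

theorem mem_calVhat_of_move (h : IsQH J1 J2 J3) {T : Tri V} (h0 : ∀ X Y Z, T X Y Z = -T X Z Y)
    (h1 : ∀ X Y Z, T X (J1 Y) Z = -T X Y (J1 Z)) (h2 : ∀ X Y Z, T X (J2 Y) Z = -T X Y (J2 Z))
    (h3 : ∀ X Y Z, T X (J3 Y) Z = -T X Y (J3 Z)) : T ∈ calVhat J1 J2 J3 := by
  refine ⟨h0, fun X Y Z => ?_, fun X Y Z => ?_, fun X Y Z => ?_⟩
  · rw [h1, h.1, map_neg, neg_neg]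
  · rw [h2, h.cyclic.1, map_neg, neg_neg]
  · rw [h3, h.cyclic.cyclic.1, map_neg, neg_neg]

theorem calVhat_subset_calV : calVhat J1 J2 J3 ⊆ calV J1 J2 J3 := by
  rintro T ⟨h0, h1, h2, h3⟩
  exact ⟨h0, 0, 0, 0, fun X Y Z => by simp [h1, h2, h3]⟩

/-- The trilinear form `(X, Y, Z) ↦ π(X) ⟨g Y, Z⟩`. -/
def formTwo (π : V →ₗ[ℝ] ℝ) (g : V →ₗ[ℝ] V) : Tri V :=
  π.smulRight ((innerₗ V).comp g)

@[simp] theorem formTwo_apply (π : V →ₗ[ℝ] ℝ) (g : V →ₗ[ℝ] V) (X Y Z : V) :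
    formTwo π g X Y Z = π X * ⟪g Y, Z⟫ := by simp [formTwo]

/-- The trilinear form `(X, Y, Z) ↦ ⟨X, Y⟩ θ(Z)`. -/
def innerTensor (θ : V →ₗ[ℝ] ℝ) : Tri V :=
  (innerₗ V).compr₂ (LinearMap.toSpanSingleton ℝ _ θ)

@[simp] theorem innerTensor_apply (θ : V →ₗ[ℝ] ℝ) (X Y Z : V) :
    innerTensor θ X Y Z = ⟪X, Y⟫ * θ Z := by simp [innerTensor]

/-- Exchange the last two arguments of a trilinear form. -/
def swap23 (T : Tri V) : Tri V := LinearMap.lflip.comp T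

@[simp] theorem swap23_apply (T : Tri V) (X Y Z : V) : swap23 T X Y Z = T X Z Y := rfl

/-- The tensor `T^θ`. -/
def Ttheta (J1 J2 J3 : V →ₗ[ℝ] V) (θ : V →ₗ[ℝ] ℝ) : Tri V :=
  let S := innerTensor θ + precomp23 (innerTensor θ) J1 + precomp23 (innerTensor θ) J2
    + precomp23 (innerTensor θ) J3
  S - swap23 S

theorem Ttheta_apply (θ : V →ₗ[ℝ] ℝ) (X Y Z : V) :
    Ttheta J1 J2 J3 θ X Y Z = TthetaForm J1 J2 J3 θ X Y Z := by
  simp only [Ttheta, TthetaForm, LinearMap.sub_apply, LinearMap.add_apply, precomp23_apply,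
    innerTensor_apply, swap23_apply]
  ring

theorem Ttheta_mem (θ : V →ₗ[ℝ] ℝ) : Ttheta J1 J2 J3 θ ∈ TthetaSet J1 J2 J3 :=
  ⟨θ, Ttheta_apply θ⟩

theorem eq_Ttheta {θ : V →ₗ[ℝ] ℝ} {T : Tri V}
    (hT : ∀ X Y Z, T X Y Z = TthetaForm J1 J2 J3 θ X Y Z) : T = Ttheta J1 J2 J3 θ :=
  tri_ext fun X Y Z => by rw [hT, Ttheta_apply]

theorem Ttheta_mem_calVhat (h : IsQH J1 J2 J3) (θ : V →ₗ[ℝ] ℝ) :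
    Ttheta J1 J2 J3 θ ∈ calVhat J1 J2 J3 := by
  have h' := h
  obtain ⟨h11, h22, h33, h12, h21, h23, h32, h31, h13, i1, i2, i3⟩ := h'
  refine mem_calVhat_of_move h (fun X Y Z => ?_) (fun X Y Z => ?_) (fun X Y Z => ?_)
    (fun X Y Z => ?_) <;>
  simp only [Ttheta_apply, TthetaForm, h11, h22, h33, h12, h21, h23, h32, h31, h13, map_neg,
    inner_neg_right] <;> ring

/-- The form `∑ₐ πₐ(X) ⟨Jₐ Y, Z⟩`. -/
def checkForm (J1 J2 J3 : V →ₗ[ℝ] V) (π1 π2 π3 : V →ₗ[ℝ] ℝ) : Tri V :=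
  formTwo π1 J1 + formTwo π2 J2 + formTwo π3 J3

theorem checkForm_apply (π1 π2 π3 : V →ₗ[ℝ] ℝ) (X Y Z : V) :
    checkForm J1 J2 J3 π1 π2 π3 X Y Z
      = π1 X * ⟪J1 Y, Z⟫ + π2 X * ⟪J2 Y, Z⟫ + π3 X * ⟪J3 Y, Z⟫ := by
  simp [checkForm]

theorem checkForm_mem_calV (h : IsQH J1 J2 J3) (π1 π2 π3 : V →ₗ[ℝ] ℝ) :
    checkForm J1 J2 J3 π1 π2 π3 ∈ calV J1 J2 J3 := by
  have j1 := h.inner_right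
  have j2 := h.cyclic.inner_right
  have j3 := h.cyclic.cyclic.inner_right
  obtain ⟨h11, h22, h33, h12, h21, h23, h32, h31, h13, i1, i2, i3⟩ := h
  refine ⟨fun X Y Z => ?_, (2 : ℝ) • π1, (2 : ℝ) • π2, (2 : ℝ) • π3, fun X Y Z => ⟨?_, ?_, ?_⟩⟩
  · simp only [checkForm_apply]
    rw [real_inner_comm Z, j1, real_inner_comm Z (J2 Y), j2, real_inner_comm Z (J3 Y), j3]
    ring
  all_goals
    simp only [checkForm_apply, j1, j2, j3, h11, h22, h33, h12, h21, h23, h32, h31, h13, map_neg,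
      inner_neg_left, LinearMap.smul_apply, smul_eq_mul]
    ring

theorem calVcheck0perp_iff {T : Tri V} : T ∈ calVcheck0perp J1 J2 J3 ↔
    ∃ θ : V →ₗ[ℝ] ℝ, T = checkForm J1 J2 J3 (θ.comp J1) (θ.comp J2) (θ.comp J3) := by
  refine exists_congr fun θ => ⟨fun h => tri_ext fun X Y Z => ?_, ?_⟩
  · rw [h, checkForm_apply]; rfl
  · rintro rfl X Y Z
    rw [checkForm_apply]; rfl

theorem calVcheck0_iff {T : Tri V} : T ∈ calVcheck0 J1 J2 J3 ↔
    ∃ π1 π2 π3 : V →ₗ[ℝ] ℝ, T = checkForm J1 J2 J3 π1 π2 π3 ∧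
      ∀ X, π1 (J1 X) + π2 (J2 X) + π3 (J3 X) = 0 := by
  refine exists_congr fun π1 => exists_congr fun π2 => exists_congr fun π3 =>
    and_congr_left fun _ => ⟨fun h => tri_ext fun X Y Z => ?_, ?_⟩
  · rw [h, checkForm_apply]
  · rintro rfl X Y Z
    rw [checkForm_apply]

theorem QKfam_subset_calV (h : IsQH J1 J2 J3) {n : ℕ} (e : OrthonormalBasis (Fin (4 * n)) ℝ V)
    (i : Fin 5) : QKfam J1 J2 J3 e i ⊆ calV J1 J2 J3 := by
  intro T hT
  fin_cases i
  · obtain ⟨θ, rfl⟩ := calVcheck0perp_iff.1 hT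
    exact checkForm_mem_calV h _ _ _
  · obtain ⟨π1, π2, π3, rfl, -⟩ := calVcheck0_iff.1 hT
    exact checkForm_mem_calV h _ _ _
  · obtain ⟨θ, hθ⟩ := hT
    exact eq_Ttheta hθ ▸ calVhat_subset_calV (Ttheta_mem_calVhat h θ)
  · exact calVhat_subset_calV hT.1
  · exact calVhat_subset_calV hT.1

end Algebra

section Invariance

variable {J1 J2 J3 : V →ₗ[ℝ] V}

/-- `g` is an isometric endomorphism with `g ∘ Jₐ = ∑_b mₐᵇ J_b ∘ g`, the matrix `m` being
orthogonal. -/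
structure IsSpMap (J1 J2 J3 : V →ₗ[ℝ] V) (g : V →ₗ[ℝ] V) (m : Matrix (Fin 3) (Fin 3) ℝ) :
    Prop where
  inner : PreservesInner g
  col : m.transpose * m = 1
  map1 : ∀ X, g (J1 X) = m 0 0 • J1 (g X) + m 0 1 • J2 (g X) + m 0 2 • J3 (g X)
  map2 : ∀ X, g (J2 X) = m 1 0 • J1 (g X) + m 1 1 • J2 (g X) + m 1 2 • J3 (g X)
  map3 : ∀ X, g (J3 X) = m 2 0 • J1 (g X) + m 2 1 • J2 (g X) + m 2 2 • J3 (g X)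

theorem sum_mul_of_transpose_mul_self {m : Matrix (Fin 3) (Fin 3) ℝ} (hm : m.transpose * m = 1)
    (b c : Fin 3) :
    m 0 b * m 0 c + m 1 b * m 1 c + m 2 b * m 2 c = (1 : Matrix (Fin 3) (Fin 3) ℝ) b c := by
  rw [← hm, Matrix.mul_apply, Fin.sum_univ_three]
  rfl

theorem IsSpnSp1.symm {A : V ≃ₗᵢ[ℝ] V} (hA : IsSpnSp1 J1 J2 J3 A) :
    IsSpnSp1 J1 J2 J3 A.symm := by
  obtain ⟨m, hm, hd, h1, h2, h3⟩ := hA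
  have hs := sum_mul_of_transpose_mul_self hm
  have key : ∀ X, A (m 0 0 • J1 (A.symm X) + m 1 0 • J2 (A.symm X) + m 2 0 • J3 (A.symm X))
      = J1 X ∧ A (m 0 1 • J1 (A.symm X) + m 1 1 • J2 (A.symm X) + m 2 1 • J3 (A.symm X))
      = J2 X ∧ A (m 0 2 • J1 (A.symm X) + m 1 2 • J2 (A.symm X) + m 2 2 • J3 (A.symm X))
      = J3 X := by
    have s00 := hs 0 0
    have s01 := hs 0 1
    have s02 := hs 0 2
    have s11 := hs 1 1
    have s12 := hs 1 2
    have s22 := hs 2 2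
    simp only [Matrix.one_apply, Fin.isValue, reduceIte, Fin.reduceEq] at s00 s01 s02 s11 s12 s22
    intro X
    simp only [map_add, map_smul, h1, h2, h3, A.apply_symm_apply]
    refine ⟨?_, ?_, ?_⟩
    · linear_combination (norm := module) s00 • J1 X + s01 • J2 X + s02 • J3 X
    · linear_combination (norm := module) s01 • J1 X + s11 • J2 X + s12 • J3 X
    · linear_combination (norm := module) s02 • J1 X + s12 • J2 X + s22 • J3 X
  refine ⟨m.transpose, ?_, by rw [Matrix.det_transpose, hd], fun X => ?_, fun X => ?_,
    fun X => ?_⟩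
  · rw [Matrix.transpose_transpose]
    exact mul_eq_one_comm.1 hm
  · exact A.symm_apply_eq.2 (key X).1.symm
  · exact A.symm_apply_eq.2 (key X).2.1.symm
  · exact A.symm_apply_eq.2 (key X).2.2.symm

theorem IsSpnSp1.isSpMap {A : V ≃ₗᵢ[ℝ] V} (hA : IsSpnSp1 J1 J2 J3 A) :
    ∃ m, IsSpMap J1 J2 J3 A.toLinearMap m := by
  obtain ⟨m, hm, -, h1, h2, h3⟩ := hA
  exact ⟨m, fun X Y => A.inner_map_map X Y, hm, h1, h2, h3⟩

theorem act_eq_pull (A : V ≃ₗᵢ[ℝ] V) (S : Tri V) : act A S = pull A.symm.toLinearMap S := rfl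

variable {g : V →ₗ[ℝ] V} {m : Matrix (Fin 3) (Fin 3) ℝ}

theorem IsSpMap.sum_apply (hg : IsSpMap J1 J2 J3 g m) (β : V →ₗ[ℝ] V →ₗ[ℝ] ℝ) (Y Z : V) :
    β (g (J1 Y)) (g (J1 Z)) + β (g (J2 Y)) (g (J2 Z)) + β (g (J3 Y)) (g (J3 Z))
      = β (J1 (g Y)) (J1 (g Z)) + β (J2 (g Y)) (J2 (g Z)) + β (J3 (g Y)) (J3 (g Z)) := by
  have hs := sum_mul_of_transpose_mul_self hg.col
  have s00 := hs 0 0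
  have s01 := hs 0 1
  have s02 := hs 0 2
  have s11 := hs 1 1
  have s12 := hs 1 2
  have s22 := hs 2 2
  simp only [Matrix.one_apply, Fin.isValue, reduceIte, Fin.reduceEq] at s00 s01 s02 s11 s12 s22
  simp only [hg.map1, hg.map2, hg.map3, map_add, map_smul, LinearMap.add_apply,
    LinearMap.smul_apply, smul_eq_mul]
  linear_combination s00 * β (J1 (g Y)) (J1 (g Z)) + s11 * β (J2 (g Y)) (J2 (g Z))
    + s22 * β (J3 (g Y)) (J3 (g Z))
    + s01 * (β (J1 (g Y)) (J2 (g Z)) + β (J2 (g Y)) (J1 (g Z)))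
    + s02 * (β (J1 (g Y)) (J3 (g Z)) + β (J3 (g Y)) (J1 (g Z)))
    + s12 * (β (J2 (g Y)) (J3 (g Z)) + β (J3 (g Y)) (J2 (g Z)))

theorem IsSpMap.pull_mem_calVhat (h : IsQH J1 J2 J3) (hg : IsSpMap J1 J2 J3 g m) {T : Tri V}
    (hT : T ∈ calVhat J1 J2 J3) : pull g T ∈ calVhat J1 J2 J3 := by
  have m1 := calVhat_move h hT
  have m2 := calVhat_move h.cyclic (calVhat_cyclic hT)
  have m3 := calVhat_move h.cyclic.cyclic (calVhat_cyclic (calVhat_cyclic hT))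
  refine mem_calVhat_of_move h (fun X Y Z => hT.1 _ _ _) (fun X Y Z => ?_) (fun X Y Z => ?_)
    (fun X Y Z => ?_) <;>
  simp only [pull_apply, hg.map1, hg.map2, hg.map3, map_add, map_smul, LinearMap.add_apply,
    LinearMap.smul_apply, smul_eq_mul, m1, m2, m3] <;> ring

theorem IsSpMap.pull_mem_calVcheck0perp (hg : IsSpMap J1 J2 J3 g m) {T : Tri V}
    (hT : T ∈ calVcheck0perp J1 J2 J3) : pull g T ∈ calVcheck0perp J1 J2 J3 := by
  obtain ⟨θ, hθ⟩ := hT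
  refine ⟨θ.comp g, fun X Y Z => ?_⟩
  have := hg.sum_apply (formTwo θ LinearMap.id |>.flip.flip.compr₂ (LinearMap.applyₗ (g Z))) X Y
  simp only [LinearMap.compr₂_apply, LinearMap.flip_apply, formTwo_apply, LinearMap.id_apply,
    LinearMap.applyₗ_apply_apply, hg.inner _ _] at this
  rw [pull_apply, hθ]
  exact this.symm

theorem IsSpMap.pull_mem_calVcheck0 (hg : IsSpMap J1 J2 J3 g m) {T : Tri V}
    (hT : T ∈ calVcheck0 J1 J2 J3) : pull g T ∈ calVcheck0 J1 J2 J3 := by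
  obtain ⟨π1, π2, π3, hπ, h0⟩ := hT
  have hs := sum_mul_of_transpose_mul_self hg.col
  have s00 := hs 0 0
  have s01 := hs 0 1
  have s02 := hs 0 2
  have s11 := hs 1 1
  have s12 := hs 1 2
  have s22 := hs 2 2
  simp only [Matrix.one_apply, Fin.isValue, reduceIte, Fin.reduceEq] at s00 s01 s02 s11 s12 s22
  refine ⟨(m 0 0 • π1 + m 0 1 • π2 + m 0 2 • π3).comp g,
    (m 1 0 • π1 + m 1 1 • π2 + m 1 2 • π3).comp g,
    (m 2 0 • π1 + m 2 1 • π2 + m 2 2 • π3).comp g, fun X Y Z => ?_, fun X => ?_⟩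
  · rw [← hg.inner (J1 Y), ← hg.inner (J2 Y), ← hg.inner (J3 Y)]
    simp only [pull_apply, hπ, hg.map1, hg.map2, hg.map3, inner_add_left,
      real_inner_smul_left, LinearMap.comp_apply, LinearMap.add_apply, LinearMap.smul_apply,
      smul_eq_mul]
    linear_combination -(π1 (g X) * (s00 * ⟪J1 (g Y), g Z⟫ + s01 * ⟪J2 (g Y), g Z⟫
        + s02 * ⟪J3 (g Y), g Z⟫)
      + π2 (g X) * (s01 * ⟪J1 (g Y), g Z⟫ + s11 * ⟪J2 (g Y), g Z⟫ + s12 * ⟪J3 (g Y), g Z⟫)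
      + π3 (g X) * (s02 * ⟪J1 (g Y), g Z⟫ + s12 * ⟪J2 (g Y), g Z⟫ + s22 * ⟪J3 (g Y), g Z⟫))
  · simp only [hg.map1, hg.map2, hg.map3, LinearMap.comp_apply, LinearMap.add_apply,
      LinearMap.smul_apply, smul_eq_mul, map_add, map_smul]
    linear_combination h0 (g X) + s00 * π1 (J1 (g X)) + s11 * π2 (J2 (g X)) + s22 * π3 (J3 (g X))
      + s01 * (π1 (J2 (g X)) + π2 (J1 (g X))) + s02 * (π1 (J3 (g X)) + π3 (J1 (g X)))
      + s12 * (π2 (J3 (g X)) + π3 (J2 (g X)))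

theorem IsSpMap.pull_mem_TthetaSet (hg : IsSpMap J1 J2 J3 g m) {T : Tri V}
    (hT : T ∈ TthetaSet J1 J2 J3) : pull g T ∈ TthetaSet J1 J2 J3 := by
  obtain ⟨θ, hθ⟩ := hT
  refine ⟨θ.comp g, fun X Y Z => ?_⟩
  have h1 := hg.sum_apply (innerTensor θ (g X)) Y Z
  have h2 := hg.sum_apply (innerTensor θ (g X)) Z Y
  simp only [innerTensor_apply, hg.inner _ _] at h1 h2
  simp only [pull_apply, hθ, TthetaForm, hg.inner _ _, LinearMap.comp_apply]
  linear_combination h2 - h1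

theorem IsSpMap.pull_mem_QK4set (h : IsQH J1 J2 J3) (hg : IsSpMap J1 J2 J3 g m) {n : ℕ}
    (e : OrthonormalBasis (Fin (4 * n)) ℝ V) {T : Tri V} (hT : T ∈ QK4set J1 J2 J3 e) :
    pull g T ∈ QK4set J1 J2 J3 e := by
  refine ⟨hg.pull_mem_calVhat h hT.1, fun X Y Z => ?_, fun Z => ?_⟩
  · have h1 := hg.sum_apply (T (g X)) Y Z
    have h2 := hg.sum_apply (cyc2 T (g X)) Y Z
    have h3 := hg.sum_apply (cyc1 T (g X)) Y Z
    simp only [cyc1_apply, cyc2_apply] at h2 h3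
    simp only [pull_apply]
    linear_combination hT.2.1 (g X) (g Y) (g Z) - (1 / 6) * (h1 + h2 + h3)
  · exact (sum_diag_preservesInner e hg.inner (cyc2 T (g Z))).trans (hT.2.2 (g Z))

theorem IsSpMap.pull_mem_QK5set (h : IsQH J1 J2 J3) (hg : IsSpMap J1 J2 J3 g m) {T : Tri V}
    (hT : T ∈ QK5set J1 J2 J3) : pull g T ∈ QK5set J1 J2 J3 :=
  ⟨hg.pull_mem_calVhat h hT.1, fun _ _ _ => hT.2 _ _ _⟩

theorem act_mem_QKfam (h : IsQH J1 J2 J3) {n : ℕ} (e : OrthonormalBasis (Fin (4 * n)) ℝ V)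
    (i : Fin 5) {A : V ≃ₗᵢ[ℝ] V} (hA : IsSpnSp1 J1 J2 J3 A) {S : Tri V}
    (hS : S ∈ QKfam J1 J2 J3 e i) : act A S ∈ QKfam J1 J2 J3 e i := by
  obtain ⟨m, hm⟩ := hA.symm.isSpMap
  rw [act_eq_pull]
  fin_cases i
  · exact hm.pull_mem_calVcheck0perp hS
  · exact hm.pull_mem_calVcheck0 hS
  · exact hm.pull_mem_TthetaSet hS
  · exact hm.pull_mem_QK4set h e hS
  · exact hm.pull_mem_QK5set h hS

end Invariance

section Orthogonality

variable {J1 J2 J3 : V →ₗ[ℝ] V} {n : ℕ} (e : OrthonormalBasis (Fin (4 * n)) ℝ V)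

theorem tinner_formTwo (π : V →ₗ[ℝ] ℝ) (g : V →ₗ[ℝ] V) (T : Tri V) :
    tinner e (formTwo π g) T = ∑ r, π (e r) * ∑ s, T (e r) (e s) (g (e s)) := by
  simp only [tinner, formTwo_apply, mul_assoc, ← Finset.mul_sum, sum_inner_smul_apply]

theorem sum_calVhat_eq_zero (h : IsQH J1 J2 J3) {T : Tri V} (hT : T ∈ calVhat J1 J2 J3) (X : V) :
    ∑ s, T X (e s) (J1 (e s)) = 0 := by
  have h1 := sum_diag_preservesInner e h.cyclic.preservesInner ((T X).compl₂ J1)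
  simp only [LinearMap.compl₂_apply] at h1
  have h2 : ∀ s, T X (J2 (e s)) (J1 (J2 (e s))) = -T X (e s) (J1 (e s)) := by
    intro s
    rw [← hT.2.2.1 X (e s) (J1 (e s)), h.2.2.2.1, h.2.2.2.2.1, map_neg, neg_neg]
  simp only [h2, Finset.sum_neg_distrib] at h1
  linarith

theorem tinner_checkForm_calVhat (h : IsQH J1 J2 J3) {T : Tri V} (hT : T ∈ calVhat J1 J2 J3)
    (π1 π2 π3 : V →ₗ[ℝ] ℝ) : tinner e (checkForm J1 J2 J3 π1 π2 π3) T = 0 := by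
  simp only [checkForm, tinner_add_left, tinner_formTwo, sum_calVhat_eq_zero e h hT,
    sum_calVhat_eq_zero e h.cyclic (calVhat_cyclic hT),
    sum_calVhat_eq_zero e h.cyclic.cyclic (calVhat_cyclic (calVhat_cyclic hT))]
  simp

theorem tinner_formTwo_formTwo_self (h : IsQH J1 J2 J3) (a b : V →ₗ[ℝ] ℝ) :
    tinner e (formTwo a J1) (formTwo b J1) = 4 * n * ∑ r, a (e r) * b (e r) := by
  rw [tinner_formTwo, Finset.mul_sum]
  refine Finset.sum_congr rfl fun r _ => ?_
  simp only [formTwo_apply, h.preservesInner _ _, real_inner_self_eq_norm_sq, e.norm_eq_one]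
  simp
  ring

theorem IsQH.inner_J1_J2 (h : IsQH J1 J2 J3) (X : V) : ⟪J2 X, J1 X⟫ = 0 := by
  rw [h.inner_right, h.2.2.2.1, real_inner_comm, h.cyclic.cyclic.inner_self, neg_zero]

theorem tinner_formTwo_formTwo_of_ne (h : IsQH J1 J2 J3) (a b : V →ₗ[ℝ] ℝ) :
    tinner e (formTwo a J1) (formTwo b J2) = 0 ∧ tinner e (formTwo a J2) (formTwo b J1) = 0 := by
  have h1 : ∀ X, ⟪J1 X, J2 X⟫ = 0 := fun X => by rw [real_inner_comm, h.inner_J1_J2]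
  constructor
  · simp [tinner_formTwo, h.inner_J1_J2]
  · simp [tinner_formTwo, h1]

theorem sum_comp_mul (h : IsQH J1 J2 J3) (a b : V →ₗ[ℝ] ℝ) :
    ∑ r, a (J1 (e r)) * b (e r) = -∑ r, a (e r) * b (J1 (e r)) := by
  have h1 := sum_mul_preservesInner e h.preservesInner a (b.comp J1)
  simp only [LinearMap.comp_apply, h.1, map_neg, mul_neg, Finset.sum_neg_distrib] at h1
  linarith

theorem tinner_calVcheck0perp_calVcheck0 (h : IsQH J1 J2 J3) {S T : Tri V}
    (hS : S ∈ calVcheck0perp J1 J2 J3) (hT : T ∈ calVcheck0 J1 J2 J3) : tinner e S T = 0 := by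
  obtain ⟨θ, rfl⟩ := calVcheck0perp_iff.1 hS
  obtain ⟨π1, π2, π3, rfl, h0⟩ := calVcheck0_iff.1 hT
  have h12 := fun a b => tinner_formTwo_formTwo_of_ne e h a b
  have h23 := fun a b => tinner_formTwo_formTwo_of_ne e h.cyclic a b
  have h31 := fun a b => tinner_formTwo_formTwo_of_ne e h.cyclic.cyclic a b
  simp only [checkForm, tinner_add_left, tinner_add_right, (h12 _ _).1, (h12 _ _).2, (h23 _ _).1,
    (h23 _ _).2, (h31 _ _).1, (h31 _ _).2, tinner_formTwo_formTwo_self e h,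
    tinner_formTwo_formTwo_self e h.cyclic, tinner_formTwo_formTwo_self e h.cyclic.cyclic,
    LinearMap.comp_apply, sum_comp_mul e h, sum_comp_mul e h.cyclic, sum_comp_mul e h.cyclic.cyclic]
  have h4 : ∑ r, θ (e r) * π1 (J1 (e r)) + ∑ r, θ (e r) * π2 (J2 (e r))
      + ∑ r, θ (e r) * π3 (J3 (e r)) = 0 := by
    rw [← Finset.sum_add_distrib, ← Finset.sum_add_distrib]
    exact Finset.sum_eq_zero fun r _ => by rw [← mul_add, ← mul_add, h0, mul_zero]
  linear_combination (-(4 * n : ℝ)) * h4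

theorem tinner_precomp23_calVhat (h : IsQH J1 J2 J3) {T : Tri V} (hT : T ∈ calVhat J1 J2 J3)
    (S : Tri V) : tinner e (precomp23 S J1) T = tinner e S T := by
  have h1 : T = precomp23 T J1 := tri_ext fun X Y Z => (hT.2.1 X Y Z).symm
  conv_lhs => rw [h1]
  exact tinner_precomp23 e h.preservesInner S T

theorem tinner_Lmap (h : IsQH J1 J2 J3) {T : Tri V} (hT : T ∈ QK5set J1 J2 J3) (S : Tri V) :
    tinner e (Lmap J1 J2 J3 S) T = -4 * tinner e S T := by
  have h1 : cyc1 T + cyc2 T = (-1 : ℝ) • T := tri_ext fun X Y Z => by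
    simp only [LinearMap.add_apply, cyc1_apply, cyc2_apply, LinearMap.smul_apply, smul_eq_mul]
    linarith [hT.2 X Y Z]
  have h2 : tinner e S (cyc1 T) + tinner e S (cyc2 T) = -tinner e S T := by
    rw [← tinner_add_right, h1, tinner_smul_right]; ring
  simp only [Lmap, tinner_add_left, tinner_precomp23_calVhat e h hT.1,
    tinner_precomp23_calVhat e h.cyclic (calVhat_cyclic hT.1),
    tinner_precomp23_calVhat e h.cyclic.cyclic (calVhat_cyclic (calVhat_cyclic hT.1)),
    tinner_cyc1, tinner_cyc2]
  linarith

theorem tinner_eq_zero_of_Lmap_eq (h : IsQH J1 J2 J3) {S T : Tri V}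
    (hS : Lmap J1 J2 J3 S = (2 : ℝ) • S) (hT : T ∈ QK5set J1 J2 J3) : tinner e S T = 0 := by
  have := tinner_Lmap e h hT S
  rw [hS, tinner_smul_left] at this
  linarith

theorem Lmap_eq_iff {T : Tri V} (hT : T ∈ calVhat J1 J2 J3) :
    Lmap J1 J2 J3 T = (2 : ℝ) • T ↔
    ∀ X Y Z : V, T X Y Z = (1/6) * ((T X Y Z + T Y Z X + T Z X Y)
      + (T X (J1 Y) (J1 Z) + T (J1 Y) (J1 Z) X + T (J1 Z) X (J1 Y))
      + (T X (J2 Y) (J2 Z) + T (J2 Y) (J2 Z) X + T (J2 Z) X (J2 Y))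
      + (T X (J3 Y) (J3 Z) + T (J3 Y) (J3 Z) X + T (J3 Z) X (J3 Y))) := by
  constructor
  · intro h X Y Z
    have h1 : Lmap J1 J2 J3 T X Y Z = 2 * T X Y Z := by rw [h]; rfl
    rw [Lmap_apply] at h1
    rw [hT.2.1, hT.2.2.1, hT.2.2.2]
    linarith
  · intro h
    refine tri_ext fun X Y Z => ?_
    have h1 := h X Y Z
    rw [hT.2.1, hT.2.2.1, hT.2.2.2] at h1
    rw [Lmap_apply, LinearMap.smul_apply, LinearMap.smul_apply, LinearMap.smul_apply, smul_eq_mul]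
    linarith

theorem Lmap_Ttheta (h : IsQH J1 J2 J3) (θ : V →ₗ[ℝ] ℝ) :
    Lmap J1 J2 J3 (Ttheta J1 J2 J3 θ) = (2 : ℝ) • Ttheta J1 J2 J3 θ := by
  have j1 := fun X Y => h.inner_right X Y
  have j2 := fun X Y => h.cyclic.inner_right X Y
  have j3 := fun X Y => h.cyclic.cyclic.inner_right X Y
  obtain ⟨h11, h22, h33, h12, h21, h23, h32, h31, h13, i1, i2, i3⟩ := h
  refine tri_ext fun X Y Z => ?_
  have c1 : ∀ A B, ⟪J1 A, B⟫ = -⟪J1 B, A⟫ := fun A B => by rw [real_inner_comm, j1]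
  have c2 : ∀ A B, ⟪J2 A, B⟫ = -⟪J2 B, A⟫ := fun A B => by rw [real_inner_comm, j2]
  have c3 : ∀ A B, ⟪J3 A, B⟫ = -⟪J3 B, A⟫ := fun A B => by rw [real_inner_comm, j3]
  simp only [Lmap_apply, LinearMap.smul_apply, smul_eq_mul, Ttheta_apply, TthetaForm, j1, j2, j3,
    h11, h22, h33, h12, h21, h23, h32, h31, h13, map_neg, inner_neg_left, inner_neg_right,
    real_inner_comm X Y, real_inner_comm X Z, real_inner_comm Y Z, c1 X Y, c1 X Z, c1 Y Z,
    c2 X Y, c2 X Z, c2 Y Z, c3 X Y, c3 X Z, c3 Y Z]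
  ring

theorem tinner_swap23 (S T : Tri V) : tinner e (swap23 S) T = tinner e S (swap23 T) := by
  simp only [tinner, swap23_apply]
  exact Finset.sum_congr rfl fun _ _ => Finset.sum_comm

theorem tinner_innerTensor (θ : V →ₗ[ℝ] ℝ) (T : Tri V) :
    tinner e (innerTensor θ) T = ∑ t, θ (e t) * c12 e T (e t) := by
  have h1 : ∀ r t, ∑ s, ⟪e r, e s⟫ * T (e r) (e s) (e t) = T (e r) (e r) (e t) := fun r t =>
    sum_inner_smul_apply e ((T (e r)).flip (e t)) (e r)
  simp only [tinner, innerTensor_apply, c12, Finset.mul_sum]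
  rw [Finset.sum_comm (s := Finset.univ (α := Fin (4 * n))) (t := Finset.univ)
    (f := fun t r => θ (e t) * T (e r) (e r) (e t))]
  refine Finset.sum_congr rfl fun r _ => ?_
  rw [Finset.sum_comm]
  refine Finset.sum_congr rfl fun t _ => ?_
  rw [← h1, Finset.mul_sum]
  exact Finset.sum_congr rfl fun s _ => by ring

theorem tinner_Ttheta (h : IsQH J1 J2 J3) {T : Tri V} (hT : T ∈ calVhat J1 J2 J3)
    (θ : V →ₗ[ℝ] ℝ) : tinner e (Ttheta J1 J2 J3 θ) T = 8 * ∑ t, θ (e t) * c12 e T (e t) := by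
  have hs : swap23 T = (-1 : ℝ) • T := tri_ext fun X Y Z => by
    rw [swap23_apply, hT.1]; simp
  have h4 : tinner e (innerTensor θ + precomp23 (innerTensor θ) J1 + precomp23 (innerTensor θ) J2
      + precomp23 (innerTensor θ) J3) T = 4 * ∑ t, θ (e t) * c12 e T (e t) := by
    simp only [tinner_add_left, tinner_precomp23_calVhat e h hT,
      tinner_precomp23_calVhat e h.cyclic (calVhat_cyclic hT),
      tinner_precomp23_calVhat e h.cyclic.cyclic (calVhat_cyclic (calVhat_cyclic hT)),
      tinner_innerTensor]
    ring
  rw [Ttheta, sub_eq_add_neg, ← neg_one_smul ℝ (swap23 _), tinner_add_left, tinner_smul_left,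
    tinner_swap23, hs, tinner_smul_right, h4]
  ring

theorem tinner_QKfam_of_lt (h : IsQH J1 J2 J3) {i j : Fin 5} (hij : i < j) {S T : Tri V}
    (hS : S ∈ QKfam J1 J2 J3 e i) (hT : T ∈ QKfam J1 J2 J3 e j) : tinner e S T = 0 := by
  have hat : ∀ k : Fin 5, 1 < k → QKfam J1 J2 J3 e k ⊆ calVhat J1 J2 J3 := by
    intro k hk T hT
    fin_cases k
    · simp at hk
    · simp at hk
    · obtain ⟨θ, hθ⟩ := hT
      exact eq_Ttheta hθ ▸ Ttheta_mem_calVhat h θ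
    · exact hT.1
    · exact hT.1
  fin_cases i
  · obtain rfl | hj : j = 1 ∨ 1 < j := by
      simp only [Fin.lt_def, Fin.ext_iff] at hij ⊢; simp at hij ⊢; omega
    · exact tinner_calVcheck0perp_calVcheck0 e h hS hT
    · obtain ⟨θ, rfl⟩ := calVcheck0perp_iff.1 hS
      exact tinner_checkForm_calVhat e h (hat j hj hT) _ _ _
  · obtain ⟨π1, π2, π3, rfl, -⟩ := calVcheck0_iff.1 hS
    exact tinner_checkForm_calVhat e h (hat j hij hT) _ _ _
  · obtain ⟨θ, hθ⟩ := hS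
    obtain rfl := eq_Ttheta hθ
    obtain rfl | rfl : j = 3 ∨ j = 4 := by
      simp only [Fin.lt_def, Fin.ext_iff] at hij ⊢; simp at hij ⊢; omega
    · rw [tinner_Ttheta e h hT.1]
      simp [hT.2.2]
    · exact tinner_eq_zero_of_Lmap_eq e h (Lmap_Ttheta h θ) hT
  · obtain rfl : j = 4 := by simp only [Fin.lt_def, Fin.ext_iff] at hij ⊢; simp at hij ⊢; omega
    exact tinner_eq_zero_of_Lmap_eq e h ((Lmap_eq_iff hS.1).2 hS.2.1) hT
  · exact absurd hij (not_lt_of_ge (Fin.le_last j))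

theorem tinner_QKfam_of_ne (h : IsQH J1 J2 J3) {i j : Fin 5} (hij : i ≠ j) {S T : Tri V}
    (hS : S ∈ QKfam J1 J2 J3 e i) (hT : T ∈ QKfam J1 J2 J3 e j) : tinner e S T = 0 := by
  rcases lt_or_gt_of_ne hij with hlt | hlt
  · exact tinner_QKfam_of_lt e h hlt hS hT
  · rw [tinner_comm]
    exact tinner_QKfam_of_lt e h hlt hT hS

end Orthogonality

section Decomposition

variable {J1 J2 J3 : V →ₗ[ℝ] V}

theorem calVhat_swap (h : IsQH J1 J2 J3) {T : Tri V} (hT : T ∈ calVhat J1 J2 J3) (X Y Z : V) :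
    T X Y (J1 Z) = T X Z (J1 Y) := by
  rw [hT.1, calVhat_move h hT, neg_neg]

theorem Lmap_mem_calVhat (h : IsQH J1 J2 J3) {T : Tri V} (hT : T ∈ calVhat J1 J2 J3) :
    Lmap J1 J2 J3 T ∈ calVhat J1 J2 J3 := by
  have m1 := calVhat_move h hT
  have m2 := calVhat_move h.cyclic (calVhat_cyclic hT)
  have m3 := calVhat_move h.cyclic.cyclic (calVhat_cyclic (calVhat_cyclic hT))
  have s1 := calVhat_swap h hT
  have s2 := calVhat_swap h.cyclic (calVhat_cyclic hT)
  have s3 := calVhat_swap h.cyclic.cyclic (calVhat_cyclic (calVhat_cyclic hT))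
  have s0 := hT.1
  have h' := h
  obtain ⟨h11, h22, h33, h12, h21, h23, h32, h31, h13, i1, i2, i3⟩ := h'
  refine mem_calVhat_of_move h (fun X Y Z => ?_) (fun X Y Z => ?_) (fun X Y Z => ?_)
    (fun X Y Z => ?_) <;>
  simp only [Lmap_apply, m1, m2, m3, h11, h22, h33, h12, h21, h23, h32, h31, h13, map_neg,
    LinearMap.neg_apply, s0 _ Y X, s0 _ Z X, s0 _ Z Y, s1 _ Y X, s2 _ Y X, s3 _ Y X, s1 _ Z X,
    s2 _ Z X, s3 _ Z X, s1 _ Z Y, s2 _ Z Y, s3 _ Z Y] <;> ring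

theorem Lmap_Lmap (h : IsQH J1 J2 J3) {T : Tri V} (hT : T ∈ calVhat J1 J2 J3) (X Y Z : V) :
    Lmap J1 J2 J3 (Lmap J1 J2 J3 T) X Y Z = 8 * T X Y Z - 2 * Lmap J1 J2 J3 T X Y Z := by
  have m1 := calVhat_move h hT
  have m2 := calVhat_move h.cyclic (calVhat_cyclic hT)
  have m3 := calVhat_move h.cyclic.cyclic (calVhat_cyclic (calVhat_cyclic hT))
  have s1 := calVhat_swap h hT
  have s2 := calVhat_swap h.cyclic (calVhat_cyclic hT)
  have s3 := calVhat_swap h.cyclic.cyclic (calVhat_cyclic (calVhat_cyclic hT))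
  have s0 := hT.1
  obtain ⟨h11, h22, h33, h12, h21, h23, h32, h31, h13, i1, i2, i3⟩ := h
  simp only [Lmap_apply, m1, m2, m3, h11, h22, h33, h12, h21, h23, h32, h31, h13, map_neg,
    LinearMap.neg_apply, s0 _ Y X, s0 _ Z X, s0 _ Z Y, s1 _ Y X, s2 _ Y X, s3 _ Y X, s1 _ Z X,
    s2 _ Z X, s3 _ Z X, s1 _ Z Y, s2 _ Z Y, s3 _ Z Y]
  ring

theorem calVhat_add {S T : Tri V} (hS : S ∈ calVhat J1 J2 J3) (hT : T ∈ calVhat J1 J2 J3) :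
    S + T ∈ calVhat J1 J2 J3 := by
  refine ⟨fun X Y Z => ?_, fun X Y Z => ?_, fun X Y Z => ?_, fun X Y Z => ?_⟩ <;>
  simp only [LinearMap.add_apply]
  · rw [hS.1, hT.1]; ring
  · rw [hS.2.1, hT.2.1]
  · rw [hS.2.2.1, hT.2.2.1]
  · rw [hS.2.2.2, hT.2.2.2]

theorem calVhat_smul (c : ℝ) {T : Tri V} (hT : T ∈ calVhat J1 J2 J3) :
    c • T ∈ calVhat J1 J2 J3 := by
  refine ⟨fun X Y Z => ?_, fun X Y Z => ?_, fun X Y Z => ?_, fun X Y Z => ?_⟩ <;>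
  simp only [LinearMap.smul_apply, smul_eq_mul]
  · rw [hT.1]; ring
  · rw [hT.2.1]
  · rw [hT.2.2.1]
  · rw [hT.2.2.2]

theorem Lmap_add (S T : Tri V) :
    Lmap J1 J2 J3 (S + T) = Lmap J1 J2 J3 S + Lmap J1 J2 J3 T :=
  tri_ext fun X Y Z => by simp only [Lmap_apply, LinearMap.add_apply]; ring

theorem Lmap_smul (c : ℝ) (T : Tri V) : Lmap J1 J2 J3 (c • T) = c • Lmap J1 J2 J3 T :=
  tri_ext fun X Y Z => by simp only [Lmap_apply, LinearMap.smul_apply, smul_eq_mul]; ring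

/-- The part of a form in `𝒱̂` that satisfies the cyclic identity. -/
def cyclicPart (J1 J2 J3 : V →ₗ[ℝ] V) (T : Tri V) : Tri V :=
  (1 / 3 : ℝ) • T + (-1 / 6 : ℝ) • Lmap J1 J2 J3 T

/-- The complement of `cyclicPart`. -/
def coPart (J1 J2 J3 : V →ₗ[ℝ] V) (T : Tri V) : Tri V :=
  (2 / 3 : ℝ) • T + (1 / 6 : ℝ) • Lmap J1 J2 J3 T

theorem cyclicPart_mem_QK5set (h : IsQH J1 J2 J3) {T : Tri V} (hT : T ∈ calVhat J1 J2 J3) :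
    cyclicPart J1 J2 J3 T ∈ QK5set J1 J2 J3 := by
  refine ⟨calVhat_add (calVhat_smul _ hT) (calVhat_smul _ (Lmap_mem_calVhat h hT)),
    fun X Y Z => ?_⟩
  have m1 := calVhat_move h hT
  have m2 := calVhat_move h.cyclic (calVhat_cyclic hT)
  have m3 := calVhat_move h.cyclic.cyclic (calVhat_cyclic (calVhat_cyclic hT))
  have s1 := calVhat_swap h hT
  have s2 := calVhat_swap h.cyclic (calVhat_cyclic hT)
  have s3 := calVhat_swap h.cyclic.cyclic (calVhat_cyclic (calVhat_cyclic hT))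
  have s0 := hT.1
  simp only [cyclicPart, LinearMap.add_apply, LinearMap.smul_apply, smul_eq_mul, Lmap_apply, m1,
    m2, m3, s0 _ Y X, s0 _ Z X, s0 _ Z Y, s1 _ Y X, s2 _ Y X, s3 _ Y X, s1 _ Z X,
    s2 _ Z X, s3 _ Z X, s1 _ Z Y, s2 _ Z Y, s3 _ Z Y]
  ring

theorem Lmap_coPart (h : IsQH J1 J2 J3) {T : Tri V} (hT : T ∈ calVhat J1 J2 J3) :
    Lmap J1 J2 J3 (coPart J1 J2 J3 T) = (2 : ℝ) • coPart J1 J2 J3 T := by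
  refine tri_ext fun X Y Z => ?_
  simp only [coPart, Lmap_add, Lmap_smul, LinearMap.add_apply, LinearMap.smul_apply, smul_eq_mul,
    Lmap_Lmap h hT]
  ring

variable {n : ℕ} (e : OrthonormalBasis (Fin (4 * n)) ℝ V)

/-- The trace `c₁₂` of a trilinear form as a linear form. -/
def c12Form (T : Tri V) : V →ₗ[ℝ] ℝ := ∑ r, T (e r) (e r)

theorem c12Form_apply (T : Tri V) (Z : V) : c12Form e T Z = c12 e T Z := by
  simp [c12Form, c12]

theorem c12_Ttheta (h : IsQH J1 J2 J3) (θ : V →ₗ[ℝ] ℝ) (Z : V) :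
    c12 e (Ttheta J1 J2 J3 θ) Z = (4 * n + 2) * θ Z := by
  have k0 : ∀ f : V →ₗ[ℝ] ℝ, ∑ r, ⟪e r, Z⟫ * f (e r) = f Z := fun f => by
    simpa only [real_inner_comm] using sum_inner_smul_apply e f Z
  have k1 : ∑ r, ⟪e r, J1 Z⟫ * θ (J1 (e r)) = - θ Z := by
    simpa only [real_inner_comm, LinearMap.comp_apply, h.1, map_neg] using
      sum_inner_smul_apply e (θ.comp J1) (J1 Z)
  have k2 : ∑ r, ⟪e r, J2 Z⟫ * θ (J2 (e r)) = - θ Z := by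
    simpa only [real_inner_comm, LinearMap.comp_apply, h.2.1, map_neg] using
      sum_inner_smul_apply e (θ.comp J2) (J2 Z)
  have k3 : ∑ r, ⟪e r, J3 Z⟫ * θ (J3 (e r)) = - θ Z := by
    simpa only [real_inner_comm, LinearMap.comp_apply, h.2.2.1, map_neg] using
      sum_inner_smul_apply e (θ.comp J3) (J3 Z)
  simp only [c12, Ttheta_apply, TthetaForm, h.inner_self, h.cyclic.inner_self,
    h.cyclic.cyclic.inner_self, real_inner_self_eq_norm_sq, e.norm_eq_one, Finset.sum_add_distrib,
    Finset.sum_sub_distrib, k0, k1, k2, k3]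
  simp
  ring

theorem coPart_sub_Ttheta_mem_QK4set (h : IsQH J1 J2 J3) {T : Tri V}
    (hT : T ∈ calVhat J1 J2 J3) :
    coPart J1 J2 J3 T + (-1 : ℝ) • Ttheta J1 J2 J3
      ((4 * n + 2 : ℝ)⁻¹ • c12Form e (coPart J1 J2 J3 T)) ∈ QK4set J1 J2 J3 e := by
  set θ := (4 * n + 2 : ℝ)⁻¹ • c12Form e (coPart J1 J2 J3 T)
  have hV : coPart J1 J2 J3 T + (-1 : ℝ) • Ttheta J1 J2 J3 θ ∈ calVhat J1 J2 J3 :=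
    calVhat_add (calVhat_add (calVhat_smul _ hT) (calVhat_smul _ (Lmap_mem_calVhat h hT)))
      (calVhat_smul _ (Ttheta_mem_calVhat h θ))
  refine ⟨hV, (Lmap_eq_iff hV).1 ?_, fun Z => ?_⟩
  · rw [Lmap_add, Lmap_smul, Lmap_coPart h hT, Lmap_Ttheta h, smul_add, smul_comm]
  · have hpos : (4 * n + 2 : ℝ) ≠ 0 := by positivity
    have h1 : c12 e (coPart J1 J2 J3 T + (-1 : ℝ) • Ttheta J1 J2 J3 θ) Z
        = c12 e (coPart J1 J2 J3 T) Z - c12 e (Ttheta J1 J2 J3 θ) Z := by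
      simp [c12, sub_eq_add_neg, Finset.sum_add_distrib]
    rw [h1, c12_Ttheta e h]
    simp only [θ, LinearMap.smul_apply, c12Form_apply, smul_eq_mul]
    field_simp
    ring

theorem sub_checkForm_mem_calVhat (h : IsQH J1 J2 J3) {S : Tri V} (hS : S ∈ calV J1 J2 J3) :
    ∃ π1 π2 π3 : V →ₗ[ℝ] ℝ, S - checkForm J1 J2 J3 π1 π2 π3 ∈ calVhat J1 J2 J3 := by
  obtain ⟨h0, π1, π2, π3, hπ⟩ := hS
  refine ⟨(1 / 2 : ℝ) • π1, (1 / 2 : ℝ) • π2, (1 / 2 : ℝ) • π3, ?_⟩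
  have j1 := h.inner_right
  have j2 := h.cyclic.inner_right
  have j3 := h.cyclic.cyclic.inner_right
  obtain ⟨h11, h22, h33, h12, h21, h23, h32, h31, h13, i1, i2, i3⟩ := h
  refine ⟨fun X Y Z => ?_, fun X Y Z => ?_, fun X Y Z => ?_, fun X Y Z => ?_⟩
  · simp only [LinearMap.sub_apply, checkForm_apply]
    rw [h0, real_inner_comm Z, j1, real_inner_comm Z (J2 Y), j2, real_inner_comm Z (J3 Y), j3]
    ring
  · have := (hπ X Y Z).1
    simp only [LinearMap.sub_apply, checkForm_apply, j1, j2, j3, h11, h22, h33, h12, h21, h23, h32,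
      h31, h13, map_neg, inner_neg_left, LinearMap.smul_apply, smul_eq_mul] at this ⊢
    linarith
  · have := (hπ X Y Z).2.1
    simp only [LinearMap.sub_apply, checkForm_apply, j1, j2, j3, h11, h22, h33, h12, h21, h23, h32,
      h31, h13, map_neg, inner_neg_left, LinearMap.smul_apply, smul_eq_mul] at this ⊢
    linarith
  · have := (hπ X Y Z).2.2
    simp only [LinearMap.sub_apply, checkForm_apply, j1, j2, j3, h11, h22, h33, h12, h21, h23, h32,
      h31, h13, map_neg, inner_neg_left, LinearMap.smul_apply, smul_eq_mul] at this ⊢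
    linarith

theorem checkForm_decomposition (h : IsQH J1 J2 J3) (π1 π2 π3 : V →ₗ[ℝ] ℝ) :
    ∃ S ∈ calVcheck0perp J1 J2 J3, ∃ T ∈ calVcheck0 J1 J2 J3,
      checkForm J1 J2 J3 π1 π2 π3 = S + T := by
  let θ : V →ₗ[ℝ] ℝ := (-1 / 3 : ℝ) • (π1.comp J1 + π2.comp J2 + π3.comp J3)
  refine ⟨_, calVcheck0perp_iff.2 ⟨θ, rfl⟩, _,
    calVcheck0_iff.2 ⟨π1 - θ.comp J1, π2 - θ.comp J2, π3 - θ.comp J3, rfl, fun X => ?_⟩,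
    tri_ext fun X Y Z => ?_⟩
  · obtain ⟨h11, h22, h33, -⟩ := h
    simp only [LinearMap.sub_apply, LinearMap.comp_apply, h11, h22, h33, map_neg, θ,
      LinearMap.smul_apply, LinearMap.add_apply, smul_eq_mul]
    ring
  · simp only [LinearMap.add_apply, checkForm_apply, LinearMap.sub_apply]
    ring

theorem exists_eq_sum_of_mem_calV (h : IsQH J1 J2 J3) {S : Tri V} (hS : S ∈ calV J1 J2 J3) :
    ∃ f : Fin 5 → Tri V, (∀ i, f i ∈ QKfam J1 J2 J3 e i) ∧ S = ∑ i, f i := by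
  obtain ⟨π1, π2, π3, hT⟩ := sub_checkForm_mem_calVhat h hS
  obtain ⟨A, hA, B, hB, hAB⟩ := checkForm_decomposition h π1 π2 π3
  set T := S - checkForm J1 J2 J3 π1 π2 π3 with hTdef
  refine ⟨![A, B, Ttheta J1 J2 J3 ((4 * n + 2 : ℝ)⁻¹ • c12Form e (coPart J1 J2 J3 T)),
    coPart J1 J2 J3 T + (-1 : ℝ) • Ttheta J1 J2 J3
      ((4 * n + 2 : ℝ)⁻¹ • c12Form e (coPart J1 J2 J3 T)),
    cyclicPart J1 J2 J3 T], fun i => ?_, ?_⟩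
  · fin_cases i
    · exact hA
    · exact hB
    · exact Ttheta_mem _
    · exact coPart_sub_Ttheta_mem_QK4set e h hT
    · exact cyclicPart_mem_QK5set h hT
  · have hsplit : S = A + B + T := by rw [hTdef, hAB]; abel
    refine tri_ext fun X Y Z => ?_
    rw [Fin.sum_univ_five, hsplit]
    simp [coPart, cyclicPart]
    ring

end Decomposition

section InvariantSubspaces

variable {J1 J2 J3 : V →ₗ[ℝ] V}

/-- A subspace of trilinear forms invariant under all `Sp(n)Sp(1)`-transformations. -/
def ActInv (J1 J2 J3 : V →ₗ[ℝ] V) (W : Submodule ℝ (Tri V)) : Prop :=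
  ∀ A : V ≃ₗᵢ[ℝ] V, IsSpnSp1 J1 J2 J3 A → ∀ S ∈ W, act A S ∈ W

/-- An endomorphism commuting with `J₁`, `J₂`, `J₃`. -/
structure QLinear (J1 J2 J3 g : V →ₗ[ℝ] V) : Prop where
  map1 : ∀ X, g (J1 X) = J1 (g X)
  map2 : ∀ X, g (J2 X) = J2 (g X)
  map3 : ∀ X, g (J3 X) = J3 (g X)

theorem QLinear.cyclic {g : V →ₗ[ℝ] V} (hg : QLinear J1 J2 J3 g) : QLinear J2 J3 J1 g :=
  ⟨hg.map2, hg.map3, hg.map1⟩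

theorem IsSpnSp1.of_cyclic {A : V ≃ₗᵢ[ℝ] V} (hA : IsSpnSp1 J2 J3 J1 A) :
    IsSpnSp1 J1 J2 J3 A := by
  obtain ⟨m, hm, hd, h1, h2, h3⟩ := hA
  refine ⟨m.submatrix (Equiv.addRight (2 : Fin 3)) (Equiv.addRight (2 : Fin 3)), ?_, ?_,
    fun X => ?_, fun X => ?_, fun X => ?_⟩
  · rw [Matrix.transpose_submatrix, Matrix.submatrix_mul_equiv, hm, Matrix.submatrix_one_equiv]
  · rw [Matrix.det_submatrix_equiv_self, hd]
  · rw [h3]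
    change _ = m 2 2 • _ + m 2 0 • _ + m 2 1 • _
    abel
  · rw [h1]
    change _ = m 0 2 • _ + m 0 0 • _ + m 0 1 • _
    abel
  · rw [h2]
    change _ = m 1 2 • _ + m 1 0 • _ + m 1 1 • _
    abel

theorem ActInv.cyclic {W : Submodule ℝ (Tri V)} (hW : ActInv J1 J2 J3 W) : ActInv J2 J3 J1 W :=
  fun A hA => hW A hA.of_cyclic

theorem ActInv.pull_mem [FiniteDimensional ℝ V] {W : Submodule ℝ (Tri V)}
    (hW : ActInv J1 J2 J3 W) {g : V →ₗ[ℝ] V} (hg : PreservesInner g) (hQ : QLinear J1 J2 J3 g)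
    {S : Tri V} (hS : S ∈ W) : pull g S ∈ W := by
  have h1 : IsSpnSp1 J1 J2 J3 hg.toEquiv := by
    refine ⟨1, by simp, by simp, fun X => ?_, fun X => ?_, fun X => ?_⟩ <;>
    simp [PreservesInner.toEquiv_apply, hQ.map1, hQ.map2, hQ.map3, Matrix.one_apply]
  exact hW _ h1.symm S hS

theorem IsQH.preservesInner_rot (h : IsQH J1 J2 J3) {c s : ℝ} (hcs : c ^ 2 + s ^ 2 = 1) :
    PreservesInner (c • LinearMap.id + s • J1) := by
  intro X Y
  simp only [LinearMap.add_apply, LinearMap.smul_apply, LinearMap.id_apply, inner_add_left,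
    inner_add_right, real_inner_smul_left, real_inner_smul_right, h.preservesInner X Y,
    h.inner_left X Y]
  linear_combination hcs * ⟪X, Y⟫

theorem ActInv.pull_rot_mem [FiniteDimensional ℝ V] (h : IsQH J1 J2 J3)
    {W : Submodule ℝ (Tri V)} (hW : ActInv J1 J2 J3 W) {c s : ℝ} (hcs : c ^ 2 + s ^ 2 = 1)
    {S : Tri V} (hS : S ∈ W) : pull (c • LinearMap.id + s • J1) S ∈ W := by
  have hg := h.preservesInner_rot hcs
  have h1 : IsSpnSp1 J1 J2 J3 hg.toEquiv := by
    obtain ⟨h11, h22, h33, h12, h21, h23, h32, h31, h13, i1, i2, i3⟩ := h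
    refine ⟨!![1, 0, 0; 0, c ^ 2 - s ^ 2, 2 * c * s; 0, -2 * c * s, c ^ 2 - s ^ 2], ?_, ?_,
      fun X => ?_, fun X => ?_, fun X => ?_⟩
    · ext i j
      fin_cases i <;> fin_cases j <;>
      simp [Matrix.mul_apply, Fin.sum_univ_three] <;>
      first
      | linear_combination (c ^ 2 + s ^ 2 + 1) * hcs
      | ring
    · simp [Matrix.det_fin_three]
      linear_combination (c ^ 2 + s ^ 2 + 1) * hcs
    · simp [PreservesInner.toEquiv_apply]
    · simp only [PreservesInner.toEquiv_apply, LinearMap.add_apply, LinearMap.smul_apply,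
        LinearMap.id_apply, map_add, map_smul, h21, h31, h12]
      simp
      linear_combination (norm := module) (-hcs) • (c • J2 X + s • J3 X)
    · simp only [PreservesInner.toEquiv_apply, LinearMap.add_apply, LinearMap.smul_apply,
        LinearMap.id_apply, map_add, map_smul, h21, h31, h13]
      simp
      linear_combination (norm := module) (-hcs) • (c • J3 X - s • J2 X)
  exact hW _ h1.symm S hS

variable {n : ℕ} (e : OrthonormalBasis (Fin (4 * n)) ℝ V)

theorem tinner_act (A : V ≃ₗᵢ[ℝ] V) (S T : Tri V) :
    tinner e S (act A T) = tinner e (act A.symm S) T := by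
  have hA : PreservesInner A.symm.toLinearMap := fun X Y => A.symm.inner_map_map X Y
  rw [← tinner_pull e hA (act A.symm S), ← act_eq_pull]
  congr 1
  exact tri_ext fun X Y Z => by simp

theorem eq_bot_or_eq_of_forall_disjoint (e : OrthonormalBasis (Fin (4 * n)) ℝ V)
    {Q : Submodule ℝ (Tri V)} (hQ : ActInv J1 J2 J3 Q)
    (key : ∀ W W' : Submodule ℝ (Tri V), W ≤ Q → W' ≤ Q → ActInv J1 J2 J3 W →
      ActInv J1 J2 J3 W' → Disjoint W W' → W = ⊥ ∨ W' = ⊥)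
    {W : Submodule ℝ (Tri V)} (hWQ : W ≤ Q) (hW : ActInv J1 J2 J3 W) : W = ⊥ ∨ W = Q := by
  let W' : Submodule ℝ (Tri V) :=
    { carrier := {T | T ∈ Q ∧ ∀ S ∈ W, tinner e S T = 0}
      add_mem' := fun ha hb => ⟨Q.add_mem ha.1 hb.1, fun S hS => by
        rw [tinner_add_right, ha.2 S hS, hb.2 S hS, add_zero]⟩
      zero_mem' := ⟨Q.zero_mem, fun S _ => by simp [tinner]⟩
      smul_mem' := fun c T hT => ⟨Q.smul_mem c hT.1, fun S hS => by
        rw [tinner_smul_right, hT.2 S hS, mul_zero]⟩ }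
  have hW' : ActInv J1 J2 J3 W' := fun A hA T hT =>
    ⟨hQ A hA T hT.1, fun S hS => by rw [tinner_act]; exact hT.2 _ (hW _ hA.symm S hS)⟩
  have hdisj : Disjoint W W' := by
    rw [Submodule.disjoint_def]
    exact fun S hS hS' => eq_zero_of_tinner_self_eq_zero e (hS'.2 S hS)
  refine (key W W' hWQ (fun T hT => hT.1) hW hW' hdisj).imp id fun hbot => ?_
  refine le_antisymm hWQ fun S hS => ?_
  obtain ⟨w, hw, hort⟩ := exists_mem_forall_tinner_sub_eq_zero e W S
  have hmem : S - w ∈ W' := ⟨Q.sub_mem hS (hWQ hw), hort⟩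
  rw [hbot, Submodule.mem_bot, sub_eq_zero] at hmem
  exact hmem ▸ hw

end InvariantSubspaces

section Rotations

variable {J1 J2 J3 : V →ₗ[ℝ] V}

/-- `P` is an orthogonal projection and `B` an orthogonal complex structure on its range, extended
by zero. -/
structure IsRot (P B : V →ₗ[ℝ] V) : Prop where
  adjP : ∀ X Y, ⟪P X, Y⟫ = ⟪X, P Y⟫
  adjB : ∀ X Y, ⟪B X, Y⟫ = -⟪X, B Y⟫
  PP : ∀ X, P (P X) = P X
  PB : ∀ X, P (B X) = B X
  BP : ∀ X, B (P X) = B X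
  BB : ∀ X, B (B X) = -P X

/-- The map that is the identity on `ker P` and acts as `c + s B` on the range of `P`. -/
def rotMap (P B : V →ₗ[ℝ] V) (c s : ℝ) : V →ₗ[ℝ] V := LinearMap.id - P + c • P + s • B

@[simp] theorem rotMap_apply (P B : V →ₗ[ℝ] V) (c s : ℝ) (X : V) :
    rotMap P B c s X = X - P X + c • P X + s • B X := rfl

theorem IsRot.preservesInner {P B : V →ₗ[ℝ] V} (h : IsRot P B) {c s : ℝ}
    (hcs : c ^ 2 + s ^ 2 = 1) : PreservesInner (rotMap P B c s) := by
  intro X Y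
  simp only [rotMap_apply, inner_add_left, inner_add_right, inner_sub_left, inner_sub_right,
    real_inner_smul_left, real_inner_smul_right, map_smul, h.adjP, h.adjB, h.PP, h.PB, h.BP, h.BB,
    inner_neg_right]
  linear_combination hcs * ⟪X, P Y⟫

theorem IsRot.add {P B P' B' : V →ₗ[ℝ] V} (h : IsRot P B) (h' : IsRot P' B')
    (h1 : ∀ X, P (P' X) = 0) (h2 : ∀ X, P' (P X) = 0) : IsRot (P + P') (B + B') := by
  have a1 : ∀ X, P (B' X) = 0 := fun X => by rw [← h'.PB, h1]
  have a2 : ∀ X, P' (B X) = 0 := fun X => by rw [← h.PB, h2]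
  have a3 : ∀ X, B (P' X) = 0 := fun X => by rw [← h.BP, h1, map_zero]
  have a4 : ∀ X, B' (P X) = 0 := fun X => by rw [← h'.BP, h2, map_zero]
  have a5 : ∀ X, B (B' X) = 0 := fun X => by rw [← h.BP, a1, map_zero]
  have a6 : ∀ X, B' (B X) = 0 := fun X => by rw [← h'.BP, a2, map_zero]
  constructor <;> intros <;>
  simp only [LinearMap.add_apply, map_add, inner_add_left, inner_add_right, h.adjP, h'.adjP,
    h.adjB, h'.adjB, h.PP, h'.PP, h.PB, h'.PB, h.BP, h'.BP, h.BB, h'.BB, h1, h2, a1, a2, a3, a4,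
    a5, a6, add_zero, zero_add, neg_add]

theorem QLinear.rotMap {P B : V →ₗ[ℝ] V} (hP : QLinear J1 J2 J3 P) (hB : QLinear J1 J2 J3 B)
    (c s : ℝ) : QLinear J1 J2 J3 (rotMap P B c s) := by
  constructor <;> intro X <;>
  simp only [rotMap_apply, hP.map1, hP.map2, hP.map3, hB.map1, hB.map2, hB.map3, map_add, map_sub,
    map_smul]

theorem QLinear.add {P B : V →ₗ[ℝ] V} (hP : QLinear J1 J2 J3 P) (hB : QLinear J1 J2 J3 B) :
    QLinear J1 J2 J3 (P + B) := by
  constructor <;> intro X <;>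
  simp only [LinearMap.add_apply, hP.map1, hP.map2, hP.map3, hB.map1, hB.map2, hB.map3, map_add]

/-- The component of the pullback of `T` along `rotMap` of weight three. -/
def fourPi (P B : V →ₗ[ℝ] V) (T : Tri V) : Tri V :=
  tcomp P P P T - tcomp B B P T - tcomp B P B T - tcomp P B B T

theorem fourPi_apply (P B : V →ₗ[ℝ] V) (T : Tri V) (X Y Z : V) :
    fourPi P B T X Y Z = T (P X) (P Y) (P Z) - T (B X) (B Y) (P Z) - T (B X) (P Y) (B Z)
      - T (P X) (B Y) (B Z) := rfl

theorem fourPi_mem {P B : V →ₗ[ℝ] V} {W : Submodule ℝ (Tri V)} {T : Tri V}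
    (hW : ∀ c s : ℝ, c ^ 2 + s ^ 2 = 1 → pull (rotMap P B c s) T ∈ W) : fourPi P B T ∈ W := by
  have key : fourPi P B T = (25 / 32 : ℝ) • (pull (rotMap P B 1 0) T - pull (rotMap P B (-1) 0) T
      - (5 / 6 : ℝ) • (pull (rotMap P B (3 / 5) (4 / 5)) T
        + pull (rotMap P B (3 / 5) (-4 / 5)) T - pull (rotMap P B (-3 / 5) (4 / 5)) T
        - pull (rotMap P B (-3 / 5) (-4 / 5)) T)) := by
    refine tri_ext fun X Y Z => ?_
    simp only [fourPi_apply, pull_apply, rotMap_apply, map_add, map_sub, map_smul,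
      LinearMap.add_apply, LinearMap.sub_apply, LinearMap.smul_apply, smul_eq_mul]
    ring
  rw [key]
  refine W.smul_mem _ (W.sub_mem (W.sub_mem ?_ ?_) (W.smul_mem _ (W.sub_mem (W.sub_mem
    (W.add_mem ?_ ?_) ?_) ?_))) <;> apply hW <;> norm_num

theorem ActInv.fourPi_mem [FiniteDimensional ℝ V] {W : Submodule ℝ (Tri V)}
    (hW : ActInv J1 J2 J3 W) {P B : V →ₗ[ℝ] V} (h : IsRot P B) (hP : QLinear J1 J2 J3 P)
    (hB : QLinear J1 J2 J3 B) {T : Tri V} (hT : T ∈ W) : fourPi P B T ∈ W :=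
  _root_.fourPi_mem fun c s hcs => hW.pull_mem (h.preservesInner hcs) (hP.rotMap hB c s) hT

theorem ActInv.fourPi_id_mem [FiniteDimensional ℝ V] (h : IsQH J1 J2 J3)
    {W : Submodule ℝ (Tri V)} (hW : ActInv J1 J2 J3 W) {T : Tri V} (hT : T ∈ W) :
    fourPi LinearMap.id J1 T ∈ W :=
  _root_.fourPi_mem fun c s hcs => by
    have h1 : rotMap LinearMap.id J1 c s = c • LinearMap.id + s • J1 := by simp [rotMap]
    exact h1 ▸ hW.pull_rot_mem h hcs hT

/-- The quaternionic rank one operator `X ↦ ⟨u, X⟩ w + ∑ₐ ⟨Jₐ u, X⟩ Jₐ w`. -/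
def qdyad (J1 J2 J3 : V →ₗ[ℝ] V) (u w : V) : V →ₗ[ℝ] V :=
  (innerₗ V u).smulRight w + (innerₗ V (J1 u)).smulRight (J1 w)
    + (innerₗ V (J2 u)).smulRight (J2 w) + (innerₗ V (J3 u)).smulRight (J3 w)

theorem qdyad_apply (u w X : V) :
    qdyad J1 J2 J3 u w X = ⟪u, X⟫ • w + ⟪J1 u, X⟫ • J1 w + ⟪J2 u, X⟫ • J2 w + ⟪J3 u, X⟫ • J3 w := by
  simp [qdyad]

theorem qdyad_cyclic (u w : V) : qdyad J2 J3 J1 u w = qdyad J1 J2 J3 u w :=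
  LinearMap.ext fun X => by simp only [qdyad_apply]; abel

theorem qdyad_map1 (h : IsQH J1 J2 J3) (u w X : V) :
    qdyad J1 J2 J3 u w (J1 X) = J1 (qdyad J1 J2 J3 u w X) := by
  have j1 := h.inner_right
  obtain ⟨h11, h22, h33, h12, h21, h23, h32, h31, h13, i1, i2, i3⟩ := h
  simp only [qdyad_apply, j1, h11, h22, h33, h12, h21, h23, h32, h31, h13, map_add, map_smul,
    inner_neg_left]
  module

theorem qdyad_qLinear (h : IsQH J1 J2 J3) (u w : V) : QLinear J1 J2 J3 (qdyad J1 J2 J3 u w) where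
  map1 := qdyad_map1 h u w
  map2 X := by
    have := qdyad_map1 h.cyclic u w X
    rwa [qdyad_cyclic] at this
  map3 X := by
    have := qdyad_map1 h.cyclic.cyclic u w X
    rwa [qdyad_cyclic, qdyad_cyclic] at this

theorem qdyad_adjoint (u w X Y : V) :
    ⟪qdyad J1 J2 J3 u w X, Y⟫ = ⟪X, qdyad J1 J2 J3 w u Y⟫ := by
  simp only [qdyad_apply, inner_add_left, inner_add_right, real_inner_smul_left,
    real_inner_smul_right, real_inner_comm X]
  ring

theorem QLinear.qdyad {f : V →ₗ[ℝ] V} (hf : QLinear J1 J2 J3 f) (u w X : V) :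
    f (qdyad J1 J2 J3 u w X) = qdyad J1 J2 J3 u (f w) X := by
  simp only [qdyad_apply, map_add, map_smul, hf.map1, hf.map2, hf.map3]

theorem qdyad_self (h : IsQH J1 J2 J3) (u w : V) : qdyad J1 J2 J3 u w u = ⟪u, u⟫ • w := by
  simp [qdyad_apply, real_inner_comm u, h.inner_self, h.cyclic.inner_self,
    h.cyclic.cyclic.inner_self]

theorem qdyad_J1_left (h : IsQH J1 J2 J3) (u w X : V) :
    qdyad J1 J2 J3 (J1 u) w X = -qdyad J1 J2 J3 u (J1 w) X := by
  obtain ⟨h11, h22, h33, h12, h21, h23, h32, h31, h13, i1, i2, i3⟩ := h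
  simp only [qdyad_apply, h11, h22, h33, h12, h21, h23, h32, h31, h13, inner_neg_left]
  module

theorem isRot_qdyad (h : IsQH J1 J2 J3) {u : V} (hu : ⟪u, u⟫ = 1) :
    IsRot (qdyad J1 J2 J3 u u) (qdyad J1 J2 J3 u (J1 u)) := by
  have hq := fun w => qdyad_qLinear h u w
  have hs := fun w => qdyad_self h u w
  simp only [hu, one_smul] at hs
  refine ⟨qdyad_adjoint u u, fun X Y => ?_, fun X => ?_, fun X => ?_, fun X => ?_, fun X => ?_⟩
  · rw [qdyad_adjoint, qdyad_J1_left h, inner_neg_right]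
  · rw [(hq u).qdyad, hs]
  · rw [(hq u).qdyad, (hq u).map1, hs]
  · rw [(hq (J1 u)).qdyad, hs]
  · rw [(hq (J1 u)).qdyad, (hq (J1 u)).map1, hs, h.1]
    simp [qdyad_apply]
    module

end Rotations

section DualSpace

variable {J1 J2 J3 : V →ₗ[ℝ] V}

/-- A subspace of `V*` invariant under precomposition with `Sp(n)`. -/
def DualInv (J1 J2 J3 : V →ₗ[ℝ] V) (U : Submodule ℝ (V →ₗ[ℝ] ℝ)) : Prop :=
  ∀ g, PreservesInner g → QLinear J1 J2 J3 g → ∀ θ ∈ U, θ.comp g ∈ U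

theorem DualInv.comp_qdyad_mem (h : IsQH J1 J2 J3) {U : Submodule ℝ (V →ₗ[ℝ] ℝ)}
    (hU : DualInv J1 J2 J3 U) {θ : V →ₗ[ℝ] ℝ} (hθ : θ ∈ U) {u : V} (hu : ⟪u, u⟫ = 1) :
    θ.comp (qdyad J1 J2 J3 u u) ∈ U ∧ θ.comp (qdyad J1 J2 J3 u (J1 u)) ∈ U := by
  have hr := isRot_qdyad h hu
  have hP := qdyad_qLinear h u u
  have hB := qdyad_qLinear h u (J1 u)
  have m1 := hU _ (hr.preservesInner (c := -1) (s := 0) (by norm_num)) (hP.rotMap hB _ _) θ hθ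
  have m2 := hU _ (hr.preservesInner (c := 0) (s := 1) (by norm_num)) (hP.rotMap hB _ _) θ hθ
  have e1 : θ.comp (qdyad J1 J2 J3 u u) = (1 / 2 : ℝ) •
      (θ - θ.comp (rotMap (qdyad J1 J2 J3 u u) (qdyad J1 J2 J3 u (J1 u)) (-1) 0)) := by
    ext X
    simp
    ring
  have h1 : θ.comp (qdyad J1 J2 J3 u u) ∈ U := e1 ▸ U.smul_mem _ (U.sub_mem hθ m1)
  refine ⟨h1, ?_⟩
  have e2 : θ.comp (qdyad J1 J2 J3 u (J1 u)) =
      θ.comp (rotMap (qdyad J1 J2 J3 u u) (qdyad J1 J2 J3 u (J1 u)) 0 1) - θ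
        + θ.comp (qdyad J1 J2 J3 u u) := by
    ext X
    simp
    ring
  rw [e2]
  exact U.add_mem (U.sub_mem m2 hθ) h1

theorem DualInv.innerₗ_mem_of_unit (h : IsQH J1 J2 J3) {U : Submodule ℝ (V →ₗ[ℝ] ℝ)}
    (hU : DualInv J1 J2 J3 U) {θ : V →ₗ[ℝ] ℝ} (hθ : θ ∈ U) {u : V} (hu : ⟪u, u⟫ = 1)
    (h0 : θ u ≠ 0) : innerₗ V u ∈ U := by
  have m1 := hU.comp_qdyad_mem h hθ hu
  have hU2 : DualInv J2 J3 J1 U := fun g hg hq => hU g hg hq.cyclic.cyclic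
  have hU3 : DualInv J3 J1 J2 U := fun g hg hq => hU g hg hq.cyclic
  have m2 := (hU2.comp_qdyad_mem h.cyclic hθ hu).2
  have m3 := (hU3.comp_qdyad_mem h.cyclic.cyclic hθ hu).2
  rw [qdyad_cyclic] at m2
  rw [qdyad_cyclic, qdyad_cyclic] at m3
  set N := θ u ^ 2 + θ (J1 u) ^ 2 + θ (J2 u) ^ 2 + θ (J3 u) ^ 2 with hN
  have hN0 : N ≠ 0 := by positivity
  have key : innerₗ V u = N⁻¹ • (θ u • θ.comp (qdyad J1 J2 J3 u u)
      + θ (J1 u) • θ.comp (qdyad J1 J2 J3 u (J1 u)) + θ (J2 u) • θ.comp (qdyad J1 J2 J3 u (J2 u))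
      + θ (J3 u) • θ.comp (qdyad J1 J2 J3 u (J3 u))) := by
    rw [eq_inv_smul_iff₀ hN0]
    obtain ⟨h11, h22, h33, h12, h21, h23, h32, h31, h13, i1, i2, i3⟩ := h
    ext X
    simp only [LinearMap.add_apply, LinearMap.smul_apply, LinearMap.comp_apply, qdyad_apply,
      map_add, map_smul, smul_eq_mul, innerₗ_apply_apply, h11, h22, h33, h12, h21, h23, h32,
      h31, h13, map_neg]
    rw [hN]
    ring
  rw [key]
  exact U.smul_mem _ (U.add_mem (U.add_mem (U.add_mem (U.smul_mem _ m1.1) (U.smul_mem _ m1.2))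
    (U.smul_mem _ m2)) (U.smul_mem _ m3))

theorem DualInv.innerₗ_mem (h : IsQH J1 J2 J3) {U : Submodule ℝ (V →ₗ[ℝ] ℝ)}
    (hU : DualInv J1 J2 J3 U) {θ : V →ₗ[ℝ] ℝ} (hθ : θ ∈ U) {u : V} (h0 : θ u ≠ 0) :
    innerₗ V u ∈ U := by
  have hu : ‖u‖ ≠ 0 := by
    rw [norm_ne_zero_iff]
    rintro rfl
    simp at h0
  have h1 : ⟪‖u‖⁻¹ • u, ‖u‖⁻¹ • u⟫ = 1 := by
    rw [real_inner_smul_left, real_inner_smul_right, real_inner_self_eq_norm_sq]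
    field_simp
  have h2 := hU.innerₗ_mem_of_unit h hθ h1 (by simp [h0, hu])
  rwa [map_smul, U.smul_mem_iff (inv_ne_zero hu)] at h2

theorem DualInv.eq_bot_or_eq_top (h : IsQH J1 J2 J3) {n : ℕ}
    (e : OrthonormalBasis (Fin (4 * n)) ℝ V) {U : Submodule ℝ (V →ₗ[ℝ] ℝ)}
    (hU : DualInv J1 J2 J3 U) : U = ⊥ ∨ U = ⊤ := by
  refine or_iff_not_imp_left.2 fun hne => ?_
  obtain ⟨θ, hθ, hθ0⟩ := U.ne_bot_iff.1 hne
  obtain ⟨u, hu⟩ : ∃ u, θ u ≠ 0 := by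
    by_contra! hc
    exact hθ0 (LinearMap.ext hc)
  have hall : ∀ w, innerₗ V w ∈ U := fun w => by
    by_cases hw : θ w = 0
    · have h1 := hU.innerₗ_mem h hθ (u := w + u) (by simpa [hw] using hu)
      have h2 := U.sub_mem h1 (hU.innerₗ_mem h hθ hu)
      rwa [map_add, add_sub_cancel_right] at h2
    · exact hU.innerₗ_mem h hθ hw
  refine eq_top_iff.2 fun φ _ => ?_
  have key : φ = ∑ r, φ (e r) • innerₗ V (e r) := by
    ext X
    rw [← sum_inner_smul_apply e φ X]
    simp [mul_comm, real_inner_comm]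
  rw [key]
  exact U.sum_mem fun r _ => U.smul_mem _ (hall _)

theorem eq_zero_or_eq_of_dualInv (h : IsQH J1 J2 J3) {n : ℕ}
    (e : OrthonormalBasis (Fin (4 * n)) ℝ V) {W : Submodule ℝ (Tri V)} {Q : Set (Tri V)}
    (F : (V →ₗ[ℝ] ℝ) →ₗ[ℝ] Tri V) (hF : ∀ T, T ∈ Q ↔ ∃ θ, T = F θ) (hWQ : (W : Set (Tri V)) ⊆ Q)
    (hpull : DualInv J1 J2 J3 (W.comap F)) :
    (W : Set (Tri V)) = {0} ∨ (W : Set (Tri V)) = Q := by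
  rcases hpull.eq_bot_or_eq_top h e with hb | ht
  · left
    refine Set.Subset.antisymm (fun T hT => ?_) (by simp)
    obtain ⟨θ, rfl⟩ := (hF T).1 (hWQ hT)
    have h1 : θ ∈ W.comap F := hT
    rw [hb, Submodule.mem_bot] at h1
    simp [h1]
  · right
    refine Set.Subset.antisymm hWQ fun T hT => ?_
    obtain ⟨θ, rfl⟩ := (hF T).1 hT
    have h1 : θ ∈ W.comap F := ht ▸ Submodule.mem_top
    exact h1

/-- The parametrisation of `𝒬𝒦₁` by `V*`. -/
def checkPerp (J1 J2 J3 : V →ₗ[ℝ] V) : (V →ₗ[ℝ] ℝ) →ₗ[ℝ] Tri V where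
  toFun θ := checkForm J1 J2 J3 (θ.comp J1) (θ.comp J2) (θ.comp J3)
  map_add' θ θ' := tri_ext fun X Y Z => by simp [checkForm_apply]; ring
  map_smul' c θ := tri_ext fun X Y Z => by simp [checkForm_apply]; ring

/-- The parametrisation of `𝒬𝒦₃` by `V*`. -/
def thetaMap (J1 J2 J3 : V →ₗ[ℝ] V) : (V →ₗ[ℝ] ℝ) →ₗ[ℝ] Tri V where
  toFun := Ttheta J1 J2 J3
  map_add' θ θ' := tri_ext fun X Y Z => by simp [Ttheta_apply, TthetaForm]; ring
  map_smul' c θ := tri_ext fun X Y Z => by simp [Ttheta_apply, TthetaForm]; ring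

theorem irreducible_calVcheck0perp (h : IsQH J1 J2 J3) {n : ℕ}
    (e : OrthonormalBasis (Fin (4 * n)) ℝ V) {W : Submodule ℝ (Tri V)}
    (hWQ : (W : Set (Tri V)) ⊆ calVcheck0perp J1 J2 J3) (hW : ActInv J1 J2 J3 W) :
    (W : Set (Tri V)) = {0} ∨ (W : Set (Tri V)) = calVcheck0perp J1 J2 J3 := by
  have := finiteDimensional_of_orthonormalBasis e
  refine eq_zero_or_eq_of_dualInv h e (checkPerp J1 J2 J3) (fun T => calVcheck0perp_iff) hWQ
    fun g hg hq θ hθ => ?_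
  have h1 := hW.pull_mem hg hq (Submodule.mem_comap.1 hθ)
  have h2 : pull g (checkPerp J1 J2 J3 θ) = checkPerp J1 J2 J3 (θ.comp g) :=
    tri_ext fun X Y Z => by
      simp [checkPerp, checkForm_apply, ← hq.map1, ← hq.map2, ← hq.map3, hg _ _]
  exact Submodule.mem_comap.2 (h2 ▸ h1)

theorem irreducible_TthetaSet (h : IsQH J1 J2 J3) {n : ℕ}
    (e : OrthonormalBasis (Fin (4 * n)) ℝ V) {W : Submodule ℝ (Tri V)}
    (hWQ : (W : Set (Tri V)) ⊆ TthetaSet J1 J2 J3) (hW : ActInv J1 J2 J3 W) :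
    (W : Set (Tri V)) = {0} ∨ (W : Set (Tri V)) = TthetaSet J1 J2 J3 := by
  have := finiteDimensional_of_orthonormalBasis e
  refine eq_zero_or_eq_of_dualInv h e (thetaMap J1 J2 J3)
    (fun T => ⟨fun ⟨θ, hθ⟩ => ⟨θ, eq_Ttheta hθ⟩, fun ⟨θ, hθ⟩ => hθ ▸ Ttheta_mem θ⟩) hWQ
    fun g hg hq θ hθ => ?_
  have h1 := hW.pull_mem hg hq (Submodule.mem_comap.1 hθ)
  have h2 : pull g (thetaMap J1 J2 J3 θ) = thetaMap J1 J2 J3 (θ.comp g) :=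
    tri_ext fun X Y Z => by
      simp [thetaMap, Ttheta_apply, TthetaForm, ← hq.map1, ← hq.map2, ← hq.map3, hg _ _]
  exact Submodule.mem_comap.2 (h2 ▸ h1)

end DualSpace

section CheckZero

variable {J1 J2 J3 : V →ₗ[ℝ] V}

theorem checkForm_cyclic (π1 π2 π3 : V →ₗ[ℝ] ℝ) :
    checkForm J2 J3 J1 π2 π3 π1 = checkForm J1 J2 J3 π1 π2 π3 :=
  tri_ext fun X Y Z => by simp only [checkForm_apply]; ring

/-- The part of `𝒬𝒦₂` of weight three for the circle generated by `J₁`. -/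
def checkTop (J1 J2 J3 : V →ₗ[ℝ] V) : (V →ₗ[ℝ] ℝ) →ₗ[ℝ] Tri V where
  toFun β := checkForm J1 J2 J3 0 β (β.comp J1)
  map_add' θ θ' := tri_ext fun X Y Z => by simp [checkForm_apply]; ring
  map_smul' c θ := tri_ext fun X Y Z => by simp [checkForm_apply]; ring

theorem checkTop_eq (β : V →ₗ[ℝ] ℝ) :
    checkTop J1 J2 J3 β = checkForm J1 J2 J3 0 β (β.comp J1) := rfl

theorem fourPi_checkForm (h : IsQH J1 J2 J3) (π1 π2 π3 : V →ₗ[ℝ] ℝ) :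
    fourPi LinearMap.id J1 (checkForm J1 J2 J3 π1 π2 π3) =
      (2 : ℝ) • checkTop J1 J2 J3 (π2 - π3.comp J1) := by
  have j1 := h.inner_right
  obtain ⟨h11, h22, h33, h12, h21, h23, h32, h31, h13, i1, i2, i3⟩ := h
  refine tri_ext fun X Y Z => ?_
  simp only [fourPi_apply, checkTop_eq, checkForm_apply, LinearMap.smul_apply, LinearMap.sub_apply,
    LinearMap.comp_apply, LinearMap.id_apply, LinearMap.zero_apply, smul_eq_mul, map_neg, j1, h11,
    h22, h33, h12, h21, h23, h32, h31, h13, inner_neg_left]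
  ring

theorem ActInv.checkTop_mem [FiniteDimensional ℝ V] (h : IsQH J1 J2 J3)
    {W : Submodule ℝ (Tri V)} (hW : ActInv J1 J2 J3 W) {π1 π2 π3 : V →ₗ[ℝ] ℝ}
    (hT : checkForm J1 J2 J3 π1 π2 π3 ∈ W) : checkTop J1 J2 J3 (π2 - π3.comp J1) ∈ W := by
  have h1 := hW.fourPi_id_mem h hT
  rwa [fourPi_checkForm h, W.smul_mem_iff two_ne_zero] at h1

theorem ActInv.dualInv_checkTop [FiniteDimensional ℝ V] {W : Submodule ℝ (Tri V)}
    (hW : ActInv J1 J2 J3 W) : DualInv J1 J2 J3 (W.comap (checkTop J1 J2 J3)) := by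
  intro g hg hq θ hθ
  have h1 := hW.pull_mem hg hq (Submodule.mem_comap.1 hθ)
  have h2 : pull g (checkTop J1 J2 J3 θ) = checkTop J1 J2 J3 (θ.comp g) :=
    tri_ext fun X Y Z => by
      simp [checkTop_eq, checkForm_apply, ← hq.map1, ← hq.map2, ← hq.map3, hg _ _]
  exact Submodule.mem_comap.2 (h2 ▸ h1)

theorem ActInv.checkTop_of_cyclic [FiniteDimensional ℝ V] (h : IsQH J1 J2 J3)
    {W : Submodule ℝ (Tri V)} (hW : ActInv J1 J2 J3 W) (ht : W.comap (checkTop J2 J3 J1) = ⊤) :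
    W.comap (checkTop J1 J2 J3) = ⊤ := by
  refine eq_top_iff.2 fun θ _ => ?_
  have h1 : θ.comp J1 ∈ W.comap (checkTop J2 J3 J1) := ht ▸ Submodule.mem_top
  rw [Submodule.mem_comap, checkTop_eq, checkForm_cyclic] at h1
  have h2 := hW.checkTop_mem h h1
  have h3 : 0 - (θ.comp J1).comp J1 = θ := by
    ext X
    simp [h.1]
  rwa [h3] at h2

theorem ActInv.checkTop_eq_top [FiniteDimensional ℝ V] (h : IsQH J1 J2 J3) {n : ℕ}
    (e : OrthonormalBasis (Fin (4 * n)) ℝ V) {W : Submodule ℝ (Tri V)} (hW : ActInv J1 J2 J3 W)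
    (hWQ : (W : Set (Tri V)) ⊆ calVcheck0 J1 J2 J3) (hne : W ≠ ⊥) :
    W.comap (checkTop J1 J2 J3) = ⊤ := by
  have hW2 := hW.cyclic
  have hW3 := hW2.cyclic
  rcases hW.dualInv_checkTop.eq_bot_or_eq_top h e with b1 | t1
  swap
  · exact t1
  rcases hW2.dualInv_checkTop.eq_bot_or_eq_top h.cyclic e with b2 | t2
  swap
  · exact hW.checkTop_of_cyclic h t2
  rcases hW3.dualInv_checkTop.eq_bot_or_eq_top h.cyclic.cyclic e with b3 | t3
  swap
  · exact hW.checkTop_of_cyclic h (hW2.checkTop_of_cyclic h.cyclic t3)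
  refine absurd (W.eq_bot_iff.2 fun T hT => ?_) hne
  obtain ⟨π1, π2, π3, rfl, hs⟩ := calVcheck0_iff.1 (hWQ hT)
  have z1 := hW.checkTop_mem h hT
  rw [← checkForm_cyclic] at hT
  have z2 := hW2.checkTop_mem h.cyclic hT
  rw [← checkForm_cyclic] at hT
  have z3 := hW3.checkTop_mem h.cyclic.cyclic hT
  rw [← Submodule.mem_comap, b1, Submodule.mem_bot, sub_eq_zero] at z1
  rw [← Submodule.mem_comap, b2, Submodule.mem_bot, sub_eq_zero] at z2
  rw [← Submodule.mem_comap, b3, Submodule.mem_bot, sub_eq_zero] at z3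
  have y1 := fun X => LinearMap.congr_fun z1 X
  have y2 := fun X => LinearMap.congr_fun z2 X
  have y3 := fun X => LinearMap.congr_fun z3 X
  simp only [LinearMap.comp_apply] at y1 y2 y3
  obtain ⟨h11, h22, h33, h12, h21, h23, h32, h31, h13, i1, i2, i3⟩ := h
  have k3 : ∀ X, π3 (J3 X) = 0 := fun X => by
    have a1 := y1 (J2 X)
    have a2 := y3 (J1 X)
    rw [h12] at a1
    rw [h31] at a2
    linarith [hs X]
  have k3' : ∀ X, π3 X = 0 := fun X => by
    have := k3 (J3 X)
    rwa [h33, map_neg, neg_eq_zero] at this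
  refine tri_ext fun X Y Z => ?_
  simp [checkForm_apply, y3, y1, k3']

/-- `𝒬𝒦₂` as a submodule. -/
def calVcheck0Sub (J1 J2 J3 : V →ₗ[ℝ] V) : Submodule ℝ (Tri V) where
  carrier := calVcheck0 J1 J2 J3
  zero_mem' := ⟨0, 0, 0, by simp, by simp⟩
  add_mem' := by
    rintro _ _ ⟨a, b, c, h1, h2⟩ ⟨a', b', c', h1', h2'⟩
    refine ⟨a + a', b + b', c + c', fun X Y Z => ?_, fun X => ?_⟩
    · simp only [LinearMap.add_apply, h1, h1']
      ring
    · simp only [LinearMap.add_apply]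
      linarith [h2 X, h2' X]
  smul_mem' := by
    rintro r _ ⟨a, b, c, h1, h2⟩
    refine ⟨r • a, r • b, r • c, fun X Y Z => ?_, fun X => ?_⟩
    · simp only [LinearMap.smul_apply, h1, smul_eq_mul]
      ring
    · simp only [LinearMap.smul_apply, smul_eq_mul, ← mul_add, h2 X, mul_zero]

theorem irreducible_calVcheck0 (h : IsQH J1 J2 J3) {n : ℕ}
    (e : OrthonormalBasis (Fin (4 * n)) ℝ V) {W : Submodule ℝ (Tri V)}
    (hWQ : (W : Set (Tri V)) ⊆ calVcheck0 J1 J2 J3) (hW : ActInv J1 J2 J3 W) :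
    (W : Set (Tri V)) = {0} ∨ (W : Set (Tri V)) = calVcheck0 J1 J2 J3 := by
  have := finiteDimensional_of_orthonormalBasis e
  have hQ : ActInv J1 J2 J3 (calVcheck0Sub J1 J2 J3) := fun A hA S hS =>
    act_mem_QKfam h e 1 hA hS
  refine (eq_bot_or_eq_of_forall_disjoint e hQ (fun W W' hWQ hWQ' hW hW' hd => ?_) hWQ hW).imp
    (fun hb => by simp [hb]) fun hq => by rw [hq]; rfl
  by_contra! hne
  have t := hW.checkTop_eq_top h e hWQ hne.1
  have t' := hW'.checkTop_eq_top h e hWQ' hne.2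
  have hz : ∀ β, checkTop J1 J2 J3 β = 0 := fun β =>
    Submodule.disjoint_def.1 hd _ (Submodule.mem_comap.1 (t ▸ Submodule.mem_top))
      (Submodule.mem_comap.1 (t' ▸ Submodule.mem_top))
  have hX : ∀ X : V, X = 0 := fun X => by
    have h1 : checkTop J1 J2 J3 (innerₗ V X) X X (J2 X) = 0 := by rw [hz]; rfl
    have h2 : X = 0 ∨ J2 X = 0 := by simpa [checkTop_eq, checkForm_apply, h.inner_self] using h1
    refine h2.elim id fun h3 => ?_
    simpa [h3] using (h.2.1 X).symm
  exact hne.1 (W.eq_bot_iff.2 fun T _ => tri_ext fun X Y Z => by rw [hX X]; simp)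

end CheckZero

section Aligned

variable {J1 J2 J3 : V →ₗ[ℝ] V}

/-- `𝒱̂` as a submodule. -/
def calVhatSub (J1 J2 J3 : V →ₗ[ℝ] V) : Submodule ℝ (Tri V) where
  carrier := calVhat J1 J2 J3
  zero_mem' := ⟨by simp, by simp, by simp, by simp⟩
  add_mem' := calVhat_add
  smul_mem' c _ hT := calVhat_smul c hT

/-- Trilinear forms supported on the range of `P` and complex trilinear with respect to `B`. -/
def alignedSub (P B : V →ₗ[ℝ] V) : Submodule ℝ (Tri V) where
  carrier := {R | ∀ X Y Z, R (P X) Y Z = R X Y Z ∧ R X (P Y) Z = R X Y Z ∧ R X Y (P Z) = R X Y Z ∧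
    R (B X) Y Z = R X (B Y) Z ∧ R X (B Y) Z = R X Y (B Z)}
  zero_mem' := by simp
  add_mem' := fun ha hb X Y Z => by
    obtain ⟨a1, a2, a3, a4, a5⟩ := ha X Y Z
    obtain ⟨b1, b2, b3, b4, b5⟩ := hb X Y Z
    simp only [LinearMap.add_apply, a1, a2, a3, a4, a5, b1, b2, b3, b4, b5, and_self]
  smul_mem' := fun c R ha X Y Z => by
    obtain ⟨a1, a2, a3, a4, a5⟩ := ha X Y Z
    simp only [LinearMap.smul_apply, a1, a2, a3, a4, a5, and_self]

theorem fourPi_mem_alignedSub {P B : V →ₗ[ℝ] V} (h : IsRot P B) (T : Tri V) :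
    fourPi P B T ∈ alignedSub P B := by
  intro X Y Z
  simp only [fourPi_apply, h.PP, h.PB, h.BP, h.BB, map_neg, LinearMap.neg_apply, true_and]
  constructor <;> ring

theorem pull_mem_alignedSub {P B g : V →ₗ[ℝ] V} (hP : ∀ X, g (P X) = P (g X))
    (hB : ∀ X, g (B X) = B (g X)) {R : Tri V} (hR : R ∈ alignedSub P B) :
    pull g R ∈ alignedSub P B := by
  intro X Y Z
  simpa only [pull_apply, hP, hB] using hR (g X) (g Y) (g Z)

theorem ActInv.pull_J1_mem [FiniteDimensional ℝ V] (h : IsQH J1 J2 J3)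
    {W : Submodule ℝ (Tri V)} (hW : ActInv J1 J2 J3 W) {S : Tri V} (hS : S ∈ W) :
    pull J1 S ∈ W := by
  simpa using hW.pull_rot_mem h (c := 0) (s := 1) (by norm_num) hS

theorem ActInv.pull_J_mem [FiniteDimensional ℝ V] (h : IsQH J1 J2 J3)
    {W : Submodule ℝ (Tri V)} (hW : ActInv J1 J2 J3 W) {S : Tri V} (hS : S ∈ W) :
    pull J1 S ∈ W ∧ pull J2 S ∈ W ∧ pull J3 S ∈ W :=
  ⟨hW.pull_J1_mem h hS, hW.cyclic.pull_J1_mem h.cyclic hS,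
    hW.cyclic.cyclic.pull_J1_mem h.cyclic.cyclic hS⟩

theorem pull_J_apply {T : Tri V} (hT : T ∈ calVhat J1 J2 J3) (X Y Z : V) :
    pull J1 T X Y Z = T (J1 X) Y Z ∧ pull J2 T X Y Z = T (J2 X) Y Z ∧
      pull J3 T X Y Z = T (J3 X) Y Z :=
  ⟨hT.2.1 _ _ _, hT.2.2.1 _ _ _, hT.2.2.2 _ _ _⟩

theorem eq_zero_or_eq_zero_of_coordinates [FiniteDimensional ℝ V] (h : IsQH J1 J2 J3)
    {W W' M : Submodule ℝ (Tri V)} (hW : ActInv J1 J2 J3 W) (hd : Disjoint W W')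
    (hM : M ≤ calVhatSub J1 J2 J3)
    (hpull : ∀ R ∈ M, pull J1 R ∈ M ∧ pull J2 R ∈ M ∧ pull J3 R ∈ M) {z u w : V}
    (hinj : ∀ R ∈ M, R z u w = 0 → R (J1 z) u w = 0 → R (J2 z) u w = 0 → R (J3 z) u w = 0 → R = 0)
    {R R' : Tri V} (hR : R ∈ W) (hRM : R ∈ M) (hR' : R' ∈ W') (hRM' : R' ∈ M) :
    R = 0 ∨ R' = 0 := by
  refine or_iff_not_imp_left.2 fun hne => ?_
  obtain ⟨p1, p2, p3⟩ := hW.pull_J_mem h hR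
  obtain ⟨q1, q2, q3⟩ := hpull R hRM
  have hp := pull_J_apply (hM hRM)
  obtain ⟨h11, h22, h33, h12, h21, h23, h32, h31, h13, i1, i2, i3⟩ := h
  set a0 := R z u w with ha0
  set a1 := R (J1 z) u w with ha1
  set a2 := R (J2 z) u w with ha2
  set a3 := R (J3 z) u w with ha3
  set b0 := R' z u w with hb0
  set b1 := R' (J1 z) u w with hb1
  set b2 := R' (J2 z) u w with hb2
  set b3 := R' (J3 z) u w with hb3
  set N := a0 ^ 2 + a1 ^ 2 + a2 ^ 2 + a3 ^ 2 with hN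
  have hN0 : N ≠ 0 := fun h0 => hne <| hinj R hRM
    (by rw [← ha0]; nlinarith [sq_nonneg a0, sq_nonneg a1, sq_nonneg a2, sq_nonneg a3])
    (by rw [← ha1]; nlinarith [sq_nonneg a0, sq_nonneg a1, sq_nonneg a2, sq_nonneg a3])
    (by rw [← ha2]; nlinarith [sq_nonneg a0, sq_nonneg a1, sq_nonneg a2, sq_nonneg a3])
    (by rw [← ha3]; nlinarith [sq_nonneg a0, sq_nonneg a1, sq_nonneg a2, sq_nonneg a3])
  let C (W : Submodule ℝ (Tri V)) (h0 : R ∈ W) (h1 : pull J1 R ∈ W) (h2 : pull J2 R ∈ W)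
      (h3 : pull J3 R ∈ W) : (a0 * b0 + a1 * b1 + a2 * b2 + a3 * b3) • R
      + (a1 * b0 - a0 * b1 - a2 * b3 + a3 * b2) • pull J1 R
      + (a2 * b0 - a0 * b2 + a1 * b3 - a3 * b1) • pull J2 R
      + (a3 * b0 - a0 * b3 - a1 * b2 + a2 * b1) • pull J3 R ∈ W :=
    W.add_mem (W.add_mem (W.add_mem (W.smul_mem _ h0) (W.smul_mem _ h1)) (W.smul_mem _ h2))
      (W.smul_mem _ h3)
  have hc := hinj _ (M.sub_mem (C M hRM q1 q2 q3) (M.smul_mem N hRM'))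
  simp only [LinearMap.sub_apply, LinearMap.add_apply, LinearMap.smul_apply, smul_eq_mul,
    (hp _ _ _).1, (hp _ _ _).2.1, (hp _ _ _).2.2, h11, h22, h33, h12, h21, h23, h32, h31, h13,
    map_neg, LinearMap.neg_apply, ← ha0, ← ha1, ← ha2, ← ha3, ← hb0, ← hb1, ← hb2, ← hb3] at hc
  have hz := hc (by rw [hN]; ring) (by rw [hN]; ring) (by rw [hN]; ring) (by rw [hN]; ring)
  have hCW := C W hR p1 p2 p3
  rw [sub_eq_zero.1 hz] at hCW
  have := Submodule.disjoint_def.1 hd _ hCW (W'.smul_mem N hR')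
  exact (smul_eq_zero.1 this).resolve_left hN0

/-- The highest weight functional of a form in `𝒱̂`. -/
def weightForm (J1 J2 J3 : V →ₗ[ℝ] V) (T : Tri V) (z u : V) : ℝ :=
  T z u (J2 u) + T (J1 z) u (J3 u)

theorem fourPi_apply_self (h : IsQH J1 J2 J3) {P B : V →ₗ[ℝ] V} (hP : QLinear J1 J2 J3 P)
    (hB : QLinear J1 J2 J3 B) {T : Tri V} (hT : T ∈ calVhat J1 J2 J3) {z u : V} (hz : P z = z)
    (hzB : B z = J1 z) (hu : P u = u) (huB : B u = J1 u) :
    fourPi P B T z u (J2 u) = 2 * weightForm J1 J2 J3 T z u := by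
  have m1 := calVhat_move h hT
  have m2 := calVhat_move h.cyclic (calVhat_cyclic hT)
  have m3 := calVhat_move h.cyclic.cyclic (calVhat_cyclic (calVhat_cyclic hT))
  obtain ⟨h11, h22, h33, h12, h21, h23, h32, h31, h13, i1, i2, i3⟩ := h
  simp only [weightForm, fourPi_apply, hz, hzB, hu, huB, hP.map2, hB.map2, m1, m2, m3, h11, h22,
    h33, h12, h21, h23, h32, h31, h13, map_neg, LinearMap.neg_apply]
  ring

end Aligned

section Analytic

variable {J1 J2 J3 : V →ₗ[ℝ] V} {n : ℕ}

theorem analyticAt_linear [FiniteDimensional ℝ V] {E : Type*} [NormedAddCommGroup E]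
    [NormedSpace ℝ E] (f : V →ₗ[ℝ] E) {a : ℝ → V} {t : ℝ} (ha : AnalyticAt ℝ a t) :
    AnalyticAt ℝ (fun s => f (a s)) t :=
  (f.toContinuousLinearMap.analyticAt _).comp ha

theorem analyticAt_tri (e : OrthonormalBasis (Fin (4 * n)) ℝ V) (T : Tri V) {a b c : ℝ → V}
    {t : ℝ} (ha : AnalyticAt ℝ a t) (hb : AnalyticAt ℝ b t) (hc : AnalyticAt ℝ c t) :
    AnalyticAt ℝ (fun s => T (a s) (b s) (c s)) t := by
  have := finiteDimensional_of_orthonormalBasis e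
  have key : (fun s => T (a s) (b s) (c s)) = fun s => ∑ r, ∑ q,
      innerₗ V (e r) (a s) * innerₗ V (e q) (b s) * T (e r) (e q) (c s) := by
    funext s
    change (T.flip (b s)).flip (c s) (a s) = _
    rw [← sum_inner_smul_apply e ((T.flip (b s)).flip (c s)) (a s)]
    refine Finset.sum_congr rfl fun r _ => ?_
    change _ * (T (e r)).flip (c s) (b s) = _
    rw [← sum_inner_smul_apply e ((T (e r)).flip (c s)) (b s), Finset.mul_sum]
    refine Finset.sum_congr rfl fun q _ => ?_
    simp only [LinearMap.flip_apply, innerₗ_apply_apply, real_inner_comm]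
    ring
  rw [key]
  exact Finset.analyticAt_fun_sum _ fun r _ => Finset.analyticAt_fun_sum _ fun q _ =>
    ((analyticAt_linear _ ha).mul (analyticAt_linear _ hb)).mul (analyticAt_linear _ hc)

theorem forall_weightForm_eq_zero_or (e : OrthonormalBasis (Fin (4 * n)) ℝ V) {T T' : Tri V}
    {z u : ℝ → V} (hz : ∀ t, AnalyticAt ℝ z t) (hu : ∀ t, AnalyticAt ℝ u t)
    (hmul : ∀ t, weightForm J1 J2 J3 T (z t) (u t) * weightForm J1 J2 J3 T' (z t) (u t) = 0) :
    (∀ t, weightForm J1 J2 J3 T (z t) (u t) = 0) ∨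
      ∀ t, weightForm J1 J2 J3 T' (z t) (u t) = 0 := by
  have := finiteDimensional_of_orthonormalBasis e
  have han : ∀ T : Tri V, AnalyticOnNhd ℝ (fun t => weightForm J1 J2 J3 T (z t) (u t)) Set.univ :=
    fun T t _ => (analyticAt_tri e T (hz t) (hu t) (analyticAt_linear J2 (hu t))).add
      (analyticAt_tri e T (analyticAt_linear J1 (hz t)) (hu t) (analyticAt_linear J3 (hu t)))
  simpa using (han T).eq_zero_or_eq_zero_of_mul_eq_zero (han T') (fun t _ => hmul t)
    isPreconnected_univ

end Analytic

section CyclicFree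

variable {J1 J2 J3 : V →ₗ[ℝ] V} {n : ℕ}

theorem weightForm_smul (T : Tri V) (r s : ℝ) (z u : V) :
    weightForm J1 J2 J3 T (r • z) (s • u) = r * s ^ 2 * weightForm J1 J2 J3 T z u := by
  simp only [weightForm, map_smul, LinearMap.smul_apply, smul_eq_mul]
  ring

theorem inner_normalize_self {u : V} (hu : u ≠ 0) : ⟪‖u‖⁻¹ • u, ‖u‖⁻¹ • u⟫ = 1 := by
  have h0 := norm_ne_zero_iff.2 hu
  rw [real_inner_smul_left, real_inner_smul_right, real_inner_self_eq_norm_sq]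
  field_simp

/-- `𝒬𝒦₅` as a submodule. -/
def qk5Sub (J1 J2 J3 : V →ₗ[ℝ] V) : Submodule ℝ (Tri V) where
  carrier := QK5set J1 J2 J3
  zero_mem' := ⟨(calVhatSub J1 J2 J3).zero_mem, by simp⟩
  add_mem' := fun ha hb => ⟨calVhat_add ha.1 hb.1, fun X Y Z => by
    have a := ha.2 X Y Z
    have b := hb.2 X Y Z
    simp only [LinearMap.add_apply]
    linarith⟩
  smul_mem' := fun c T ha => ⟨calVhat_smul c ha.1, fun X Y Z => by
    simp only [LinearMap.smul_apply, smul_eq_mul, ← mul_add, ha.2 X Y Z, mul_zero]⟩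

theorem calVhat_qdyad_eq_zero (h : IsQH J1 J2 J3) {R : Tri V} (hR : R ∈ calVhat J1 J2 J3) {X u : V}
    (h1 : R X u (J1 u) = 0) (h2 : R X u (J2 u) = 0) (h3 : R X u (J3 u) = 0) (w w' Y Z : V) :
    R X (qdyad J1 J2 J3 w u Y) (qdyad J1 J2 J3 w' u Z) = 0 := by
  have h0 : R X u u = 0 := by linarith [hR.1 X u u]
  have m1 := calVhat_move h hR
  have m2 := calVhat_move h.cyclic (calVhat_cyclic hR)
  have m3 := calVhat_move h.cyclic.cyclic (calVhat_cyclic (calVhat_cyclic hR))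
  obtain ⟨h11, h22, h33, h12, h21, h23, h32, h31, h13, i1, i2, i3⟩ := h
  simp only [qdyad_apply, map_add, map_smul, LinearMap.add_apply, LinearMap.smul_apply, m1, m2, m3,
    h11, h22, h33, h12, h21, h23, h32, h31, h13, map_neg, h0, h1, h2, h3, neg_zero, smul_zero,
    add_zero]

theorem apply_qdyad_left_eq_zero {R : Tri V} {z Y Z : V} (h0 : R z Y Z = 0) (h1 : R (J1 z) Y Z = 0)
    (h2 : R (J2 z) Y Z = 0) (h3 : R (J3 z) Y Z = 0) (w X : V) :
    R (qdyad J1 J2 J3 w z X) Y Z = 0 := by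
  simp [qdyad_apply, h0, h1, h2, h3]

theorem qdyad_unit (h : IsQH J1 J2 J3) {u : V} (hu : ⟪u, u⟫ = 1) (w : V) :
    qdyad J1 J2 J3 u w u = w := by
  rw [qdyad_self h, hu, one_smul]

theorem eq_zero_of_aligned_line (h : IsQH J1 J2 J3) {u : V} (hu : ⟪u, u⟫ = 1) {R : Tri V}
    (hR : R ∈ calVhat J1 J2 J3)
    (hRa : R ∈ alignedSub (qdyad J1 J2 J3 u u) (qdyad J1 J2 J3 u (J1 u)))
    (h0 : R u u (J2 u) = 0) (h1 : R (J1 u) u (J2 u) = 0) (h2 : R (J2 u) u (J2 u) = 0)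
    (h3 : R (J3 u) u (J2 u) = 0) : R = 0 := by
  set P := qdyad J1 J2 J3 u u with hPdef
  set B := qdyad J1 J2 J3 u (J1 u) with hBdef
  have hB : QLinear J1 J2 J3 B := qdyad_qLinear h u (J1 u)
  have a2 : ∀ X, R X u (J2 u) = 0 := fun X => by
    rw [← (hRa X _ _).1]
    exact apply_qdyad_left_eq_zero h0 h1 h2 h3 u X
  have a1 : ∀ X, R X u (J1 u) = 0 := fun X => by
    have b1 := (hRa X u u).2.2.2.2
    rw [qdyad_unit h hu] at b1
    linarith [hR.1 X (J1 u) u]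
  have a3 : ∀ X, R X u (J3 u) = 0 := fun X => by
    have b1 := (hRa X u (J2 u)).2.2.2
    rw [a2, hB.map2, qdyad_unit h hu, h.2.2.2.2.1, map_neg] at b1
    linarith [b1.1, b1.2]
  refine tri_ext fun X Y Z => ?_
  rw [← (hRa X Y Z).2.1, ← (hRa X _ Z).2.2.1]
  exact calVhat_qdyad_eq_zero h hR (a1 X) (a2 X) (a3 X) u u Y Z

theorem calVhatSub_actInv (h : IsQH J1 J2 J3) : ActInv J1 J2 J3 (calVhatSub J1 J2 J3) := by
  intro A hA S hS
  obtain ⟨m, hm⟩ := hA.symm.isSpMap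
  exact hm.pull_mem_calVhat h hS

theorem weightForm_mul_eq_zero_of_unit [FiniteDimensional ℝ V] (h : IsQH J1 J2 J3)
    {W W' : Submodule ℝ (Tri V)} (hWQ : W ≤ calVhatSub J1 J2 J3) (hWQ' : W' ≤ calVhatSub J1 J2 J3)
    (hW : ActInv J1 J2 J3 W) (hW' : ActInv J1 J2 J3 W') (hd : Disjoint W W') {T T' : Tri V}
    (hT : T ∈ W) (hT' : T' ∈ W') {u : V} (hu : ⟪u, u⟫ = 1) :
    weightForm J1 J2 J3 T u u * weightForm J1 J2 J3 T' u u = 0 := by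
  set P := qdyad J1 J2 J3 u u with hPdef
  set B := qdyad J1 J2 J3 u (J1 u) with hBdef
  have hP : QLinear J1 J2 J3 P := qdyad_qLinear h u u
  have hB : QLinear J1 J2 J3 B := qdyad_qLinear h u (J1 u)
  have hr : IsRot P B := isRot_qdyad h hu
  have hval : ∀ T ∈ calVhat J1 J2 J3, fourPi P B T = 0 → weightForm J1 J2 J3 T u u = 0 := by
    intro T hT h0
    have h1 := fourPi_apply_self h hP hB hT (qdyad_unit h hu u) (qdyad_unit h hu _)
      (qdyad_unit h hu u) (qdyad_unit h hu _)
    rw [h0] at h1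
    simpa using h1.symm
  have hS := hW.fourPi_mem hr hP hB hT
  have hS' := hW'.fourPi_mem hr hP hB hT'
  have key := eq_zero_or_eq_zero_of_coordinates h (M := calVhatSub J1 J2 J3 ⊓ alignedSub P B)
    (z := u) (u := u) (w := J2 u) hW hd inf_le_left
    (fun R hR => ⟨⟨((calVhatSub_actInv h).pull_J_mem h hR.1).1, pull_mem_alignedSub
      (fun X => (hP.map1 X).symm) (fun X => (hB.map1 X).symm) hR.2⟩,
      ⟨((calVhatSub_actInv h).pull_J_mem h hR.1).2.1, pull_mem_alignedSub
      (fun X => (hP.map2 X).symm) (fun X => (hB.map2 X).symm) hR.2⟩,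
      ⟨((calVhatSub_actInv h).pull_J_mem h hR.1).2.2, pull_mem_alignedSub
      (fun X => (hP.map3 X).symm) (fun X => (hB.map3 X).symm) hR.2⟩⟩)
    (fun R hR => eq_zero_of_aligned_line h hu hR.1 hR.2)
    hS ⟨hWQ hS, fourPi_mem_alignedSub hr T⟩ hS' ⟨hWQ' hS', fourPi_mem_alignedSub hr T'⟩
  rcases key with k | k
  · rw [hval T (hWQ hT) k, zero_mul]
  · rw [hval T' (hWQ' hT') k, mul_zero]

theorem weightForm_mul_eq_zero [FiniteDimensional ℝ V] (h : IsQH J1 J2 J3)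
    {W W' : Submodule ℝ (Tri V)} (hWQ : W ≤ calVhatSub J1 J2 J3) (hWQ' : W' ≤ calVhatSub J1 J2 J3)
    (hW : ActInv J1 J2 J3 W) (hW' : ActInv J1 J2 J3 W') (hd : Disjoint W W') {T T' : Tri V}
    (hT : T ∈ W) (hT' : T' ∈ W') (u : V) :
    weightForm J1 J2 J3 T u u * weightForm J1 J2 J3 T' u u = 0 := by
  rcases eq_or_ne u 0 with rfl | hu
  · simp [weightForm]
  have h1 := weightForm_mul_eq_zero_of_unit h hWQ hWQ' hW hW' hd hT hT' (inner_normalize_self hu)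
  simpa [weightForm_smul, hu] using h1

theorem eq_zero_of_apply_line_eq_zero (h : IsQH J1 J2 J3) {T : Tri V} (hT : T ∈ QK5set J1 J2 J3)
    (h0 : ∀ u, T u u (J1 u) = 0) (h1 : ∀ u, T (J1 u) u (J1 u) = 0) : T = 0 := by
  have sw := calVhat_swap h hT.1
  have p0 : ∀ u w, T w u (J1 u) = -2 * T u w (J1 u) := fun u w => by
    have a := h0 (u + w)
    have b := h0 (u - w)
    simp only [map_add, map_sub, LinearMap.add_apply, LinearMap.sub_apply, sw _ u w, h0] at a b
    linarith
  have p1 : ∀ u w, T (J1 w) u (J1 u) = -2 * T (J1 u) w (J1 u) := fun u w => by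
    have a := h1 (u + w)
    have b := h1 (u - w)
    simp only [map_add, map_sub, LinearMap.add_apply, LinearMap.sub_apply, sw _ u w, h1] at a b
    linarith
  have A : ∀ u w, T w u (J1 u) = 0 := fun u w => by
    have a := p0 u w
    have b := p1 u (J1 w)
    rw [h.1, map_neg, LinearMap.neg_apply, LinearMap.neg_apply, hT.1.2.1] at b
    have c := hT.2 w u (J1 u)
    linarith [hT.1.1 u (J1 u) w]
  refine tri_ext fun X Y Z => ?_
  have a := A (Y + J1 Z) X
  simp only [map_add, LinearMap.add_apply, A, sw _ Y (J1 Z)] at a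
  have b := sw X (J1 Z) Y
  rw [h.1, map_neg] at b
  simp only [LinearMap.zero_apply]
  linarith

theorem eq_zero_of_weightForm_eq_zero (h : IsQH J1 J2 J3) {T : Tri V} (hT : T ∈ QK5set J1 J2 J3)
    (h0 : ∀ u, weightForm J1 J2 J3 T u u = 0) (h1 : ∀ u, weightForm J1 J2 J3 (pull J1 T) u u = 0)
    (h2 : ∀ u, weightForm J1 J2 J3 (pull J2 T) u u = 0)
    (h3 : ∀ u, weightForm J1 J2 J3 (pull J3 T) u u = 0) : T = 0 := by
  have m1 := calVhat_move h hT.1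
  have m2 := calVhat_move h.cyclic (calVhat_cyclic hT.1)
  have m3 := calVhat_move h.cyclic.cyclic (calVhat_cyclic (calVhat_cyclic hT.1))
  have s0 : ∀ X Y, T X Y Y = 0 := fun X Y => by linarith [hT.1.1 X Y Y]
  have hp := pull_J_apply hT.1
  simp only [weightForm, (hp _ _ _).1, (hp _ _ _).2.1, (hp _ _ _).2.2] at h0 h1 h2 h3
  have hh := h
  obtain ⟨h11, h22, h33, h12, h21, h23, h32, h31, h13, i1, i2, i3⟩ := h
  refine eq_zero_of_apply_line_eq_zero hh hT (fun u => ?_) fun u => ?_ <;>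
  · have a0 := h0 (u + J3 u)
    have a1 := h1 (u + J3 u)
    have a2 := h2 (u + J3 u)
    have a3 := h3 (u + J3 u)
    have b0 := h0 u
    have b1 := h1 u
    have b2 := h2 u
    have b3 := h3 u
    have c1 := hT.2 u (J2 u) (J3 u)
    have c2 := hT.2 (J1 u) (J2 u) (J3 u)
    have c3 := hT.2 u (J1 u) (J2 u)
    have c4 := hT.2 u (J1 u) (J3 u)
    simp only [map_add, LinearMap.add_apply, m1, m2, m3, h11, h22, h33, h12, h21, h23, h32, h31,
      h13, map_neg, LinearMap.neg_apply, s0] at a0 a1 a2 a3 b0 b1 b2 b3 c1 c2 c3 c4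
    linarith

theorem exists_weightForm_ne_zero [FiniteDimensional ℝ V] (h : IsQH J1 J2 J3)
    {W : Submodule ℝ (Tri V)} (hWQ : W ≤ qk5Sub J1 J2 J3) (hW : ActInv J1 J2 J3 W) (hne : W ≠ ⊥) :
    ∃ T ∈ W, ∃ u, weightForm J1 J2 J3 T u u ≠ 0 := by
  by_contra! hc
  refine hne (W.eq_bot_iff.2 fun T hT => ?_)
  obtain ⟨p1, p2, p3⟩ := hW.pull_J_mem h hT
  exact eq_zero_of_weightForm_eq_zero h (hWQ hT) (hc T hT) (hc _ p1) (hc _ p2) (hc _ p3)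

theorem analyticAt_segment (a b : V) (t : ℝ) : AnalyticAt ℝ (fun s : ℝ => a + s • (b - a)) t := by
  fun_prop

theorem irreducible_QK5set (h : IsQH J1 J2 J3) (e : OrthonormalBasis (Fin (4 * n)) ℝ V)
    {W : Submodule ℝ (Tri V)} (hWQ : (W : Set (Tri V)) ⊆ QK5set J1 J2 J3)
    (hW : ActInv J1 J2 J3 W) :
    (W : Set (Tri V)) = {0} ∨ (W : Set (Tri V)) = QK5set J1 J2 J3 := by
  have := finiteDimensional_of_orthonormalBasis e
  have hQ : ActInv J1 J2 J3 (qk5Sub J1 J2 J3) := fun A hA S hS => act_mem_QKfam h e 4 hA hS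
  refine (eq_bot_or_eq_of_forall_disjoint e hQ (fun W W' hWQ hWQ' hW hW' hd => ?_) hWQ hW).imp
    (fun hb => by simp [hb]) fun hq => by rw [hq]; rfl
  by_contra! hne
  obtain ⟨T, hT, u, hu⟩ := exists_weightForm_ne_zero h hWQ hW hne.1
  obtain ⟨T', hT', u', hu'⟩ := exists_weightForm_ne_zero h hWQ' hW' hne.2
  rcases forall_weightForm_eq_zero_or e (analyticAt_segment u u') (analyticAt_segment u u')
    (fun t => weightForm_mul_eq_zero h (fun S hS => (hWQ hS).1) (fun S hS => (hWQ' hS).1) hW hW' hd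
      hT hT' _) with k | k
  · exact hu (by simpa using k 0)
  · exact hu' (by simpa using k 1)

end CyclicFree

section QuaternionicOrthogonality

variable {J1 J2 J3 : V →ₗ[ℝ] V} {n : ℕ}

/-- Orthogonality of the quaternionic lines spanned by `u` and `v`. -/
structure QOrth (J1 J2 J3 : V →ₗ[ℝ] V) (u v : V) : Prop where
  inner0 : ⟪u, v⟫ = 0
  inner1 : ⟪J1 u, v⟫ = 0
  inner2 : ⟪J2 u, v⟫ = 0
  inner3 : ⟪J3 u, v⟫ = 0

theorem QOrth.cyclic {u v : V} (huv : QOrth J1 J2 J3 u v) : QOrth J2 J3 J1 u v :=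
  ⟨huv.inner0, huv.inner2, huv.inner3, huv.inner1⟩

theorem QOrth.symm (h : IsQH J1 J2 J3) {u v : V} (huv : QOrth J1 J2 J3 u v) :
    QOrth J1 J2 J3 v u := by
  refine ⟨?_, ?_, ?_, ?_⟩
  · rw [real_inner_comm, huv.inner0]
  · rw [h.inner_left, real_inner_comm, huv.inner1, neg_zero]
  · rw [h.cyclic.inner_left, real_inner_comm, huv.inner2, neg_zero]
  · rw [h.cyclic.cyclic.inner_left, real_inner_comm, huv.inner3, neg_zero]

theorem QOrth.J1_left (h : IsQH J1 J2 J3) {u v : V} (huv : QOrth J1 J2 J3 u v) :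
    QOrth J1 J2 J3 (J1 u) v := by
  refine ⟨huv.inner1, ?_, ?_, ?_⟩
  · rw [h.1, inner_neg_left, huv.inner0, neg_zero]
  · rw [h.2.2.2.2.1, inner_neg_left, huv.inner3, neg_zero]
  · rw [h.2.2.2.2.2.2.2.1, huv.inner2]

theorem QOrth.J2_left (h : IsQH J1 J2 J3) {u v : V} (huv : QOrth J1 J2 J3 u v) :
    QOrth J1 J2 J3 (J2 u) v :=
  (huv.cyclic.J1_left h.cyclic).cyclic.cyclic

theorem QOrth.J3_left (h : IsQH J1 J2 J3) {u v : V} (huv : QOrth J1 J2 J3 u v) :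
    QOrth J1 J2 J3 (J3 u) v :=
  (huv.cyclic.cyclic.J1_left h.cyclic.cyclic).cyclic

theorem QOrth.smul_right {u v : V} (huv : QOrth J1 J2 J3 u v) (c : ℝ) :
    QOrth J1 J2 J3 u (c • v) := by
  constructor <;> simp [inner_smul_right, huv.inner0, huv.inner1, huv.inner2, huv.inner3]

theorem QOrth.add_right {u v w : V} (huv : QOrth J1 J2 J3 u v) (huw : QOrth J1 J2 J3 u w) :
    QOrth J1 J2 J3 u (v + w) := by
  constructor <;> simp [inner_add_right, huv.inner0, huv.inner1, huv.inner2, huv.inner3,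
    huw.inner0, huw.inner1, huw.inner2, huw.inner3]

theorem QOrth.smul_left {u v : V} (huv : QOrth J1 J2 J3 u v) (c : ℝ) :
    QOrth J1 J2 J3 (c • u) v := by
  constructor <;> simp [inner_smul_left, huv.inner0, huv.inner1, huv.inner2, huv.inner3]

theorem QOrth.add_left {u v w : V} (huw : QOrth J1 J2 J3 u w) (hvw : QOrth J1 J2 J3 v w) :
    QOrth J1 J2 J3 (u + v) w := by
  constructor <;> simp [inner_add_left, huw.inner0, huw.inner1, huw.inner2, huw.inner3,
    hvw.inner0, hvw.inner1, hvw.inner2, hvw.inner3]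

theorem QOrth.add_sub (h : IsQH J1 J2 J3) {u v : V} (huv : QOrth J1 J2 J3 u v)
    (hn : ⟪u, u⟫ = ⟪v, v⟫) : QOrth J1 J2 J3 (u + v) (u - v) := by
  have hvu := huv.symm h
  have i1 : ∀ X, ⟪J1 X, X⟫ = 0 := fun X => by rw [real_inner_comm, h.inner_self]
  have i2 : ∀ X, ⟪J2 X, X⟫ = 0 := fun X => by rw [real_inner_comm, h.cyclic.inner_self]
  have i3 : ∀ X, ⟪J3 X, X⟫ = 0 := fun X => by rw [real_inner_comm, h.cyclic.cyclic.inner_self]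
  constructor <;> simp only [map_add, inner_add_left, inner_sub_right, huv.inner0, huv.inner1,
    huv.inner2, huv.inner3, hvu.inner0, hvu.inner1, hvu.inner2, hvu.inner3, i1, i2, i3, hn] <;> ring

theorem QOrth.qdyad_eq_zero {u v : V} (huv : QOrth J1 J2 J3 u v) (w : V) :
    qdyad J1 J2 J3 u w v = 0 := by
  simp [qdyad_apply, huv.inner0, huv.inner1, huv.inner2, huv.inner3]

theorem qOrth_smul_sub_qdyad (h : IsQH J1 J2 J3) (u y : V) :
    QOrth J1 J2 J3 u (⟪u, u⟫ • y - qdyad J1 J2 J3 u u y) := by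
  have key : ∀ w, ⟪w, qdyad J1 J2 J3 u u y⟫ = ⟪qdyad J1 J2 J3 u u w, y⟫ :=
    fun w => (qdyad_adjoint u u w y).symm
  have hQ := qdyad_qLinear h u u
  constructor <;> simp only [inner_sub_right, key, hQ.map1, hQ.map2, hQ.map3, qdyad_self h,
    map_smul, inner_smul_left, inner_smul_right] <;> simp

theorem qOrth_qdyad_left (h : IsQH J1 J2 J3) {u v : V} (huv : QOrth J1 J2 J3 u v) (y : V) :
    QOrth J1 J2 J3 (qdyad J1 J2 J3 u u y) v := by
  rw [qdyad_apply]
  exact (((huv.smul_left _).add_left ((huv.J1_left h).smul_left _)).add_left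
    ((huv.J2_left h).smul_left _)).add_left ((huv.J3_left h).smul_left _)

theorem exists_unit_qOrth (h : IsQH J1 J2 J3) (hn : 2 ≤ n)
    (e : OrthonormalBasis (Fin (4 * n)) ℝ V) {Z : V} (hZ : ⟪Z, Z⟫ = 1) :
    ∃ X, ⟪X, X⟫ = 1 ∧ QOrth J1 J2 J3 Z X := by
  by_contra! hc
  have key : ∀ y, qdyad J1 J2 J3 Z Z y = y := fun y => by
    have ho := qOrth_smul_sub_qdyad h Z y
    by_contra hne
    rw [hZ, one_smul] at ho
    exact hc _ (inner_normalize_self (sub_ne_zero.2 (Ne.symm hne))) (ho.smul_right _)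
  have hs : ∀ w : V, ∑ r, ⟪w, e r⟫ * ⟪w, e r⟫ = ⟪w, w⟫ := fun w => by
    simpa using sum_inner_smul_apply e (innerₗ V w) w
  have h1 : ∑ r, ⟪qdyad J1 J2 J3 Z Z (e r), e r⟫ = 4 := by
    simp only [qdyad_apply, inner_add_left, real_inner_smul_left, Finset.sum_add_distrib, hs]
    rw [h.preservesInner, h.cyclic.preservesInner, h.cyclic.cyclic.preservesInner, hZ]
    norm_num
  simp only [key, real_inner_self_eq_norm_sq, e.norm_eq_one, one_pow, Finset.sum_const,
    Finset.card_univ, Fintype.card_fin, nsmul_eq_mul, mul_one] at h1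
  have : 4 * n = 4 := by exact_mod_cast h1
  omega

end QuaternionicOrthogonality

section TraceFree

variable {J1 J2 J3 : V →ₗ[ℝ] V} {n : ℕ}

theorem QK4set_law {e : OrthonormalBasis (Fin (4 * n)) ℝ V} {T : Tri V}
    (hT : T ∈ QK4set J1 J2 J3 e) (X Y Z : V) :
    2 * T X Y Z = T Y Z X + T Z X Y + (T (J1 Y) (J1 Z) X + T (J1 Z) X (J1 Y))
      + (T (J2 Y) (J2 Z) X + T (J2 Z) X (J2 Y)) + (T (J3 Y) (J3 Z) X + T (J3 Z) X (J3 Y)) := by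
  have := hT.2.1 X Y Z
  rw [hT.1.2.1 X Y Z, hT.1.2.2.1 X Y Z, hT.1.2.2.2 X Y Z] at this
  linarith

theorem QK4set_cyclic {e : OrthonormalBasis (Fin (4 * n)) ℝ V} {T : Tri V}
    (hT : T ∈ QK4set J1 J2 J3 e) : T ∈ QK4set J2 J3 J1 e :=
  ⟨calVhat_cyclic hT.1, fun X Y Z => (hT.2.1 X Y Z).trans (by ring), hT.2.2⟩

/-- The form vanishes whenever the first argument is quaternionically orthogonal to the others. -/
def VanishesOrth (J1 J2 J3 : V →ₗ[ℝ] V) (T : Tri V) : Prop :=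
  ∀ X Y Z, QOrth J1 J2 J3 X Y → QOrth J1 J2 J3 X Z → T X Y Z = 0

theorem VanishesOrth.cyclic {T : Tri V} (hv : VanishesOrth J1 J2 J3 T) :
    VanishesOrth J2 J3 J1 T :=
  fun X Y Z hY hZ => hv X Y Z hY.cyclic.cyclic hZ.cyclic.cyclic

theorem vanishesOrth_of_weightForm (h : IsQH J1 J2 J3) {T : Tri V} (hT : T ∈ calVhat J1 J2 J3)
    (hw : ∀ v u, QOrth J1 J2 J3 v u → weightForm J1 J2 J3 T v u = 0) : VanishesOrth J1 J2 J3 T := by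
  have hA : ∀ v u, QOrth J1 J2 J3 v u → T v u (J1 u) = 0 := by
    intro v u hvu
    have hu := (((hvu.symm h).J3_left h).symm h)
    have a := hw v (u + J3 u) (hvu.add_right hu)
    have b := hw v (u + (-1 : ℝ) • J3 u) (hvu.add_right (hu.smul_right _))
    have s0 : ∀ X Y, T X Y Y = 0 := fun X Y => by linarith [hT.1 X Y Y]
    have m1 := calVhat_move h hT
    have m2 := calVhat_move h.cyclic (calVhat_cyclic hT)
    have m3 := calVhat_move h.cyclic.cyclic (calVhat_cyclic (calVhat_cyclic hT))
    obtain ⟨h11, h22, h33, h12, h21, h23, h32, h31, h13, i1, i2, i3⟩ := h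
    simp only [weightForm, neg_smul, one_smul, map_add, LinearMap.add_apply, m1, m2, m3, h11, h22,
      h33, h12, h21, h23, h32, h31, h13, map_neg, LinearMap.neg_apply, s0] at a b
    linarith
  intro X Y Z hY hZ
  have hJ := ((hZ.symm h).J1_left h).symm h
  have a := hA X _ (hY.add_right hJ)
  have sw := calVhat_swap h hT
  simp only [map_add, LinearMap.add_apply, hA X Y hY, hA X _ hJ, sw _ Y (J1 Z)] at a
  have b := sw X (J1 Z) Y
  rw [h.1, map_neg] at b
  linarith

/-- Subsets stable under the quaternionic structure. -/
def QClosed (J1 J2 J3 : V →ₗ[ℝ] V) (A : Set V) : Prop :=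
  ∀ X ∈ A, J1 X ∈ A ∧ J2 X ∈ A ∧ J3 X ∈ A

theorem QClosed.cyclic {A : Set V} (hA : QClosed J1 J2 J3 A) : QClosed J2 J3 J1 A :=
  fun X hX => ⟨(hA X hX).2.1, (hA X hX).2.2, (hA X hX).1⟩

theorem QK4set_apply_J1_J1 (h : IsQH J1 J2 J3) {e : OrthonormalBasis (Fin (4 * n)) ℝ V}
    {T : Tri V} (hT : T ∈ QK4set J1 J2 J3 e) {A C : Set V} (hA : QClosed J1 J2 J3 A)
    (hC : QClosed J1 J2 J3 C) (hv : ∀ z ∈ C, ∀ x ∈ A, ∀ y ∈ A, T z x y = 0) {X Z : V}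
    (hX : X ∈ A) (hZ : Z ∈ C) : T (J1 X) (J1 X) Z = T X X Z := by
  have key : ∀ X ∈ A,
      3 * T X X Z = T (J1 X) (J1 X) Z + T (J2 X) (J2 X) Z + T (J3 X) (J3 X) Z := by
    intro X hX
    have a0 := hv Z hZ X hX X hX
    have a1 := hv _ (hC Z hZ).1 X hX _ (hA X hX).1
    have a2 := hv _ (hC Z hZ).2.1 X hX _ (hA X hX).2.1
    have a3 := hv _ (hC Z hZ).2.2 X hX _ (hA X hX).2.2
    have l := QK4set_law hT X X Z
    have m1 := calVhat_move h hT.1 (J1 X) Z X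
    have m2 := calVhat_move h.cyclic (calVhat_cyclic hT.1) (J2 X) Z X
    have m3 := calVhat_move h.cyclic.cyclic (calVhat_cyclic (calVhat_cyclic hT.1)) (J3 X) Z X
    have s := hT.1.1
    linarith [s X Z X, s (J1 X) Z (J1 X), s (J2 X) Z (J2 X), s (J3 X) Z (J3 X)]
  have k0 := key X hX
  have k1 := key (J1 X) (hA X hX).1
  obtain ⟨h11, h22, h33, h12, h21, h23, h32, h31, h13, i1, i2, i3⟩ := h
  simp only [h11, h21, h31, map_neg, LinearMap.neg_apply, neg_neg] at k1
  linarith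

theorem VanishesOrth.apply_J1_J1 (h : IsQH J1 J2 J3) {e : OrthonormalBasis (Fin (4 * n)) ℝ V}
    {T : Tri V} (hT : T ∈ QK4set J1 J2 J3 e) (hv : VanishesOrth J1 J2 J3 T) {X Z : V}
    (hX : QOrth J1 J2 J3 X Z) : T (J1 X) (J1 X) Z = T X X Z :=
  QK4set_apply_J1_J1 h hT (A := {Y | QOrth J1 J2 J3 Y Z})
    (C := {W | ∀ Y, QOrth J1 J2 J3 Y Z → QOrth J1 J2 J3 W Y})
    (fun _ hY => ⟨hY.J1_left h, hY.J2_left h, hY.J3_left h⟩)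
    (fun _ hW => ⟨fun Y hY => (hW Y hY).J1_left h, fun Y hY => (hW Y hY).J2_left h,
      fun Y hY => (hW Y hY).J3_left h⟩)
    (fun z hz x hx y hy => hv z x y (hz x hx) (hz y hy)) hX (fun _ hY => hY.symm h)

theorem VanishesOrth.apply_J1_add (h : IsQH J1 J2 J3) {e : OrthonormalBasis (Fin (4 * n)) ℝ V}
    {T : Tri V} (hT : T ∈ QK4set J1 J2 J3 e) (hv : VanishesOrth J1 J2 J3 T) {X Z : V}
    (hX : QOrth J1 J2 J3 X Z) : T X (J1 X) Z + T (J1 X) X Z = 0 := by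
  have k := hv.apply_J1_J1 h hT (hX.add_left (hX.J1_left h))
  have k0 := hv.apply_J1_J1 h hT hX
  simp only [map_add, LinearMap.add_apply, h.1, map_neg, LinearMap.neg_apply] at k
  linarith

theorem VanishesOrth.apply_self_eq_mul (h : IsQH J1 J2 J3) {T : Tri V}
    (hv : VanishesOrth J1 J2 J3 T) {X Y Z : V} (hX : QOrth J1 J2 J3 X Z) (hY : QOrth J1 J2 J3 Y Z)
    (hXY : QOrth J1 J2 J3 X Y) : ⟪Y, Y⟫ * T X X Z = ⟪X, X⟫ * T Y Y Z := by
  have key : ∀ X Y, QOrth J1 J2 J3 X Z → QOrth J1 J2 J3 Y Z → QOrth J1 J2 J3 X Y →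
      ⟪X, X⟫ = ⟪Y, Y⟫ → T X X Z = T Y Y Z := by
    intro X Y hX hY hXY hn
    have a := hv _ _ Z (hXY.add_sub h hn) (hX.add_left hY)
    simp only [map_add, map_sub, LinearMap.add_apply, LinearMap.sub_apply, hv X Y Z hXY hX,
      hv Y X Z (hXY.symm h) hY] at a
    linarith
  have a := key (‖Y‖ • X) (‖X‖ • Y) (hX.smul_left _) (hY.smul_left _)
    ((hXY.smul_left _).smul_right _) (by
      simp only [real_inner_self_eq_norm_sq, norm_smul, norm_norm]; ring)
  simp only [map_smul, LinearMap.smul_apply, smul_eq_mul] at a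
  rw [real_inner_self_eq_norm_sq, real_inner_self_eq_norm_sq]
  linarith

theorem VanishesOrth.apply_self_eq_inner_mul (h : IsQH J1 J2 J3)
    {e : OrthonormalBasis (Fin (4 * n)) ℝ V} {T : Tri V} (hT : T ∈ QK4set J1 J2 J3 e)
    (hv : VanishesOrth J1 J2 J3 T) {X Y Z : V} (hX1 : ⟪X, X⟫ = 1) (hX : QOrth J1 J2 J3 X Z)
    (hY : QOrth J1 J2 J3 Y Z) : T Y Y Z = ⟪Y, Y⟫ * T X X Z := by
  have ho := qOrth_smul_sub_qdyad h X Y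
  have hKZ := qOrth_qdyad_left h hX Y
  rw [hX1, one_smul] at ho
  set K := qdyad J1 J2 J3 X X Y with hK
  have hKo : QOrth J1 J2 J3 K (Y - K) := qOrth_qdyad_left h ho Y
  have hYK : QOrth J1 J2 J3 (Y - K) Z := by
    rw [sub_eq_add_neg, ← neg_one_smul ℝ K]
    exact hY.add_left (hKZ.smul_left _)
  have a := hv.apply_self_eq_mul h hX hYK ho
  rw [hX1, one_mul] at a
  have b : T K K Z = ⟪K, K⟫ * T X X Z := by
    have hT' := QK4set_cyclic hT
    have hT'' := QK4set_cyclic hT'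
    have j1 := hv.apply_J1_J1 h hT hX
    have j2 := hv.cyclic.apply_J1_J1 h.cyclic hT' hX.cyclic
    have j3 := hv.cyclic.cyclic.apply_J1_J1 h.cyclic.cyclic hT'' hX.cyclic.cyclic
    have l1 := hv.apply_J1_add h hT hX
    have l2 := hv.cyclic.apply_J1_add h.cyclic hT' hX.cyclic
    have l3 := hv.cyclic.cyclic.apply_J1_add h.cyclic.cyclic hT'' hX.cyclic.cyclic
    have l12 := hv.cyclic.cyclic.apply_J1_add h.cyclic.cyclic hT'' (hX.J1_left h).cyclic.cyclic
    have l23 := hv.apply_J1_add h hT (hX.J2_left h)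
    have l31 := hv.cyclic.apply_J1_add h.cyclic hT' (hX.J3_left h).cyclic
    have hKK : ⟪K, K⟫ = ⟪K, Y⟫ := by
      rw [hK, ← qdyad_adjoint, (isRot_qdyad h hX1).PP]
    obtain ⟨h11, h22, h33, h12, h21, h23, h32, h31, h13, i1, i2, i3⟩ := h
    rw [h31] at l12
    rw [h12] at l23
    rw [h23] at l31
    rw [hKK, hK]
    simp only [qdyad_apply, inner_add_left, real_inner_smul_left, map_add, map_smul,
      LinearMap.add_apply, LinearMap.smul_apply, smul_eq_mul, j1, j2, j3]
    linear_combination ⟪X, Y⟫ * ⟪J1 X, Y⟫ * l1 + ⟪X, Y⟫ * ⟪J2 X, Y⟫ * l2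
      + ⟪X, Y⟫ * ⟪J3 X, Y⟫ * l3 + ⟪J1 X, Y⟫ * ⟪J2 X, Y⟫ * l12 + ⟪J2 X, Y⟫ * ⟪J3 X, Y⟫ * l23
      + ⟪J3 X, Y⟫ * ⟪J1 X, Y⟫ * l31
  have c1 := hv _ _ Z hKo hKZ
  have c2 := hv _ _ Z (hKo.symm h) hYK
  have d : ⟪Y, Y⟫ = ⟪K, K⟫ + ⟪Y - K, Y - K⟫ := by
    have := hKo.inner0
    simp only [inner_sub_left, inner_sub_right] at this ⊢
    linarith [real_inner_comm Y K]
  simp only [map_sub, LinearMap.sub_apply] at a c1 c2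
  rw [d]
  simp only [inner_sub_left, inner_sub_right] at a ⊢
  linarith

theorem VanishesOrth.apply_line (h : IsQH J1 J2 J3) {T : Tri V} (hT : T ∈ calVhat J1 J2 J3)
    (hv : VanishesOrth J1 J2 J3 T) {X Z : V} (hX : QOrth J1 J2 J3 X Z) (hn : ⟪X, X⟫ = ⟪Z, Z⟫) :
    T Z Z (J1 Z) = 2 * T X X (J1 Z) ∧ T (J1 Z) Z (J1 Z) = 2 * T (J1 X) X (J1 Z) ∧
      T (J2 Z) Z (J1 Z) = 2 * T (J2 X) X (J1 Z) ∧ T (J3 Z) Z (J1 Z) = 2 * T (J3 X) X (J1 Z) := by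
  have sw := calVhat_swap h hT
  have hZ := hX.symm h
  have key : ∀ q : V →ₗ[ℝ] V, (∀ {u v}, QOrth J1 J2 J3 u v → QOrth J1 J2 J3 (q u) v) →
      T (q Z) Z (J1 Z) = 2 * T (q X) X (J1 Z) := by
    intro q hq
    have right : ∀ {u v}, QOrth J1 J2 J3 u v → QOrth J1 J2 J3 u (J1 v) :=
      fun huv => ((huv.symm h).J1_left h).symm h
    have o1 := hX.add_sub h hn
    have o2 := (hX.smul_left (-1)).add_sub h (by simpa using hn)
    have a := hv _ _ _ (hq o1) (right (hq o1))
    have b := hv _ _ _ (hq o2) (right (hq o2))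
    have c1 := hv _ _ _ (hq hX) (right (hq hX))
    have c2 := hv _ _ _ (hq hZ) (right (hq hZ))
    simp only [neg_smul, one_smul, map_add, map_sub, map_neg, LinearMap.add_apply,
      LinearMap.sub_apply, LinearMap.neg_apply, c1, c2, sw _ Z X] at a b
    linarith
  exact ⟨key LinearMap.id id, key J1 (QOrth.J1_left h), key J2 (QOrth.J2_left h),
    key J3 (QOrth.J3_left h)⟩

theorem VanishesOrth.apply_self_of_unit (h : IsQH J1 J2 J3)
    {e : OrthonormalBasis (Fin (4 * n)) ℝ V} {T : Tri V} (hT : T ∈ QK4set J1 J2 J3 e)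
    (hv : VanishesOrth J1 J2 J3 T) {X Z : V} (hX1 : ⟪X, X⟫ = 1) (hZ1 : ⟪Z, Z⟫ = 1)
    (hX : QOrth J1 J2 J3 X Z) : T X X Z = 0 := by
  have hT' := QK4set_cyclic hT
  have hT'' := QK4set_cyclic hT'
  have hn := hX1.trans hZ1.symm
  have r0 : T Z Z Z = 0 := by linarith [hT.1.1 Z Z Z]
  have r : ∀ {I1 I2 I3 : V →ₗ[ℝ] V}, IsQH I1 I2 I3 → T ∈ QK4set I1 I2 I3 e →
      VanishesOrth I1 I2 I3 T → QOrth I1 I2 I3 X Z → T (I1 Z) (I1 Z) Z = 2 * T X X Z := by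
    intro I1 I2 I3 h hT hv hX
    have a := (hv.apply_line h hT.1 hX hn).2.1
    have m := calVhat_move h hT.1
    rw [← hv.apply_J1_J1 h hT hX, m, m, a]
    ring
  have r1 := r h hT hv hX
  have r2 := r h.cyclic hT' hv.cyclic hX.cyclic
  have r3 := r h.cyclic.cyclic hT'' hv.cyclic.cyclic hX.cyclic.cyclic
  set P := qdyad J1 J2 J3 Z Z with hP
  have hterm : ∀ y, T y y Z = T (P y) y Z + ⟪y - P y, y - P y⟫ * T X X Z := by
    intro y
    have ho := qOrth_smul_sub_qdyad h Z y
    rw [hZ1, one_smul] at ho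
    have ho' := ho.symm h
    rw [← hv.apply_self_eq_inner_mul h hT hX1 hX ho']
    have := hv _ _ Z ((qOrth_qdyad_left h ho y).symm h) ho'
    simp only [map_sub, LinearMap.sub_apply] at this ⊢
    linarith
  have hsum : ∑ r, T (P (e r)) (e r) Z = 6 * T X X Z := by
    have hs : ∀ w, ∑ r, ⟪w, e r⟫ * T w (e r) Z = T w w Z :=
      fun w => sum_inner_smul_apply e ((T w).flip Z) w
    simp only [hP, qdyad_apply, map_add, map_smul, LinearMap.add_apply, LinearMap.smul_apply,
      smul_eq_mul, Finset.sum_add_distrib, hs, r0, r1, r2, r3]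
    ring
  have htr : ∑ r, T (e r) (e r) Z = 0 := hT.2.2 Z
  rw [Finset.sum_congr rfl fun r _ => hterm (e r), Finset.sum_add_distrib, hsum, ← Finset.sum_mul,
    ← add_mul] at htr
  have hpos : 0 ≤ ∑ r, ⟪e r - P (e r), e r - P (e r)⟫ :=
    Finset.sum_nonneg fun r _ => real_inner_self_nonneg
  exact (mul_eq_zero.1 htr).resolve_left (by positivity)

theorem VanishesOrth.apply_self (h : IsQH J1 J2 J3)
    {e : OrthonormalBasis (Fin (4 * n)) ℝ V} {T : Tri V} (hT : T ∈ QK4set J1 J2 J3 e)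
    (hv : VanishesOrth J1 J2 J3 T) {X Z : V} (hX : QOrth J1 J2 J3 X Z) : T X X Z = 0 := by
  rcases eq_or_ne X 0 with rfl | hX0
  · simp
  rcases eq_or_ne Z 0 with rfl | hZ0
  · simp
  have := hv.apply_self_of_unit h hT (inner_normalize_self hX0) (inner_normalize_self hZ0)
    ((hX.smul_left _).smul_right _)
  simpa [hX0, hZ0] using this

theorem VanishesOrth.apply_self_J1_of_qOrth (h : IsQH J1 J2 J3)
    {e : OrthonormalBasis (Fin (4 * n)) ℝ V}
    {T : Tri V} (hT : T ∈ QK4set J1 J2 J3 e) (hv : VanishesOrth J1 J2 J3 T) {X Z : V}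
    (hX : QOrth J1 J2 J3 X Z) : T X (J1 X) Z = 0 := by
  rw [calVhat_move h hT.1, hv.apply_self h hT (((hX.symm h).J1_left h).symm h), neg_zero]

theorem VanishesOrth.apply_self_J1 (h : IsQH J1 J2 J3) (hn : 2 ≤ n)
    {e : OrthonormalBasis (Fin (4 * n)) ℝ V} {T : Tri V} (hT : T ∈ QK4set J1 J2 J3 e)
    (hv : VanishesOrth J1 J2 J3 T) (Z : V) : T Z Z (J1 Z) = 0 := by
  rcases eq_or_ne Z 0 with rfl | hZ0
  · simp
  have hu := inner_normalize_self hZ0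
  obtain ⟨X, hX1, hX⟩ := exists_unit_qOrth h hn e hu
  have hX' := hX.symm h
  have a := (hv.apply_line h hT.1 hX' (hX1.trans hu.symm)).1
  rw [hv.apply_self h hT ((hX.J1_left h).symm h)] at a
  simpa [hZ0] using a

theorem VanishesOrth.eq_zero (h : IsQH J1 J2 J3) (hn : 2 ≤ n)
    {e : OrthonormalBasis (Fin (4 * n)) ℝ V} {T : Tri V} (hT : T ∈ QK4set J1 J2 J3 e)
    (hv : VanishesOrth J1 J2 J3 T) : T = 0 := by
  refine tri_ext fun X Y Z => ?_
  rcases eq_or_ne X 0 with rfl | hX0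
  · simp
  have hT' := QK4set_cyclic hT
  have hT'' := QK4set_cyclic hT'
  have line := calVhat_qdyad_eq_zero h hT.1 (hv.apply_self_J1 h hn hT X)
    (hv.cyclic.apply_self_J1 h.cyclic hn hT' X)
    (hv.cyclic.cyclic.apply_self_J1 h.cyclic.cyclic hn hT'' X) X X Y Z
  have mixed : ∀ Y Z, QOrth J1 J2 J3 X Z → T X (qdyad J1 J2 J3 X X Y) Z = 0 := by
    intro Y Z hX
    simp only [qdyad_apply, map_add, map_smul, LinearMap.add_apply, LinearMap.smul_apply,
      hv.apply_self h hT hX, hv.apply_self_J1_of_qOrth h hT hX,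
      hv.cyclic.apply_self_J1_of_qOrth h.cyclic hT' hX.cyclic,
      hv.cyclic.cyclic.apply_self_J1_of_qOrth h.cyclic.cyclic hT'' hX.cyclic.cyclic,
      smul_zero, add_zero]
  have oY := qOrth_smul_sub_qdyad h X Y
  have oZ := qOrth_smul_sub_qdyad h X Z
  have a := mixed Y _ oZ
  have b := mixed Z _ oY
  have c := hv _ _ _ oY oZ
  rw [hT.1.1] at b
  simp only [map_sub, map_smul, LinearMap.sub_apply, LinearMap.smul_apply, smul_eq_mul,
    line] at a b c
  have d : (⟪X, X⟫ * ⟪X, X⟫) * T X Y Z = 0 := by linarith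
  simpa [hX0] using d

end TraceFree

section AlignedPair

variable {J1 J2 J3 : V →ₗ[ℝ] V} {n : ℕ}

theorem qClosed_range {g : V →ₗ[ℝ] V} (hg : QLinear J1 J2 J3 g) :
    QClosed J1 J2 J3 (Set.range g) := by
  rintro _ ⟨X, rfl⟩
  exact ⟨⟨J1 X, hg.map1 X⟩, ⟨J2 X, hg.map2 X⟩, ⟨J3 X, hg.map3 X⟩⟩

theorem aligned_apply_J1 {R : Tri V} (hR : R ∈ calVhat J1 J2 J3) {P B : V →ₗ[ℝ] V}
    (hRa : R ∈ alignedSub P B) {v : V} (hv : B v = J1 v) (X : V) : R X v (J1 v) = 0 := by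
  have b := (hRa X v v).2.2.2.2
  rw [hv] at b
  linarith [hR.1 X (J1 v) v]

theorem aligned_apply_J3 (h : IsQH J1 J2 J3) {R : Tri V} (hR : R ∈ calVhat J1 J2 J3)
    {P B : V →ₗ[ℝ] V} (hRa : R ∈ alignedSub P B) {v : V} (hv : B v = J1 v) (X : V) :
    R X v (J3 v) = -R (B X) v (J2 v) := by
  have b := (hRa X v (J2 v)).2.2.2.1
  rw [hv, calVhat_move h hR, h.2.2.2.1] at b
  linarith

/-- A form aligned with a projection onto two quaternionic lines vanishes on one of them. -/
theorem aligned_line_eq_zero (h : IsQH J1 J2 J3) {e : OrthonormalBasis (Fin (4 * n)) ℝ V}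
    {R : Tri V} (hR : R ∈ QK4set J1 J2 J3 e) {P B : V →ₗ[ℝ] V} (hB : QLinear J1 J2 J3 B)
    (hRa : R ∈ alignedSub P B) {v : V} (hv : B v = J1 v) (X Y Z : V) :
    R (qdyad J1 J2 J3 v v X) (qdyad J1 J2 J3 v v Y) (qdyad J1 J2 J3 v v Z) = 0 := by
  have s0 : ∀ X Y, R X Y Y = 0 := fun X Y => by linarith [hR.1.1 X Y Y]
  have m1 := calVhat_move h hR.1
  have m2 := calVhat_move h.cyclic (calVhat_cyclic hR.1)
  have m3 := calVhat_move h.cyclic.cyclic (calVhat_cyclic (calVhat_cyclic hR.1))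
  have a1 := aligned_apply_J1 hR.1 hRa hv
  have a3 := aligned_apply_J3 h hR.1 hRa hv
  have b0 := a3 v
  have b1 := a3 (J1 v)
  have b2 := a3 (J2 v)
  have b3 := a3 (J3 v)
  have l01 := QK4set_law hR v v (J1 v)
  have l02 := QK4set_law hR v v (J2 v)
  have l03 := QK4set_law hR v v (J3 v)
  have l11 := QK4set_law hR (J1 v) v (J1 v)
  have l12 := QK4set_law hR (J1 v) v (J2 v)
  have l13 := QK4set_law hR (J1 v) v (J3 v)
  have l21 := QK4set_law hR (J2 v) v (J1 v)
  have l22 := QK4set_law hR (J2 v) v (J2 v)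
  have l23 := QK4set_law hR (J2 v) v (J3 v)
  have l31 := QK4set_law hR (J3 v) v (J1 v)
  have l32 := QK4set_law hR (J3 v) v (J2 v)
  have l33 := QK4set_law hR (J3 v) v (J3 v)
  have hh := h
  obtain ⟨h11, h22, h33, h12, h21, h23, h32, h31, h13, i1, i2, i3⟩ := h
  simp only [hB.map1, hB.map2, hB.map3, hv, m1, m2, m3, h11, h22, h33, h12, h21, h23, h32, h31, h13,
    map_neg, LinearMap.neg_apply, s0, a1, neg_zero, neg_neg]
    at b0 b1 b2 b3 l01 l02 l03 l11 l12 l13 l21 l22 l23 l31 l32 l33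
  refine apply_qdyad_left_eq_zero ?_ ?_ ?_ ?_ v X <;>
  · refine calVhat_qdyad_eq_zero hh hR.1 (a1 _) ?_ ?_ v v Y Z <;> linarith

theorem eq_zero_of_aligned_pair (h : IsQH J1 J2 J3) {e : OrthonormalBasis (Fin (4 * n)) ℝ V}
    {R : Tri V} (hR : R ∈ QK4set J1 J2 J3 e) {u v : V} (hu : ⟪u, u⟫ = 1) (hv : ⟪v, v⟫ = 1)
    (huv : QOrth J1 J2 J3 u v)
    (hRa : R ∈ alignedSub (qdyad J1 J2 J3 u u + qdyad J1 J2 J3 v v)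
      (qdyad J1 J2 J3 u (J1 u) + qdyad J1 J2 J3 v (J1 v)))
    (hodd : pull (rotMap (qdyad J1 J2 J3 v v) (qdyad J1 J2 J3 v (J1 v)) (-1) 0) R = -R)
    (h0 : R v u (J2 u) = 0) (h1 : R (J1 v) u (J2 u) = 0) (h2 : R (J2 v) u (J2 u) = 0)
    (h3 : R (J3 v) u (J2 u) = 0) : R = 0 := by
  set Pu := qdyad J1 J2 J3 u u with hPu
  set Pv := qdyad J1 J2 J3 v v with hPv
  set B := qdyad J1 J2 J3 u (J1 u) + qdyad J1 J2 J3 v (J1 v) with hBdef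
  have hvu := huv.symm h
  have hQu : QLinear J1 J2 J3 Pu := qdyad_qLinear h u u
  have hQv : QLinear J1 J2 J3 Pv := qdyad_qLinear h v v
  have hB : QLinear J1 J2 J3 B := (qdyad_qLinear h u _).add (qdyad_qLinear h v _)
  have hBu : B u = J1 u := by
    simp only [hBdef, LinearMap.add_apply, qdyad_unit h hu, hvu.qdyad_eq_zero, add_zero]
  have hBv : B v = J1 v := by
    simp only [hBdef, LinearMap.add_apply, qdyad_unit h hv, huv.qdyad_eq_zero, zero_add]
  have hvPu : ∀ X, Pv (Pu X) = 0 := fun X =>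
    ((qOrth_qdyad_left h huv X).symm h).qdyad_eq_zero v
  have hvPv : ∀ X, Pv (Pv X) = Pv X := (isRot_qdyad h hv).PP
  have hBPv : ∀ X, B (Pv X) = Pv (qdyad J1 J2 J3 v (J1 v) X) := fun X => by
    simp only [hBdef, LinearMap.add_apply, (isRot_qdyad h hv).BP, (isRot_qdyad h hv).PB, hPv]
    rw [((qOrth_qdyad_left h hvu X).symm h).qdyad_eq_zero, zero_add]
  have hvuu : ∀ X Y Z, R (Pv X) (Pu Y) (Pu Z) = 0 := fun X Y Z => by
    have a2 : ∀ X, R (Pv X) u (J2 u) = 0 := apply_qdyad_left_eq_zero h0 h1 h2 h3 v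
    refine calVhat_qdyad_eq_zero h hR.1 (aligned_apply_J1 hR.1 hRa hBu _) (a2 X) ?_ u u Y Z
    rw [aligned_apply_J3 h hR.1 hRa hBu, hBPv, a2, neg_zero]
  have hvuu' : ∀ z ∈ Set.range Pv, ∀ x ∈ Set.range Pu, ∀ y ∈ Set.range Pu, R z x y = 0 := by
    rintro _ ⟨X, rfl⟩ _ ⟨Y, rfl⟩ _ ⟨Z, rfl⟩
    exact hvuu X Y Z
  have hu' : u ∈ Set.range Pu := ⟨u, qdyad_unit h hu u⟩
  have hcu := qClosed_range hQu
  have hcv := qClosed_range hQv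
  have j1 := fun Z hZ => QK4set_apply_J1_J1 h hR hcu hcv hvuu' hu' (Z := Z) hZ
  have j2 := fun Z hZ => QK4set_apply_J1_J1 h.cyclic (QK4set_cyclic hR) hcu.cyclic hcv.cyclic hvuu'
    hu' (Z := Z) hZ
  have j3 := fun Z hZ => QK4set_apply_J1_J1 h.cyclic.cyclic (QK4set_cyclic (QK4set_cyclic hR))
    hcu.cyclic.cyclic hcv.cyclic.cyclic hvuu' hu' (Z := Z) hZ
  have huuZ : ∀ Z ∈ Set.range Pv, R u u Z = 0 := fun Z hZ => by
    have a := (hRa u (J1 u) Z).2.2.2.1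
    rw [hBu, hB.map1, hBu, h.1, j1 Z hZ, map_neg, LinearMap.neg_apply] at a
    linarith
  have huuv : ∀ X Y, ∀ Z ∈ Set.range Pv, R (Pu X) (Pu Y) Z = 0 := by
    intro X Y Z hZ
    have key : ∀ Z ∈ Set.range Pv, R (Pu X) u Z = 0 := by
      intro Z hZ
      refine apply_qdyad_left_eq_zero (huuZ Z hZ) ?_ ?_ ?_ u X
      · rw [← hR.1.2.1, j1 _ (hcv Z hZ).1, huuZ _ (hcv Z hZ).1]
      · rw [← hR.1.2.2.1, j2 _ (hcv Z hZ).2.1, huuZ _ (hcv Z hZ).2.1]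
      · rw [← hR.1.2.2.2, j3 _ (hcv Z hZ).2.2, huuZ _ (hcv Z hZ).2.2]
    have m1 := calVhat_move h hR.1
    have m2 := calVhat_move h.cyclic (calVhat_cyclic hR.1)
    have m3 := calVhat_move h.cyclic.cyclic (calVhat_cyclic (calVhat_cyclic hR.1))
    rw [hPu, qdyad_apply u u Y, ← hPu]
    simp only [map_add, map_smul, LinearMap.add_apply, LinearMap.smul_apply, m1, m2, m3, key Z hZ,
      key _ (hcv Z hZ).1, key _ (hcv Z hZ).2.1, key _ (hcv Z hZ).2.2, neg_zero, smul_zero, add_zero]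
  have hpull : ∀ X Y Z, R (X - Pv X - Pv X) (Y - Pv Y - Pv Y) (Z - Pv Z - Pv Z) = -R X Y Z := by
    intro X Y Z
    have a := congrArg (fun S : Tri V => S X Y Z) hodd
    simpa [sub_eq_add_neg] using a
  refine tri_ext fun X Y Z => ?_
  rw [← (hRa X Y Z).1, ← (hRa _ Y Z).2.1, ← (hRa _ _ Z).2.2.1]
  have e1 := hpull (Pu X) (Pu Y) (Pu Z)
  have e2 := hpull (Pu X) (Pv Y) (Pv Z)
  have e3 := hpull (Pv X) (Pu Y) (Pv Z)
  have e4 := hpull (Pv X) (Pv Y) (Pu Z)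
  have f1 := huuv X Y _ ⟨Z, rfl⟩
  have f2 := huuv X Z _ ⟨Y, rfl⟩
  have f3 := aligned_line_eq_zero h hR hB hRa hBv X Y Z
  have f4 := hR.1.1 (Pu X) (Pu Z) (Pv Y)
  have f5 := hvuu X Y Z
  simp only [hvPu, hvPv, sub_zero, sub_self, zero_sub, map_neg, LinearMap.neg_apply, neg_neg]
    at e1 e2 e3 e4
  simp only [← hPv] at f3
  simp only [LinearMap.add_apply, map_add, LinearMap.zero_apply]
  linarith

end AlignedPair

section TraceFreeIrreducible

variable {J1 J2 J3 : V →ₗ[ℝ] V} {n : ℕ}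

/-- `𝒬𝒦₄` as a submodule. -/
def qk4Sub (J1 J2 J3 : V →ₗ[ℝ] V) (e : OrthonormalBasis (Fin (4 * n)) ℝ V) :
    Submodule ℝ (Tri V) where
  carrier := QK4set J1 J2 J3 e
  zero_mem' := ⟨(calVhatSub J1 J2 J3).zero_mem, by simp, by simp [c12]⟩
  add_mem' := fun ha hb => ⟨calVhat_add ha.1 hb.1, fun X Y Z => by
    have a := ha.2.1 X Y Z
    have b := hb.2.1 X Y Z
    simp only [LinearMap.add_apply]
    linarith, fun Z => by
    have a := ha.2.2 Z
    have b := hb.2.2 Z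
    simp only [c12] at a b
    simp only [c12, LinearMap.add_apply, Finset.sum_add_distrib, a, b, add_zero]⟩
  smul_mem' := fun c T ha => ⟨calVhat_smul c ha.1, fun X Y Z => by
    have a := ha.2.1 X Y Z
    simp only [LinearMap.smul_apply, smul_eq_mul]
    linear_combination c * a, fun Z => by
    have a := ha.2.2 Z
    simp only [c12] at a
    simp only [c12, LinearMap.smul_apply, smul_eq_mul, ← Finset.mul_sum, a, mul_zero]⟩

theorem qk4Sub_actInv (h : IsQH J1 J2 J3) (e : OrthonormalBasis (Fin (4 * n)) ℝ V) :
    ActInv J1 J2 J3 (qk4Sub J1 J2 J3 e) :=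
  fun _ hA _ hS => act_mem_QKfam h e 3 hA hS

/-- Trilinear forms that are odd under the pullback along `g`. -/
def oddSub (g : V →ₗ[ℝ] V) : Submodule ℝ (Tri V) where
  carrier := {R | ∀ X Y Z, R (g X) (g Y) (g Z) = -R X Y Z}
  zero_mem' := by simp
  add_mem' := fun ha hb X Y Z => by
    simp only [LinearMap.add_apply, ha X Y Z, hb X Y Z]
    ring
  smul_mem' := fun c R ha X Y Z => by
    simp only [LinearMap.smul_apply, ha X Y Z, smul_neg]

theorem pull_mem_oddSub {g f : V →ₗ[ℝ] V} (hfg : ∀ X, f (g X) = g (f X)) {R : Tri V}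
    (hR : R ∈ oddSub g) : pull f R ∈ oddSub g := by
  intro X Y Z
  simpa only [pull_apply, hfg] using hR (f X) (f Y) (f Z)

theorem weightForm_mul_eq_zero_of_unit_pair (h : IsQH J1 J2 J3)
    (e : OrthonormalBasis (Fin (4 * n)) ℝ V) {W W' : Submodule ℝ (Tri V)}
    (hWQ : W ≤ qk4Sub J1 J2 J3 e) (hWQ' : W' ≤ qk4Sub J1 J2 J3 e)
    (hW : ActInv J1 J2 J3 W) (hW' : ActInv J1 J2 J3 W') (hd : Disjoint W W') {T T' : Tri V}
    (hT : T ∈ W) (hT' : T' ∈ W') {u v : V} (hu : ⟪u, u⟫ = 1) (hv : ⟪v, v⟫ = 1)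
    (huv : QOrth J1 J2 J3 u v) :
    weightForm J1 J2 J3 T v u * weightForm J1 J2 J3 T' v u = 0 := by
  have := finiteDimensional_of_orthonormalBasis e
  have hvu := huv.symm h
  have hru := isRot_qdyad h hu
  have hrv := isRot_qdyad h hv
  have zuv : ∀ X, qdyad J1 J2 J3 u u (qdyad J1 J2 J3 v v X) = 0 := fun X =>
    ((qOrth_qdyad_left h hvu X).symm h).qdyad_eq_zero u
  have zvu : ∀ X, qdyad J1 J2 J3 v v (qdyad J1 J2 J3 u u X) = 0 := fun X =>
    ((qOrth_qdyad_left h huv X).symm h).qdyad_eq_zero v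
  set P := qdyad J1 J2 J3 u u + qdyad J1 J2 J3 v v with hPdef
  set B := qdyad J1 J2 J3 u (J1 u) + qdyad J1 J2 J3 v (J1 v) with hBdef
  set σ := rotMap (qdyad J1 J2 J3 v v) (qdyad J1 J2 J3 v (J1 v)) (-1) 0 with hσdef
  have hP : QLinear J1 J2 J3 P := (qdyad_qLinear h u u).add (qdyad_qLinear h v v)
  have hB : QLinear J1 J2 J3 B := (qdyad_qLinear h u _).add (qdyad_qLinear h v _)
  have hσ : QLinear J1 J2 J3 σ := (qdyad_qLinear h v v).rotMap (qdyad_qLinear h v _) _ _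
  have hr : IsRot P B := hru.add hrv zuv zvu
  have hσi : PreservesInner σ := hrv.preservesInner (by norm_num)
  obtain ⟨hσσ, hσP, hσB⟩ : (∀ X, σ (σ X) = X) ∧ (∀ X, σ (P X) = P (σ X)) ∧
      ∀ X, σ (B X) = B (σ X) := by
    have zvB : ∀ X, qdyad J1 J2 J3 v v (qdyad J1 J2 J3 u (J1 u) X) = 0 := fun X => by
      rw [← hru.PB, zvu]
    have zBv : ∀ X, qdyad J1 J2 J3 u (J1 u) (qdyad J1 J2 J3 v v X) = 0 := fun X => by
      rw [← hru.BP, zuv, map_zero]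
    refine ⟨fun X => ?_, fun X => ?_, fun X => ?_⟩ <;>
    simp only [hσdef, hPdef, hBdef, rotMap_apply, LinearMap.add_apply, map_add, map_sub, map_smul,
      zero_smul, add_zero, hrv.PP, hrv.PB, hrv.BP, zuv, zvu, zvB, zBv] <;>
    module
  have hPu : P u = u := by
    simp only [hPdef, LinearMap.add_apply, qdyad_unit h hu, hvu.qdyad_eq_zero, add_zero]
  have hPv : P v = v := by
    simp only [hPdef, LinearMap.add_apply, qdyad_unit h hv, huv.qdyad_eq_zero, zero_add]
  have hBu : B u = J1 u := by
    simp only [hBdef, LinearMap.add_apply, qdyad_unit h hu, hvu.qdyad_eq_zero, add_zero]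
  have hBv : B v = J1 v := by
    simp only [hBdef, LinearMap.add_apply, qdyad_unit h hv, huv.qdyad_eq_zero, zero_add]
  have hσu : σ u = u := by
    simp [hσdef, hvu.qdyad_eq_zero]
  have hσv : σ v = -v := by
    simp [hσdef, qdyad_unit h hv]
  let M := qk4Sub J1 J2 J3 e ⊓ (alignedSub P B ⊓ oddSub σ)
  have hmem : ∀ {W : Submodule ℝ (Tri V)} {T : Tri V}, W ≤ qk4Sub J1 J2 J3 e →
      ActInv J1 J2 J3 W → T ∈ W → fourPi P B T - pull σ (fourPi P B T) ∈ W ∧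
        fourPi P B T - pull σ (fourPi P B T) ∈ M ∧
        (fourPi P B T - pull σ (fourPi P B T)) v u (J2 u) = 4 * weightForm J1 J2 J3 T v u := by
    intro W T hWQ hW hT
    have hS := hW.fourPi_mem hr hP hB hT
    have hRW := W.sub_mem hS (hW.pull_mem hσi hσ hS)
    have hSa := fourPi_mem_alignedSub hr T
    refine ⟨hRW, ⟨hWQ hRW, (alignedSub P B).sub_mem hSa (pull_mem_alignedSub hσP hσB hSa),
      fun X Y Z => ?_⟩, ?_⟩
    · simp only [LinearMap.sub_apply, pull_apply, hσσ]
      ring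
    · have a := fourPi_apply_self h hP hB (hWQ hT).1 hPv hBv hPu hBu
      simp only [LinearMap.sub_apply, pull_apply, hσv, hσu, hσ.map2, map_neg,
        LinearMap.neg_apply, a]
      ring
  have hq := qk4Sub_actInv h e
  obtain ⟨hR, hRM, hRv⟩ := hmem hWQ hW hT
  obtain ⟨hR', hRM', hRv'⟩ := hmem hWQ' hW' hT'
  have key := eq_zero_or_eq_zero_of_coordinates h (M := M) (z := v) (u := u) (w := J2 u) hW hd
    (fun R hR => hR.1.1)
    (fun R hR => ⟨⟨(hq.pull_J_mem h hR.1).1,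
        pull_mem_alignedSub (fun X => (hP.map1 X).symm) (fun X => (hB.map1 X).symm) hR.2.1,
        pull_mem_oddSub (fun X => (hσ.map1 X).symm) hR.2.2⟩,
      ⟨(hq.pull_J_mem h hR.1).2.1,
        pull_mem_alignedSub (fun X => (hP.map2 X).symm) (fun X => (hB.map2 X).symm) hR.2.1,
        pull_mem_oddSub (fun X => (hσ.map2 X).symm) hR.2.2⟩,
      ⟨(hq.pull_J_mem h hR.1).2.2,
        pull_mem_alignedSub (fun X => (hP.map3 X).symm) (fun X => (hB.map3 X).symm) hR.2.1,
        pull_mem_oddSub (fun X => (hσ.map3 X).symm) hR.2.2⟩⟩)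
    (fun R hR => eq_zero_of_aligned_pair h hR.1 hu hv huv hR.2.1 (tri_ext hR.2.2))
    hR hRM hR' hRM'
  rcases key with k | k
  · rw [k] at hRv
    rw [show weightForm J1 J2 J3 T v u = 0 by simpa using hRv.symm, zero_mul]
  · rw [k] at hRv'
    rw [show weightForm J1 J2 J3 T' v u = 0 by simpa using hRv'.symm, mul_zero]

theorem weightForm_mul_eq_zero_of_qOrth (h : IsQH J1 J2 J3)
    (e : OrthonormalBasis (Fin (4 * n)) ℝ V) {W W' : Submodule ℝ (Tri V)}
    (hWQ : W ≤ qk4Sub J1 J2 J3 e) (hWQ' : W' ≤ qk4Sub J1 J2 J3 e)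
    (hW : ActInv J1 J2 J3 W) (hW' : ActInv J1 J2 J3 W') (hd : Disjoint W W') {T T' : Tri V}
    (hT : T ∈ W) (hT' : T' ∈ W') {u v : V} (huv : QOrth J1 J2 J3 u v) :
    weightForm J1 J2 J3 T v u * weightForm J1 J2 J3 T' v u = 0 := by
  rcases eq_or_ne u 0 with rfl | hu
  · simp [weightForm]
  rcases eq_or_ne v 0 with rfl | hv
  · simp [weightForm]
  have h1 := weightForm_mul_eq_zero_of_unit_pair h e hWQ hWQ' hW hW' hd hT hT'
    (inner_normalize_self hu) (inner_normalize_self hv) ((huv.smul_left _).smul_right _)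
  simpa [weightForm_smul, hu, hv] using h1

theorem exists_weightForm_ne_zero_of_qOrth (h : IsQH J1 J2 J3) (hn : 2 ≤ n)
    {e : OrthonormalBasis (Fin (4 * n)) ℝ V} {W : Submodule ℝ (Tri V)}
    (hWQ : W ≤ qk4Sub J1 J2 J3 e) (hne : W ≠ ⊥) :
    ∃ T ∈ W, ∃ u v, QOrth J1 J2 J3 u v ∧ weightForm J1 J2 J3 T v u ≠ 0 := by
  by_contra! hc
  refine hne (W.eq_bot_iff.2 fun T hT => ?_)
  exact (vanishesOrth_of_weightForm h (hWQ hT).1 fun v u hvu =>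
    hc T hT u v (hvu.symm h)).eq_zero h hn (hWQ hT)

theorem weightForm_smul_sub_qdyad {u v : V} (huv : QOrth J1 J2 J3 u v) (T : Tri V) :
    weightForm J1 J2 J3 T (⟪u, u⟫ • v - qdyad J1 J2 J3 u u v) u =
      ⟪u, u⟫ * weightForm J1 J2 J3 T v u := by
  rw [huv.qdyad_eq_zero, sub_zero]
  simpa using weightForm_smul (J1 := J1) (J2 := J2) (J3 := J3) T ⟪u, u⟫ 1 v u

theorem analyticAt_inner {a b : ℝ → V} {t : ℝ} (ha : AnalyticAt ℝ a t)
    (hb : AnalyticAt ℝ b t) : AnalyticAt ℝ (fun s => ⟪a s, b s⟫) t :=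
  ((innerSL ℝ).analyticAt_bilinear (a t, b t)).comp₂ ha hb

theorem analyticAt_smul_sub_qdyad [FiniteDimensional ℝ V] {a b : ℝ → V} {t : ℝ}
    (ha : AnalyticAt ℝ a t) (hb : AnalyticAt ℝ b t) :
    AnalyticAt ℝ (fun s => ⟪a s, a s⟫ • b s - qdyad J1 J2 J3 (a s) (a s) (b s)) t := by
  simp only [qdyad_apply]
  have h1 := analyticAt_linear J1 ha
  have h2 := analyticAt_linear J2 ha
  have h3 := analyticAt_linear J3 ha
  exact ((analyticAt_inner ha ha).smul hb).sub (((((analyticAt_inner ha hb).smul ha).add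
    ((analyticAt_inner h1 hb).smul h1)).add ((analyticAt_inner h2 hb).smul h2)).add
    ((analyticAt_inner h3 hb).smul h3))

theorem irreducible_QK4set (h : IsQH J1 J2 J3) (hn : 2 ≤ n)
    (e : OrthonormalBasis (Fin (4 * n)) ℝ V)
    {W : Submodule ℝ (Tri V)} (hWQ : (W : Set (Tri V)) ⊆ QK4set J1 J2 J3 e)
    (hW : ActInv J1 J2 J3 W) :
    (W : Set (Tri V)) = {0} ∨ (W : Set (Tri V)) = QK4set J1 J2 J3 e := by
  have := finiteDimensional_of_orthonormalBasis e
  refine (eq_bot_or_eq_of_forall_disjoint e (qk4Sub_actInv h e)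
    (fun W W' hWQ hWQ' hW hW' hd => ?_) hWQ hW).imp
    (fun hb => by simp [hb]) fun hq => by rw [hq]; rfl
  by_contra! hne
  obtain ⟨T, hT, u, v, huv, hu⟩ := exists_weightForm_ne_zero_of_qOrth h hn hWQ hne.1
  obtain ⟨T', hT', u', v', huv', hu'⟩ := exists_weightForm_ne_zero_of_qOrth h hn hWQ' hne.2
  have hpos : ∀ {T : Tri V} {u v : V}, QOrth J1 J2 J3 u v → weightForm J1 J2 J3 T v u ≠ 0 →
      weightForm J1 J2 J3 T (⟪u, u⟫ • v - qdyad J1 J2 J3 u u v) u ≠ 0 := by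
    intro T u v huv hne
    rw [weightForm_smul_sub_qdyad huv]
    refine mul_ne_zero (inner_self_ne_zero.2 ?_) hne
    rintro rfl
    exact hne (by simp [weightForm])
  rcases forall_weightForm_eq_zero_or e
    (fun t => analyticAt_smul_sub_qdyad (analyticAt_segment u u' t) (analyticAt_segment v v' t))
    (analyticAt_segment u u')
    (fun t => weightForm_mul_eq_zero_of_qOrth h e hWQ hWQ' hW hW' hd hT hT'
      (qOrth_smul_sub_qdyad h _ _)) with k | k
  · exact hpos huv hu (by simpa using k 0)
  · exact hpos huv' hu' (by simpa using k 1)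

end TraceFreeIrreducible

end

/-- classification theorem: for `n ≥ 2`,
`𝒱 = 𝒬𝒦₁ ⊕ 𝒬𝒦₂ ⊕ 𝒬𝒦₃ ⊕ 𝒬𝒦₄ ⊕ 𝒬𝒦₅`, an orthogonal direct sum of subspaces that are
invariant and irreducible under the `Sp(n)Sp(1)`-transformations. -/
theorem stmt15 (J1 J2 J3 : V →ₗ[ℝ] V) (hQH : IsQH J1 J2 J3)
    {n : ℕ} (hn : 2 ≤ n) (hdim : Module.finrank ℝ V = 4 * n)
    (e : OrthonormalBasis (Fin (4*n)) ℝ V) :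
    (∀ i, QKfam J1 J2 J3 e i ⊆ calV J1 J2 J3) ∧
    (∀ i j, i ≠ j → ∀ S ∈ QKfam J1 J2 J3 e i, ∀ S' ∈ QKfam J1 J2 J3 e j,
      tinner e S S' = 0) ∧
    (∀ S ∈ calV J1 J2 J3, ∃ f : Fin 5 → Tri V,
      (∀ i, f i ∈ QKfam J1 J2 J3 e i) ∧ S = ∑ i, f i) ∧
    (∀ i,
      (∀ A : V ≃ₗᵢ[ℝ] V, IsSpnSp1 J1 J2 J3 A →
        ∀ S ∈ QKfam J1 J2 J3 e i, act A S ∈ QKfam J1 J2 J3 e i) ∧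
      (∀ W : Submodule ℝ (Tri V), (W : Set (Tri V)) ⊆ QKfam J1 J2 J3 e i →
        (∀ A : V ≃ₗᵢ[ℝ] V, IsSpnSp1 J1 J2 J3 A → ∀ S ∈ W, act A S ∈ W) →
        ((W : Set (Tri V)) = {0} ∨ (W : Set (Tri V)) = QKfam J1 J2 J3 e i))) := by
  refine ⟨QKfam_subset_calV hQH e, fun i j hij S hS S' hS' => tinner_QKfam_of_ne e hQH hij hS hS',
    fun S hS => exists_eq_sum_of_mem_calV e hQH hS,
    fun i => ⟨fun A hA S hS => act_mem_QKfam hQH e i hA hS, fun W hWQ hW => ?_⟩⟩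
  fin_cases i
  · exact irreducible_calVcheck0perp hQH e hWQ hW
  · exact irreducible_calVcheck0 hQH e hWQ hW
  · exact irreducible_TthetaSet hQH e hWQ hW
  · exact irreducible_QK4set hQH hn e hWQ hW
  · exact irreducible_QK5set hQH e hWQ hW

end
end

section
/- For n ≥ 2, every element of 𝒬𝒦₂ ⊕ 𝒬𝒦₄ ⊕ 𝒬𝒦₅ is traceless with respect to c₁₂ (so lies in the Tricerri–Vanhecke class 𝒯_{2+3} = {S ∈ 𝒯(V) : c₁₂(S) = 0}), and every element T of 𝒬𝒦₅ satisfies both c₁₂(T) = 0 and T_{XYZ} + T_{YZX} + T_{ZXY} = 0 (so lies in the Tricerri–Vanhecke class 𝒯₂ = {S ∈ 𝒯(V) : c₁₂(S) = 0 and 𝔖_{XYZ}S_{XYZ} = 0}). -/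
open scoped RealInnerProductSpace

noncomputable section

variable {V : Type} [NormedAddCommGroup V] [InnerProductSpace ℝ V]

theorem inner_map_eq_neg {J : V →ₗ[ℝ] V} (hJ : ∀ X, J (J X) = -X)
    (hI : ∀ X Y, ⟪J X, J Y⟫ = ⟪X, Y⟫) (X Y : V) : ⟪J X, Y⟫ = -⟪X, J Y⟫ := by
  rw [← hI (J X) Y, hJ, inner_neg_left]

/-- The metric trace of a bilinear form is unchanged by an orthogonal complex structure. -/
theorem sum_map_map_eq {ι : Type} [Fintype ι] (e : OrthonormalBasis ι ℝ V) {J : V →ₗ[ℝ] V}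
    (hJ : ∀ X, J (J X) = -X) (hI : ∀ X Y, ⟪J X, J Y⟫ = ⟪X, Y⟫) (B : V →ₗ[ℝ] V →ₗ[ℝ] ℝ) :
    ∑ r, B (J (e r)) (J (e r)) = ∑ r, B (e r) (e r) := by
  have expand_left : ∀ r, B (J (e r)) (J (e r))
      = ∑ s, ⟪e s, J (e r)⟫ * B (e s) (J (e r)) := by
    intro r
    calc B (J (e r)) (J (e r)) = B (∑ s, ⟪e s, J (e r)⟫ • e s) (J (e r)) := by
          rw [e.sum_repr' (J (e r))]
      _ = _ := by simp [LinearMap.sum_apply]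
  have expand_right : ∀ s, B (e s) (e s) = ∑ r, ⟪e s, J (e r)⟫ * B (e s) (J (e r)) := by
    intro s
    calc B (e s) (e s) = B (e s) (J (-J (e s))) := by rw [map_neg, hJ, neg_neg]
      _ = B (e s) (J (∑ r, ⟪e s, J (e r)⟫ • e r)) := by
          congr 2
          rw [← e.sum_repr' (-J (e s))]
          refine Finset.sum_congr rfl fun r _ => ?_
          rw [inner_neg_right, real_inner_comm, inner_map_eq_neg hJ hI, neg_neg]
      _ = _ := by simp
  simp_rw [expand_left, expand_right]
  exact Finset.sum_comm

theorem c12_eq_zero_of_mem_QK5set {J1 J2 J3 : V →ₗ[ℝ] V} (hQH : IsQH J1 J2 J3) {n : ℕ}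
    (e : OrthonormalBasis (Fin (4*n)) ℝ V) {T : Tri V} (hT : T ∈ QK5set J1 J2 J3) (Z : V) :
    c12 e T Z = 0 := by
  obtain ⟨h11, h22, -, h12, h21, -, -, -, -, hI1, hI2, -⟩ := hQH
  obtain ⟨⟨skew, inv1, inv2, -⟩, cyclic⟩ := hT
  have trace_J1 : ∀ W, ∑ r, T W (e r) (J1 (e r)) = 0 := by
    intro W
    have h := sum_map_map_eq e h22 hI2 ((T W).compl₂ J1)
    simp only [LinearMap.compl₂_apply] at h
    have h' : ∀ r, T W (J2 (e r)) (J1 (J2 (e r))) = -T W (e r) (J1 (e r)) := by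
      intro r
      rw [← inv2 W (e r), h12, h21, map_neg, neg_neg]
    simp_rw [h', Finset.sum_neg_distrib] at h
    linarith
  have trace_at_J1 : ∀ W, c12 e T (J1 W) = 0 := by
    intro W
    have h := sum_map_map_eq e h11 hI1 (T.compr₂ (LinearMap.applyₗ (J1 W)))
    simp only [LinearMap.compr₂_apply, LinearMap.applyₗ_apply_apply] at h
    have hpt : ∀ r, T W (e r) (J1 (e r))
        = T (e r) (e r) (J1 W) + T (J1 (e r)) (J1 (e r)) (J1 W) := by
      intro r
      have hc := cyclic W (e r) (J1 (e r))
      have h1 := inv1 (e r) (J1 (e r)) W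
      rw [h11, map_neg, LinearMap.neg_apply] at h1
      have h2 := inv1 (J1 (e r)) (e r) W
      have h3 := skew (J1 (e r)) W (e r)
      linarith
    have h0 := trace_J1 W
    simp_rw [hpt, Finset.sum_add_distrib] at h0
    unfold c12
    linarith
  have h := trace_at_J1 (-J1 Z)
  rwa [map_neg, h11, neg_neg] at h

theorem sum_mul_inner_map {ι : Type} [Fintype ι] (e : OrthonormalBasis ι ℝ V) {J : V →ₗ[ℝ] V}
    (hJ : ∀ X, J (J X) = -X) (hI : ∀ X Y, ⟪J X, J Y⟫ = ⟪X, Y⟫) (π : V →ₗ[ℝ] ℝ) (Z : V) :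
    ∑ r, π (e r) * ⟪J (e r), Z⟫ = -π (J Z) := by
  conv_rhs => rw [← e.sum_repr' (J Z)]
  simp [inner_map_eq_neg hJ hI, mul_comm]

theorem c12_eq_zero_of_mem_calVcheck0 {J1 J2 J3 : V →ₗ[ℝ] V} (hQH : IsQH J1 J2 J3) {n : ℕ}
    (e : OrthonormalBasis (Fin (4*n)) ℝ V) {S : Tri V} (hS : S ∈ calVcheck0 J1 J2 J3) (Z : V) :
    c12 e S Z = 0 := by
  obtain ⟨h11, h22, h33, -, -, -, -, -, -, hI1, hI2, hI3⟩ := hQH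
  obtain ⟨π1, π2, π3, hS, hπ⟩ := hS
  simp only [c12, hS, Finset.sum_add_distrib, sum_mul_inner_map e h11 hI1,
    sum_mul_inner_map e h22 hI2, sum_mul_inner_map e h33 hI3]
  linarith [hπ Z]

theorem calVcheck0_subset_calT {J1 J2 J3 : V →ₗ[ℝ] V} (hQH : IsQH J1 J2 J3) :
    calVcheck0 J1 J2 J3 ⊆ calT := by
  obtain ⟨h11, h22, h33, -, -, -, -, -, -, hI1, hI2, hI3⟩ := hQH
  rintro S ⟨π1, π2, π3, hS, -⟩ X Y Z
  rw [hS, hS, inner_map_eq_neg h11 hI1 Y, inner_map_eq_neg h22 hI2 Y,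
    inner_map_eq_neg h33 hI3 Y, real_inner_comm Y, real_inner_comm Y, real_inner_comm Y]
  ring

/-- every element of `𝒬𝒦₂ ⊕ 𝒬𝒦₄ ⊕ 𝒬𝒦₅` is traceless w.r.t. `c₁₂` (hence
lies in the Tricerri–Vanhecke class `𝒯_{2+3}`), and every `T ∈ 𝒬𝒦₅` moreover has
vanishing cyclic sum (hence lies in `𝒯₂`). -/
theorem stmt16 (J1 J2 J3 : V →ₗ[ℝ] V) (hQH : IsQH J1 J2 J3)
    {n : ℕ} (hn : 2 ≤ n) (hdim : Module.finrank ℝ V = 4 * n)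
    (e : OrthonormalBasis (Fin (4*n)) ℝ V) :
    (∀ S2 ∈ calVcheck0 J1 J2 J3, ∀ S4 ∈ QK4set J1 J2 J3 e, ∀ S5 ∈ QK5set J1 J2 J3,
      (∀ X Y Z : V, (S2 + S4 + S5) X Y Z = -((S2 + S4 + S5) X Z Y)) ∧
      (∀ Z, c12 e (S2 + S4 + S5) Z = 0)) ∧
    (∀ T ∈ QK5set J1 J2 J3,
      (∀ X Y Z : V, T X Y Z = - T X Z Y) ∧
      (∀ Z, c12 e T Z = 0) ∧
      (∀ X Y Z : V, T X Y Z + T Y Z X + T Z X Y = 0)) := by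
  refine ⟨fun S2 h2 S4 h4 S5 h5 => ⟨fun X Y Z => ?_, fun Z => ?_⟩,
    fun T hT => ⟨hT.1.1, c12_eq_zero_of_mem_QK5set hQH e hT, hT.2⟩⟩
  · have hs2 := calVcheck0_subset_calT hQH h2 X Y Z
    have hs4 := h4.1.1 X Y Z
    have hs5 := h5.1.1 X Y Z
    simp only [LinearMap.add_apply]
    linarith
  · have ht2 := c12_eq_zero_of_mem_calVcheck0 hQH e h2 Z
    have ht4 := h4.2.2 Z
    have ht5 := c12_eq_zero_of_mem_QK5set hQH e h5 Z
    simp only [c12] at ht2 ht4 ht5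
    simp only [c12, LinearMap.add_apply, Finset.sum_add_distrib, ht2, ht4, ht5, add_zero]

end
end
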